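/- Let 𝒞 be a G-conformal algebra and χ: G → ℂ× an injective linear character. Then the (G,χ)-equivariant φ-coordinated quasi V_𝒞-modules (W, Y_W^φ, d) are exactly the restricted 𝒞̃[G]-modules W, under the correspondence d = 𝐝 and Y_W^φ(u,z) = u[z] = ∑_{n∈ℤ} (image of u[n] in 𝒞̄[G]) z^{-n} for u ∈ 𝒞. -/

import Mathlib

noncomputable section
open scoped BigOperators

/-- The generalized binomial coefficient `binom(m, i) = m(m-1)⋯(m-i+1)/i!` as a complex
number, for `m : ℤ`. -/
def intChoose (m : ℤ) (i : ℕ) : ℂ :=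
  (∏ j ∈ Finset.range i, ((m : ℂ) - (j : ℂ))) / (Nat.factorial i : ℂ)

/-- A vertex algebra over `ℂ`, presented through its modes: `Y v n` is the operator `v_n`,
so that `Y(v,z) = ∑_{n ∈ ℤ} v_n z^{-n-1}`. -/
structure VertexAlg (V : Type) [AddCommGroup V] [Module ℂ V] where
  /-- the modes `v ↦ vₙ` of the vertex operator `Y(v,z) = ∑ₙ vₙ z^{-n-1}` -/
  Y : V → ℤ → Module.End ℂ V
  /-- the vacuum vector -/
  one : V
  Y_add : ∀ u v n, Y (u + v) n = Y u n + Y v n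
  Y_smul : ∀ (c : ℂ) u n, Y (c • u) n = c • Y u n
  /-- lower truncation: `uₙ v = 0` for `n` sufficiently large -/
  trunc : ∀ u v, ∃ N : ℤ, ∀ n, N ≤ n → Y u n v = 0
  /-- `Y(𝟏, z) = id` -/
  vacuum_Y : ∀ n, Y one n = if n = -1 then 1 else 0
  /-- creation: `Y(v,z)𝟏 ∈ V[[z]]` -/
  create : ∀ v n, 0 ≤ n → Y v n one = 0
  /-- creation: `Y(v,z)𝟏|_{z=0} = v` -/
  create_neg_one : ∀ v, Y v (-1) one = v
  /-- the Borcherds (Jacobi) identity in coefficient form -/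
  borcherds : ∀ u v w : V, ∀ m n k : ℤ,
    (∑ᶠ i : ℕ, intChoose m i • Y (Y u (n + i) v) (m + k - i) w) =
      ∑ᶠ i : ℕ, ((-1 : ℂ) ^ i * intChoose n i) •
        (Y u (m + n - i) (Y v (k + i) w)
          - ((-1 : ℂ) ^ n) • Y v (n + k - i) (Y u (m + i) w))

namespace VertexAlg

variable {V : Type} [AddCommGroup V] [Module ℂ V]

/-- the canonical derivation `𝒟 v = v₋₂𝟏` of a vertex algebra -/
def D (VA : VertexAlg V) (v : V) : V := VA.Y v (-2) VA.one

/-- a linear automorphism of `V` is an automorphism of the vertex algebra `VA` if it fixes the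
vacuum and intertwines all modes. -/
def IsAuto (VA : VertexAlg V) (g : V ≃ₗ[ℂ] V) : Prop :=
  g VA.one = VA.one ∧ ∀ u n v, g (VA.Y u n v) = VA.Y (g u) n (g v)

/-- an ideal of a vertex algebra: a subspace stable under left and right modes. -/
def IsIdeal (VA : VertexAlg V) (I : Submodule ℂ V) : Prop :=
  ∀ u ∈ I, ∀ (v : V) (n : ℤ), VA.Y u n v ∈ I ∧ VA.Y v n u ∈ I

/-- a vertex algebra is simple if its only ideals are `⊥` and `⊤`. -/
def IsSimpleVA (VA : VertexAlg V) : Prop :=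
  ∀ I : Submodule ℂ V, IsIdeal VA I → I = ⊥ ∨ I = ⊤

end VertexAlg

/-- Coefficient of `z₁^m z₂^k` in `f(z₁/z₂) A(z₁) B(z₂)`, where `A(z) = ∑ₙ (A n) zⁿ`,
`B(z) = ∑ₙ (B n) zⁿ` are fields written with `n`-th coefficient convention. -/
def pCoeff2 {W : Type} [AddCommGroup W] [Module ℂ W]
    (A B : ℤ → Module.End ℂ W) (f : Polynomial ℂ) (m k : ℤ) :
    Module.End ℂ W :=
  ∑ i ∈ f.support, f.coeff i • (A (m - i) * B (k + i))

/-- coefficient of `z^s` in `e^{i z}` -/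
def expC (i : ℕ) (s : ℤ) : ℂ :=
  if 0 ≤ s then (i : ℂ) ^ s.toNat / (Nat.factorial s.toNat : ℂ) else 0

/-- coefficient of `z₀^r` in `e^{m z₀}` (the substitution `z₁ = z₂ e^{z₀}` applied to `z₁^m`
produces `z₂^m e^{m z₀}`). -/
def subC (m : ℤ) (r : ℤ) : ℂ :=
  if 0 ≤ r then (m : ℂ) ^ r.toNat / (Nat.factorial r.toNat : ℂ) else 0

/-- A `(G,χ)`-equivariant `φ`-coordinated quasi module for a vertex algebra `VA`, where
`φ(z₂,z₀) = z₂ e^{z₀}`.  The field `Y_W^φ(v,z)` is recorded through its coefficients: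
`Y_W^φ(v,z) = ∑_{n ∈ ℤ} (E v n) zⁿ`. -/
structure PhiMod {V : Type} [AddCommGroup V] [Module ℂ V] (VA : VertexAlg V)
    {G : Type} [Group G] (ρ : G →* (V ≃ₗ[ℂ] V)) (χ : G →* ℂˣ)
    (W : Type) [AddCommGroup W] [Module ℂ W] where
  /-- `E v n` is the coefficient of `zⁿ` in `Y_W^φ(v, z)` -/
  E : V → ℤ → Module.End ℂ W
  E_add : ∀ u v n, E (u + v) n = E u n + E v n
  E_smul : ∀ (c : ℂ) v n, E (c • v) n = c • E v n
  /-- `Y_W^φ(v,z) ∈ Hom(W, W((z)))` -/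
  lower_trunc : ∀ v w, ∃ N : ℤ, ∀ n, n < N → E v n w = 0
  /-- `Y_W^φ(𝟏,z) = 1_W` -/
  vacuum : ∀ n, E VA.one n = if n = 0 then 1 else 0
  /-- `Y_W^φ(gv, z) = Y_W^φ(v, χ(g)z)` -/
  equivar : ∀ (g : G) (v : V) (n : ℤ), E (ρ g v) n = (((χ g : ℂ)) ^ n) • E v n
  /-- for all `u,v` there is `f ∈ ℂ_{χ(G)}[z]` such that
  `f(z₁/z₂) Y^φ(u,z₁) Y^φ(v,z₂) ∈ Hom(W, W((z₁,z₂)))` and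
  `f(e^{z₀}) Y^φ(Y(u,z₀)v, z₂) = (f(z₁/z₂)Y^φ(u,z₁)Y^φ(v,z₂))|_{z₁ = z₂e^{z₀}}`,
  both written out in coefficients (of `z₁^m z₂^k`, resp. of `z₀^r z₂^n`). -/
  assoc : ∀ u v : V, ∃ f : Polynomial ℂ, f ≠ 0 ∧
    (∀ c : ℂ, f.IsRoot c → ∃ g : G, ((χ g : ℂ)) = c) ∧
    (∀ w : W, ∃ N : ℤ, ∀ m k : ℤ, (m < N ∨ k < N) →
      pCoeff2 (E u) (E v) f m k w = 0) ∧
    (∀ (r n : ℤ) (w : W),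
      (∑ᶠ j : ℤ, (∑ i ∈ f.support, f.coeff i * expC i (r + j + 1)) • E (VA.Y u j v) n w)
        = ∑ᶠ m : ℤ, subC m r • pCoeff2 (E u) (E v) f m (n - m) w)

/-- a `(G,χ)`-equivariant `φ`-coordinated quasi module `(W, Y_W^φ, d)`: additionally an
endomorphism `d` with `[d, Y_W^φ(v,z)] = Y_W^φ(𝒟v, z)`. -/
structure PhiModD {V : Type} [AddCommGroup V] [Module ℂ V] (VA : VertexAlg V)
    {G : Type} [Group G] (ρ : G →* (V ≃ₗ[ℂ] V)) (χ : G →* ℂˣ)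
    (W : Type) [AddCommGroup W] [Module ℂ W] extends PhiMod VA ρ χ W where
  d : Module.End ℂ W
  d_comm : ∀ (v : V) (n : ℤ), d * E v n - E v n * d = E (VA.D v) n

end
noncomputable section
/-- A conformal algebra (vertex Lie algebra) over `ℂ`: a space `C` with a linear operator
`∂` and products `uᵢv` (`i ∈ ℕ`), i.e. `Y⁻(u,z)v = ∑_{i ≥ 0} (uᵢv) z^{-i-1}`, subject to
the translation, skew-symmetry and Jacobi axioms (written in coefficients). -/
structure ConformalAlg (C : Type) [AddCommGroup C] [Module ℂ C] where
  /-- the translation operator `∂` -/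
  der : Module.End ℂ C
  /-- the `i`-th product `uᵢv` -/
  prod : ℕ → C → C → C
  prod_add_left : ∀ i u u' v, prod i (u + u') v = prod i u v + prod i u' v
  prod_add_right : ∀ i u v v', prod i u (v + v') = prod i u v + prod i u v'
  prod_smul_left : ∀ i (c : ℂ) u v, prod i (c • u) v = c • prod i u v
  prod_smul_right : ∀ i (c : ℂ) u v, prod i u (c • v) = c • prod i u v
  /-- `Y⁻(u,z)v ∈ z⁻¹C[z⁻¹]`: finitely many nonzero products -/
  loc : ∀ u v, ∃ N : ℕ, ∀ i, N ≤ i → prod i u v = 0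
  /-- `[∂, Y⁻(u,z)] = Y⁻(∂u, z)` -/
  der_prod : ∀ i u v, der (prod i u v) - prod i u (der v) = prod i (der u) v
  /-- `Y⁻(∂u, z) = (d/dz) Y⁻(u,z)`, i.e. `(∂u)ᵢv = -i u_{i-1}v` -/
  der_left : ∀ i u v, prod i (der u) v = (-(i : ℂ)) • prod (i - 1) u v
  /-- skew symmetry: `Y⁻(u,z)v = Sing(e^{z∂} Y⁻(v,-z)u)` -/
  skew : ∀ (n : ℕ) u v, prod n u v =
    ∑ᶠ j : ℕ, (((-1 : ℂ) ^ (n + j + 1)) / (Nat.factorial j : ℂ)) • (der ^ j) (prod (n + j) v u)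
  /-- `[Y⁻(u,z), Y⁻(v,w)] = Sing (Y⁻(Y⁻(u,z-w)v, w))` -/
  jacobi : ∀ (m n : ℕ) u v w, prod m u (prod n v w) - prod n v (prod m u w)
      = ∑ᶠ j : ℕ, ((m.choose j : ℂ)) • prod (m + n - j) (prod j u v) w

namespace ConformalAlg

variable {C : Type} [AddCommGroup C] [Module ℂ C]

/-- the operator `1⊗∂ + d/dt⊗1` on `ℂ[t,t⁻¹] ⊗ C ≅ (ℤ →₀ C)`:
`tᵐ ⊗ u ↦ tᵐ ⊗ ∂u + m t^{m-1} ⊗ u`. -/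
def hatD (CA : ConformalAlg C) : (ℤ →₀ C) →ₗ[ℂ] (ℤ →₀ C) :=
  Finsupp.lsum ℂ fun m : ℤ =>
    (Finsupp.lsingle m).comp CA.der + (m : ℂ) • (Finsupp.lsingle (m - 1)).comp (LinearMap.id)

/-- the underlying space of the Lie algebra
`𝒞̂ = ℂ[t,t⁻¹] ⊗ 𝒞 / (1⊗∂ + d/dt⊗1)(ℂ[t,t⁻¹] ⊗ 𝒞)`. -/
abbrev hatC (CA : ConformalAlg C) : Type := (ℤ →₀ C) ⧸ LinearMap.range CA.hatD

/-- the projection `ℂ[t,t⁻¹] ⊗ 𝒞 → 𝒞̂` -/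
def hatmk (CA : ConformalAlg C) : (ℤ →₀ C) →ₗ[ℂ] CA.hatC :=
  Submodule.mkQ _

/-- `u(m)`, the image of `tᵐ ⊗ u` in `𝒞̂` -/
def gen (CA : ConformalAlg C) (u : C) (m : ℤ) : CA.hatC :=
  CA.hatmk (Finsupp.single m u)

end ConformalAlg

/-- Data presenting the universal enveloping vertex algebra `V_𝒞` of a conformal algebra
`𝒞`: a vertex algebra `V` together with an embedding `ι : 𝒞 → V` compatible with `∂` and
with the nonnegative products, and universal among such. -/
structure UnivVA {C : Type} [AddCommGroup C] [Module ℂ C] (CA : ConformalAlg C)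
    (V : Type) [AddCommGroup V] [Module ℂ V] where
  va : VertexAlg V
  ι : C →ₗ[ℂ] V
  ι_der : ∀ u, ι (CA.der u) = va.D (ι u)
  ι_prod : ∀ (i : ℕ) (u v : C), va.Y (ι u) (i : ℤ) (ι v) = ι (CA.prod i u v)
  univ : ∀ (V' : Type) [AddCommGroup V'] [Module ℂ V'] (va' : VertexAlg V')
      (ι' : C →ₗ[ℂ] V'),
      (∀ u, ι' (CA.der u) = va'.D (ι' u)) →
      (∀ (i : ℕ) (u v : C), va'.Y (ι' u) (i : ℤ) (ι' v) = ι' (CA.prod i u v)) →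
      ∃! F : V →ₗ[ℂ] V', F va.one = va'.one ∧
        (∀ (u : V) (n : ℤ) (v : V), F (va.Y u n v) = va'.Y (F u) n (F v)) ∧
        (∀ u : C, F (ι u) = ι' u)

/-- A restricted module `W` for the covariance Lie algebra `𝒞̃[G] = 𝒞̄[G] ⋊ ℂ𝐝`, described
through the action operators: `T u n` is the action of `u[n]‾` (the image of `tⁿ ⊗ u`), and
`d` the action of `𝐝`.  The bracket relations of `𝒞̃[G]` are
`[u[m]‾, v[n]‾] = ∑_{g ∈ G} ∑_{i ≥ 0} χ(g)^m (mⁱ/i!) ((gu)ᵢv)[m+n]‾`,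
`(∂u)[m]‾ = -m u[m]‾`, `(gu)[m]‾ = χ(g)^{-m} u[m]‾`, `[𝐝, u[m]‾] = -m u[m]‾`;
restrictedness states `u[z] = ∑ₙ u[n]‾ z^{-n} ∈ Hom(W, W((z)))`. -/
structure CTildeGMod {C : Type} [AddCommGroup C] [Module ℂ C] (CA : ConformalAlg C)
    {G : Type} [Group G] (ρC : G →* (C ≃ₗ[ℂ] C)) (χ : G →* ℂˣ)
    (W : Type) [AddCommGroup W] [Module ℂ W] where
  T : C → ℤ → Module.End ℂ W
  T_add : ∀ u v n, T (u + v) n = T u n + T v n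
  T_smul : ∀ (c : ℂ) u n, T (c • u) n = c • T u n
  d : Module.End ℂ W
  rel : ∀ (u v : C) (m n : ℤ),
    T u m * T v n - T v n * T u m =
      ∑ᶠ g : G, ∑ᶠ i : ℕ,
        (((χ g : ℂ) ^ m) * ((m : ℂ) ^ i / (Nat.factorial i : ℂ))) •
          T (CA.prod i (ρC g u) v) (m + n)
  der_rel : ∀ u m, T (CA.der u) m = (-(m : ℂ)) • T u m
  collapse : ∀ (g : G) u m, T (ρC g u) m = ((χ g : ℂ) ^ (-m : ℤ)) • T u m
  d_rel : ∀ u m, d * T u m - T u m * d = (-(m : ℂ)) • T u m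
  res : ∀ u w, ∃ N : ℤ, ∀ n, N ≤ n → T u n w = 0

noncomputable section

/-- The group algebra of `Γ` over `ℂ` acts on functions on `Γ` by convolution. -/
def cv (Γ : Type) [AddCommGroup Γ] : AddMonoidAlgebra ℂ Γ →ₐ[ℂ] Module.End ℂ (Γ → ℂ) :=
  AddMonoidAlgebra.lift ℂ _ Γ
    { toFun := fun δ => LinearMap.funLeft ℂ ℂ fun γ => γ - δ.toAdd
      map_one' := by
        ext A γ
        simp [LinearMap.funLeft_apply]
      map_mul' := by
        intro x y
        apply LinearMap.ext
        intro A
        funext γ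
        simp [LinearMap.funLeft_apply, sub_sub] }

theorem cv_single {Γ : Type} [AddCommGroup Γ] (δ : Γ) (c : ℂ) (A : Γ → ℂ) (γ : Γ) :
    cv Γ (AddMonoidAlgebra.single δ c) A γ = c * A (γ - δ) := by
  simp [cv, AddMonoidAlgebra.lift_single, LinearMap.funLeft_apply]

theorem cv_mul {Γ : Type} [AddCommGroup Γ] (f g : AddMonoidAlgebra ℂ Γ) (A : Γ → ℂ) :
    cv Γ (f * g) A = cv Γ f (cv Γ g A) := by
  rw [map_mul, Module.End.mul_apply]

theorem cv_comm {Γ : Type} [AddCommGroup Γ] (f g : AddMonoidAlgebra ℂ Γ) (A : Γ → ℂ) :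
    cv Γ f (cv Γ g A) = cv Γ g (cv Γ f A) := by
  rw [← cv_mul, ← cv_mul, mul_comm]

theorem cv_add {Γ : Type} [AddCommGroup Γ] (f g : AddMonoidAlgebra ℂ Γ) (A : Γ → ℂ) :
    cv Γ (f + g) A = cv Γ f A + cv Γ g A := by
  rw [map_add, LinearMap.add_apply]

/-- Convolution along a homomorphism is convolution along its fibres. -/
theorem cv_mapDomain {Γ Δ : Type} [AddCommGroup Γ] [AddCommGroup Δ] (h : Γ →+ Δ)
    (f : AddMonoidAlgebra ℂ Γ) (A : Δ → ℂ) (δ : Δ) (γ : Γ) :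
    cv Δ (AddMonoidAlgebra.mapDomainAlgHom ℂ ℂ h f) A (δ + h γ) = cv Γ f (fun n => A (δ + h n)) γ := by
  induction f using AddMonoidAlgebra.induction_linear with
  | zero => simp
  | add x y hx hy => rw [map_add, cv_add, cv_add, Pi.add_apply, Pi.add_apply, hx, hy]
  | single m r =>
    rw [AddMonoidAlgebra.mapDomainAlgHom_apply, AddMonoidAlgebra.mapDomain_single, cv_single,
      cv_single]
    simp [add_sub_assoc]

/-- Convolution preserves finiteness of the support. -/
theorem cv_finite {Γ : Type} [AddCommGroup Γ] (f : AddMonoidAlgebra ℂ Γ) (A : Γ → ℂ)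
    (hA : A.support.Finite) : (cv Γ f A).support.Finite := by
  induction f using AddMonoidAlgebra.induction_linear with
  | zero => simp
  | add x y hx hy =>
    rw [cv_add]
    exact (hx.union hy).subset (Function.support_add _ _)
  | single m r =>
    apply (hA.image fun γ => γ + m).subset
    intro γ hγ
    rw [Function.mem_support, cv_single] at hγ
    exact ⟨γ - m, fun h => hγ (by rw [h, mul_zero]), by simp⟩

instance laurentSeriesAlgebra {A : Type} [CommRing A] [Algebra ℂ A] :
    Algebra ℂ (LaurentSeries A) :=
  HahnSeries.instAlgebra

/-- Formal exponential series `e^{at}` as a Laurent series. -/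
def exL {A : Type} [CommRing A] [Algebra ℚ A] (a : A) : LaurentSeries A :=
  HahnSeries.ofPowerSeries ℤ A (PowerSeries.rescale a (PowerSeries.exp A))

theorem exL_add {A : Type} [CommRing A] [Algebra ℚ A] (a b : A) :
    exL (a + b) = exL a * exL b := by
  rw [exL, exL, exL, ← map_mul, PowerSeries.exp_mul_exp_eq_exp_add]

theorem exL_zero {A : Type} [CommRing A] [Algebra ℚ A] : exL (0 : A) = 1 := by
  rw [exL, PowerSeries.rescale_zero]
  simp

/-- Evaluation of Laurent polynomials at `T = e^t`. -/
def ev : AddMonoidAlgebra ℂ ℤ →ₐ[ℂ] LaurentSeries ℂ :=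
  AddMonoidAlgebra.lift ℂ _ ℤ
    { toFun := fun i => exL ((i.toAdd : ℤ) : ℂ)
      map_one' := by simp [exL_zero]
      map_mul' := by
        intro x y
        simp [exL_add] }

theorem ev_single (i : ℤ) (c : ℂ) :
    ev (AddMonoidAlgebra.single i c) = c • exL (i : ℂ) := by
  rw [ev, AddMonoidAlgebra.lift_single]
  rfl

theorem exL_coeff (a : ℂ) (n : ℤ) : (exL a).coeff n =
    if n < 0 then 0 else a ^ n.natAbs / (n.natAbs.factorial : ℂ) := by
  rw [exL, PowerSeries.coeff_coe]
  simp [PowerSeries.coeff_rescale, PowerSeries.coeff_exp, div_eq_mul_inv]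

theorem ev_eq_sum (f : AddMonoidAlgebra ℂ ℤ) :
    ev f = ∑ i ∈ f.coeff.support, f.coeff i • exL (i : ℂ) := by
  rw [ev, AddMonoidAlgebra.lift_apply]
  rfl

theorem ev_injective : Function.Injective ev := by
  rw [injective_iff_map_eq_zero]
  intro f hf
  have hli := linearIndependent_monoidHom (Multiplicative ℕ) ℂ
  let φ : ℤ → (Multiplicative ℕ →* ℂ) := fun i =>
    { toFun := fun n => (i : ℂ) ^ n.toAdd
      map_one' := by simp
      map_mul' := by intro x y; simp [pow_add] }
  have hφ : Function.Injective φ := by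
    intro i j hij
    have := DFunLike.congr_fun hij (Multiplicative.ofAdd 1)
    simpa [φ] using this
  have h2 := linearIndependent_iff'.1 (hli.comp φ hφ) f.coeff.support f.coeff
  have h3 : ∀ i ∈ f.coeff.support, f.coeff i = 0 := by
    apply h2
    funext n
    have h4 := congrArg (fun E => HahnSeries.coeff E ((n.toAdd : ℕ) : ℤ)) hf
    rw [ev_eq_sum] at h4
    simp only [HahnSeries.coeff_sum, HahnSeries.coeff_smul, HahnSeries.coeff_zero, exL_coeff] at h4
    have hn : ((n.toAdd.factorial : ℕ) : ℂ) ≠ 0 := by exact_mod_cast Nat.factorial_ne_zero _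
    have h5 : ∑ i ∈ f.coeff.support, f.coeff i * (i : ℂ) ^ n.toAdd = 0 := by
      have h6 := congrArg (fun x => x * ((n.toAdd.factorial : ℕ) : ℂ)) h4
      simp only [zero_mul, Finset.sum_mul] at h6
      rw [← h6]
      refine Finset.sum_congr rfl fun i _ => ?_
      have h7 : ¬ (((n.toAdd : ℕ) : ℤ) < 0) := by omega
      simp only [h7, if_false, Int.natAbs_natCast, smul_eq_mul]
      field_simp
    simpa [φ] using h5
  have h4 : f.coeff = 0 := by
    ext i
    by_cases hi : i ∈ f.coeff.support
    · exact h3 i hi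
    · simpa using hi
  exact AddMonoidAlgebra.coeff_injective h4

theorem ev_ne_zero {f : AddMonoidAlgebra ℂ ℤ} (hf : f ≠ 0) : ev f ≠ 0 := by
  rw [Ne, map_eq_zero_iff ev ev_injective]
  exact hf

instance : IsDomain (AddMonoidAlgebra ℂ ℤ) :=
  Function.Injective.isDomain ev.toRingHom ev_injective

/-- A finitely supported function is its own symbol applied to the delta function. -/
theorem cv_symbol {Γ : Type} [AddCommGroup Γ] [DecidableEq Γ] (f : AddMonoidAlgebra ℂ Γ) :
    cv Γ f (Pi.single 0 1) = f.coeff := by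
  induction f using AddMonoidAlgebra.induction_linear with
  | zero => simp
  | add x y hx hy => rw [cv_add, hx, hy]; simp
  | single m r =>
    funext γ
    rw [cv_single, AddMonoidAlgebra.coeff_single, Finsupp.single_apply, Pi.single_apply]
    simp [sub_eq_zero, eq_comm]

theorem exists_epsilon : ∃ ε : (ℤ → ℂ) →ₗ[ℂ] LaurentSeries ℂ,
    (∀ f A, ε (cv ℤ f A) = ev f * ε A) ∧ ε (Pi.single 0 1) = 1 := by
  let _ : Module (AddMonoidAlgebra ℂ ℤ) (LaurentSeries ℂ) := Module.compHom _ ev.toRingHom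
  let _ : Module (AddMonoidAlgebra ℂ ℤ) (ℤ → ℂ) := Module.compHom (ℤ → ℂ) (cv ℤ).toRingHom
  have hL : ∀ (f : AddMonoidAlgebra ℂ ℤ) (E : LaurentSeries ℂ), f • E = ev f * E := fun _ _ => rfl
  have hS : ∀ (f : AddMonoidAlgebra ℂ ℤ) (A : ℤ → ℂ), f • A = cv ℤ f A := fun _ _ => rfl
  have hB : Module.Baer (AddMonoidAlgebra ℂ ℤ) (LaurentSeries ℂ) := by
    intro I g
    by_cases hI : I = ⊥
    · subst hI
      refine ⟨0, fun x mem => ?_⟩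
      have : (⟨x, mem⟩ : (⊥ : Ideal (AddMonoidAlgebra ℂ ℤ))) = 0 := Subtype.ext (by simpa using mem)
      rw [this, map_zero]; rfl
    · obtain ⟨f, hfI, hf⟩ := Submodule.exists_mem_ne_zero_of_ne_bot hI
      refine ⟨LinearMap.toSpanSingleton _ _ (g ⟨f, hfI⟩ / ev f), fun x mem => ?_⟩
      rw [LinearMap.toSpanSingleton_apply, hL]
      have h1 : f • g ⟨x, mem⟩ = x • g ⟨f, hfI⟩ := by
        rw [← map_smul, ← map_smul]
        congr 1
        exact Subtype.ext (mul_comm _ _)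
      rw [hL, hL] at h1
      have := ev_ne_zero hf
      field_simp
      rw [← h1, mul_comm]
  let i : AddMonoidAlgebra ℂ ℤ →ₗ[AddMonoidAlgebra ℂ ℤ] (ℤ → ℂ) :=
    LinearMap.toSpanSingleton _ _ (Pi.single 0 1)
  have hi : ∀ f, i f = f.coeff := fun f => by
    rw [LinearMap.toSpanSingleton_apply, hS, cv_symbol]
  obtain ⟨h, hh⟩ := hB.extension_property i (by
    intro f g hfg
    rw [hi, hi] at hfg
    exact AddMonoidAlgebra.coeff_injective (DFunLike.coe_injective hfg))
    (LinearMap.toSpanSingleton _ _ (1 : LaurentSeries ℂ))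
  have hsm : ∀ f A, h (cv ℤ f A) = ev f * h A := fun f A => by rw [← hS, map_smul, hL]
  refine ⟨{ toFun := h, map_add' := map_add h, map_smul' := ?_ }, hsm, ?_⟩
  · intro c A
    have h1 := hsm (algebraMap ℂ _ c) A
    rw [AlgHom.commutes, AlgHom.commutes, Module.algebraMap_end_apply, ← Algebra.smul_def] at h1
    exact h1
  · have := LinearMap.congr_fun hh 1
    simpa [i] using this

end

noncomputable section

/-- A chosen `ℂ[T^{±1}]`-linear summation functional with `T` acting on the right as `e^t`. -/
def eps : (ℤ → ℂ) →ₗ[ℂ] LaurentSeries ℂ := Classical.choose exists_epsilon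

theorem eps_cv (f : AddMonoidAlgebra ℂ ℤ) (A : ℤ → ℂ) : eps (cv ℤ f A) = ev f * eps A :=
  (Classical.choose_spec exists_epsilon).1 f A

theorem eps_symbol (f : AddMonoidAlgebra ℂ ℤ) : eps f.coeff = ev f := by
  rw [← cv_symbol, eps_cv, eps, (Classical.choose_spec exists_epsilon).2, mul_one]

theorem exists_symbol {Γ : Type} [AddCommGroup Γ] {A : Γ → ℂ} (hA : A.support.Finite) :
    ∃ f : AddMonoidAlgebra ℂ Γ, A = f.coeff :=
  ⟨AddMonoidAlgebra.ofCoeff (Finsupp.ofSupportFinite A hA), rfl⟩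

/-- All coefficients below `q` vanish. -/
def Low {A : Type} [Zero A] (q : ℤ) (E : LaurentSeries A) : Prop := ∀ κ < q, E.coeff κ = 0

theorem exists_low {A : Type} [Zero A] (E : LaurentSeries A) : ∃ q, Low q E :=
  ⟨E.order, fun _ hκ => HahnSeries.coeff_eq_zero_of_lt_order hκ⟩

theorem Low.mul {A : Type} [Ring A] {p q : ℤ} {E F : LaurentSeries A} (hE : Low p E)
    (hF : Low q F) : Low (p + q) (E * F) := by
  intro κ hκ
  rw [HahnSeries.coeff_mul]
  refine Finset.sum_eq_zero fun ij hij => ?_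
  rw [Finset.mem_antidiagonal] at hij
  by_cases h : ij.1 < p
  · rw [hE _ h, zero_mul]
  · rw [hF ij.2 (by omega), mul_zero]

theorem low_ofPowerSeries {A : Type} [Ring A] (g : PowerSeries A) :
    Low 0 (HahnSeries.ofPowerSeries ℤ A g) := by
  intro κ hκ
  rw [PowerSeries.coeff_coe, if_pos hκ]

theorem coeff_ofPowerSeries_mul {A : Type} [Ring A] (g : PowerSeries A) {q : ℤ}
    {E : LaurentSeries A} (hE : Low q E) (κ : ℤ) {n : ℕ} (hn : κ - q + 1 ≤ n) :
    (HahnSeries.ofPowerSeries ℤ A g * E).coeff κ =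
      ∑ r ∈ Finset.range n, PowerSeries.coeff r g * E.coeff (κ - r) := by
  rw [HahnSeries.coeff_mul]
  refine Finset.sum_of_injOn (fun ij => ij.1.natAbs) ?_ ?_ ?_ ?_
  · intro x hx y hy hxy
    simp only [Finset.mem_coe, Finset.mem_antidiagonal, HahnSeries.mem_support] at hx hy
    have hx0 : 0 ≤ x.1 := by
      by_contra h
      exact hx.1 (low_ofPowerSeries g _ (not_le.1 h))
    have hy0 : 0 ≤ y.1 := by
      by_contra h
      exact hy.1 (low_ofPowerSeries g _ (not_le.1 h))
    simp only at hxy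
    have h1 : x.1 = y.1 := by omega
    exact Prod.ext h1 (by omega)
  · intro x hx
    simp only [Finset.mem_coe, Finset.mem_antidiagonal, HahnSeries.mem_support] at hx
    have hx0 : 0 ≤ x.1 := by
      by_contra h
      exact hx.1 (low_ofPowerSeries g _ (not_le.1 h))
    have hq : q ≤ x.2 := by
      by_contra h
      exact hx.2.1 (hE _ (not_le.1 h))
    simp only [Finset.coe_range, Set.mem_Iio]
    omega
  · intro r hr hr'
    by_contra h
    refine hr' ⟨((r : ℤ), κ - r), ?_, by simp⟩
    simp only [Finset.mem_coe, Finset.mem_antidiagonal, HahnSeries.mem_support]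
    refine ⟨?_, right_ne_zero_of_mul h, by ring⟩
    rw [HahnSeries.ofPowerSeries_apply_coeff]
    exact left_ne_zero_of_mul h
  · intro x hx
    simp only [Finset.mem_antidiagonal, HahnSeries.mem_support] at hx
    have hx0 : 0 ≤ x.1 := by
      by_contra h
      exact hx.1 (low_ofPowerSeries g _ (not_le.1 h))
    rw [PowerSeries.coeff_coe, if_neg (not_lt.2 hx0)]
    congr 2
    omega

theorem low_ev (f : AddMonoidAlgebra ℂ ℤ) : Low 0 (ev f) := by
  intro κ hκ
  rw [ev_eq_sum, HahnSeries.coeff_sum]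
  refine Finset.sum_eq_zero fun i _ => ?_
  rw [HahnSeries.coeff_smul, exL_coeff, if_pos hκ, smul_zero]

theorem low_eps_of_finite {A : ℤ → ℂ} (hA : A.support.Finite) : Low 0 (eps A) := by
  obtain ⟨f, rfl⟩ := exists_symbol hA
  rw [eps_symbol]
  exact low_ev f

theorem eps_bound {f : AddMonoidAlgebra ℂ ℤ} (hf : f ≠ 0) :
    ∃ q : ℤ, ∀ A : ℤ → ℂ, (cv ℤ f A).support.Finite → Low q (eps A) := by
  obtain ⟨q, hq⟩ := exists_low (ev f)⁻¹
  refine ⟨q, fun A hA => ?_⟩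
  have h1 := hq.mul (low_eps_of_finite hA)
  rw [eps_cv, inv_mul_cancel_left₀ (ev_ne_zero hf), add_zero] at h1
  exact h1

end

noncomputable section

/-- Laurent series in an outer variable with Laurent series coefficients. -/
abbrev KK : Type := @LaurentSeries (LaurentSeries ℂ) MulZeroClass.toZero

/-- The inner summations of the array `A` are uniformly bounded below. -/
def BB (q : ℤ) (A : ℤ × ℤ → ℂ) : Prop := ∀ p, Low q (eps fun j => A (p, j))

/-- `α` is the iterated summation of the array `A`. -/
def IsE2 (A : ℤ × ℤ → ℂ) (α : KK) : Prop :=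
  ∀ κ, α.coeff κ = eps fun p => (eps fun j => A (p, j)).coeff κ

theorem BB.exists_isE2 {q : ℤ} {A : ℤ × ℤ → ℂ} (h : BB q A) : ∃ α, IsE2 A α := by
  refine ⟨HahnSeries.ofSuppBddBelow (fun κ => eps fun p => (eps fun j => A (p, j)).coeff κ)
    ⟨q, fun κ hκ => not_lt.1 fun hlt => hκ ?_⟩, fun κ => ?_⟩
  · have : (fun p => (eps fun j => A (p, j)).coeff κ) = 0 := by
      funext p
      exact h p κ hlt
    beta_reduce
    rw [this, map_zero]
  · exact congrFun HahnSeries.coeff_ofSuppBddBelow κ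

theorem IsE2.low {q : ℤ} {A : ℤ × ℤ → ℂ} {α : KK} (hA : BB q A) (h : IsE2 A α) : Low q α := by
  intro κ hκ
  rw [h κ]
  have : (fun p => (eps fun j => A (p, j)).coeff κ) = 0 := by
    funext p
    exact hA p κ hκ
  rw [this, map_zero]

/-- Evaluation of two-variable Laurent polynomials at the exponentials of the two variables. -/
def ev2 : AddMonoidAlgebra ℂ (ℤ × ℤ) →ₐ[ℂ] KK :=
  AddMonoidAlgebra.lift ℂ _ (ℤ × ℤ)
    { toFun := fun i => HahnSeries.C (exL ((i.toAdd.1 : ℤ) : ℂ)) *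
        exL ((i.toAdd.2 : ℤ) : LaurentSeries ℂ)
      map_one' := by simp [exL_zero]
      map_mul' := by
        intro x y
        simp only [toAdd_mul, Prod.fst_add, Prod.snd_add, Int.cast_add, exL_add, map_mul]
        ring }

theorem ev2_single (i j : ℤ) (c : ℂ) :
    ev2 (AddMonoidAlgebra.single (i, j) c) =
      c • (HahnSeries.C (exL (i : ℂ)) * exL (j : LaurentSeries ℂ)) := by
  rw [ev2, AddMonoidAlgebra.lift_single]
  rfl

theorem coeff_rescale_exp (j : ℤ) (r : ℕ) :
    PowerSeries.coeff r (PowerSeries.rescale (j : LaurentSeries ℂ)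
      (PowerSeries.exp (LaurentSeries ℂ))) = HahnSeries.C ((j : ℂ) ^ r / (r.factorial : ℂ)) := by
  rw [PowerSeries.coeff_rescale, PowerSeries.coeff_exp]
  have h1 : (algebraMap ℚ (LaurentSeries ℂ)) (1 / (r.factorial : ℚ)) =
      HahnSeries.C (1 / (r.factorial : ℂ)) := by
    have := RingHom.congr_fun (Subsingleton.elim (algebraMap ℚ (LaurentSeries ℂ))
      ((HahnSeries.C : ℂ →+* LaurentSeries ℂ).comp (algebraMap ℚ ℂ))) (1 / (r.factorial : ℚ))
    rw [this]
    simp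
  have h2 : (j : LaurentSeries ℂ) = HahnSeries.C (j : ℂ) := (map_intCast _ j).symm
  rw [h1, h2, ← map_pow, ← map_mul, mul_one_div]

theorem Low.smul {q : ℤ} {E : LaurentSeries ℂ} (h : Low q E) (c : ℂ) : Low q (c • E) := by
  intro κ hκ
  rw [HahnSeries.coeff_smul, h κ hκ, smul_zero]

theorem Low.add {A : Type} [AddMonoid A] {q : ℤ} {E F : LaurentSeries A} (h : Low q E)
    (h' : Low q F) : Low q (E + F) := by
  intro κ hκ
  rw [HahnSeries.coeff_add, h κ hκ, h' κ hκ, zero_add]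

theorem eps_shift (j : ℤ) (c : ℂ) (B : ℤ → ℂ) :
    eps (fun n => c * B (n - j)) = c • (exL (j : ℂ) * eps B) := by
  rw [← smul_mul_assoc, ← ev_single, ← eps_cv]
  congr 1
  funext n
  rw [cv_single]

theorem low_exL (a : ℂ) : Low 0 (exL a) := low_ofPowerSeries _

theorem BB.cv {q : ℤ} {A : ℤ × ℤ → ℂ} (h : BB q A) (F : AddMonoidAlgebra ℂ (ℤ × ℤ)) :
    BB q (_root_.cv _ F A) := by
  induction F using AddMonoidAlgebra.induction_linear with
  | zero =>
    intro p κ _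
    have : (fun j => _root_.cv (ℤ × ℤ) 0 A (p, j)) = 0 := by
      funext j
      simp
    rw [this, map_zero, HahnSeries.coeff_zero]
  | add x y hx hy =>
    intro p
    have : (fun j => _root_.cv (ℤ × ℤ) (x + y) A (p, j)) =
        (fun j => _root_.cv (ℤ × ℤ) x A (p, j)) + fun j => _root_.cv (ℤ × ℤ) y A (p, j) := by
      funext j
      rw [cv_add]
      rfl
    rw [this, map_add]
    exact (hx p).add (hy p)
  | single m r =>
    intro p
    have : (fun j => _root_.cv (ℤ × ℤ) (AddMonoidAlgebra.single m r) A (p, j)) =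
        fun j => r * (fun j' => A (p - m.1, j')) (j - m.2) := by
      funext j
      rw [cv_single]
      rfl
    rw [this, eps_shift _ _ (fun j' => A (p - m.1, j'))]
    have := (low_exL (m.2 : ℂ)).mul (h (p - m.1))
    rw [zero_add] at this
    exact this.smul r

theorem coeff_C_mul (x : LaurentSeries ℂ) (E : KK) (κ : ℤ) :
    (HahnSeries.C x * E).coeff κ = x * E.coeff κ := by
  rw [HahnSeries.C_mul_eq_smul, HahnSeries.coeff_smul, smul_eq_mul]

theorem IsE2.add {A B : ℤ × ℤ → ℂ} {α β : KK} (hA : IsE2 A α) (hB : IsE2 B β) :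
    IsE2 (A + B) (α + β) := by
  intro κ
  rw [HahnSeries.coeff_add, hA κ, hB κ, ← map_add]
  congr 1
  funext p
  have : (fun j => (A + B) (p, j)) = (fun j => A (p, j)) + fun j => B (p, j) := rfl
  rw [this, map_add]
  rfl

theorem isE2_zero : IsE2 0 0 := by
  intro κ
  have h1 : (fun j : ℤ => (0 : ℤ × ℤ → ℂ) (0, j)) = 0 := rfl
  have : (fun p : ℤ => (eps fun j : ℤ => (0 : ℤ × ℤ → ℂ) (p, j)).coeff κ) = 0 := by
    funext p
    have h1 : (fun j : ℤ => (0 : ℤ × ℤ → ℂ) (p, j)) = 0 := rfl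
    rw [h1, map_zero]
    rfl
  rw [this, map_zero]
  rfl

theorem IsE2.cv {q : ℤ} {A : ℤ × ℤ → ℂ} {α : KK} (hA : BB q A) (h : IsE2 A α)
    (F : AddMonoidAlgebra ℂ (ℤ × ℤ)) : IsE2 (_root_.cv _ F A) (ev2 F * α) := by
  induction F using AddMonoidAlgebra.induction_linear with
  | zero =>
    rw [map_zero, map_zero, zero_mul, LinearMap.zero_apply]
    exact isE2_zero
  | add x y hx hy =>
    rw [cv_add, map_add, add_mul]
    exact hx.add hy
  | single m c =>
    obtain ⟨i, j⟩ := m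
    intro κ
    have h1 : ∀ p, (fun j' => _root_.cv (ℤ × ℤ) (AddMonoidAlgebra.single (i, j) c) A (p, j')) =
        fun j' => c * (fun j' => A (p - i, j')) (j' - j) := by
      intro p
      funext j'
      rw [cv_single]
      rfl
    obtain ⟨n, hn⟩ : ∃ n : ℕ, κ - q + 1 ≤ n := ⟨(κ - q + 1).toNat, Int.self_le_toNat _⟩
    have h2 : (fun p => (eps fun j' => _root_.cv (ℤ × ℤ) (AddMonoidAlgebra.single (i, j) c) A
        (p, j')).coeff κ) = fun p => c * (∑ r ∈ Finset.range n, ((j : ℂ) ^ r / (r.factorial : ℂ)) •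
          fun p => (eps fun j' => A (p, j')).coeff (κ - r)) (p - i) := by
      funext p
      rw [h1, eps_shift _ _ (fun j' => A (p - i, j')), HahnSeries.coeff_smul, smul_eq_mul]
      congr 1
      rw [exL, coeff_ofPowerSeries_mul _ (hA (p - i)) κ hn]
      rw [Finset.sum_apply]
      refine Finset.sum_congr rfl fun r _ => ?_
      simp [PowerSeries.coeff_rescale, PowerSeries.coeff_exp, div_eq_mul_inv]
    rw [h2, eps_shift, ev2_single, smul_mul_assoc, HahnSeries.coeff_smul, mul_assoc, coeff_C_mul]
    congr 2
    rw [exL, coeff_ofPowerSeries_mul _ (h.low hA) κ hn, map_sum]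
    refine Finset.sum_congr rfl fun r _ => ?_
    rw [coeff_rescale_exp, map_smul, ← h, HahnSeries.C_mul_eq_smul]

theorem isE2_delta : IsE2 (Pi.single 0 1) 1 := by
  intro κ
  have h0 : eps (Pi.single 0 1) = 1 := (Classical.choose_spec exists_epsilon).2
  have h1 : ∀ p : ℤ, (fun j : ℤ => (Pi.single 0 1 : ℤ × ℤ → ℂ) (p, j)) =
      (if p = 0 then (1 : ℂ) else 0) • Pi.single 0 1 := by
    intro p
    funext j
    simp only [Pi.single_apply, Pi.smul_apply, Prod.ext_iff, Prod.fst_zero, Prod.snd_zero]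
    by_cases hp : p = 0 <;> simp [hp]
  have h2 : (fun p : ℤ => (eps fun j : ℤ => (Pi.single 0 1 : ℤ × ℤ → ℂ) (p, j)).coeff κ) =
      (if κ = 0 then (1 : ℂ) else 0) • Pi.single 0 1 := by
    funext p
    rw [h1, map_smul, h0, HahnSeries.coeff_smul, HahnSeries.coeff_one]
    simp only [Pi.single_apply, Pi.smul_apply]
    by_cases hp : p = 0 <;> by_cases hκ : κ = 0 <;> simp [hp, hκ]
  rw [h2, map_smul, h0, HahnSeries.coeff_one]
  by_cases hκ : κ = 0
  · rw [if_pos hκ, if_pos hκ, one_smul]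
  · rw [if_neg hκ, if_neg hκ]
    exact (zero_smul ℂ _).symm

theorem bb_delta : BB 0 (Pi.single 0 1) := by
  intro p
  apply low_eps_of_finite
  apply (Set.finite_singleton (0 : ℤ)).subset
  intro j hj
  rw [Function.mem_support, Pi.single_apply] at hj
  by_contra h
  exact hj (if_neg fun hh => h (Set.mem_singleton_iff.2 (Prod.ext_iff.1 hh).2))

theorem IsE2.unique {A : ℤ × ℤ → ℂ} {α β : KK} (h : IsE2 A α) (h' : IsE2 A β) : α = β :=
  HahnSeries.ext (funext fun κ => by rw [h κ, h' κ])

/-- A symbol relation for arrays yields the corresponding relation for iterated sums. -/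
theorem IsE2.relation {q : ℤ} {A : ℤ × ℤ → ℂ} {α : KK} (hA : BB q A) (h : IsE2 A α)
    {F P : AddMonoidAlgebra ℂ (ℤ × ℤ)} (hF : _root_.cv _ F A = P.coeff) :
    ev2 F * α = ev2 P := by
  have h1 := h.cv hA F
  have h2 := isE2_delta.cv bb_delta P
  rw [cv_symbol, mul_one, ← hF] at h2
  exact h1.unique h2

end

noncomputable section

theorem intChoose_zero (m : ℤ) : intChoose m 0 = 1 := by
  simp [intChoose]

theorem intChoose_succ_mul (m : ℤ) (i : ℕ) :
    ((i : ℂ) + 1) * intChoose m (i + 1) = ((m : ℂ) - i) * intChoose m i := by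
  have h1 : ((i.factorial : ℕ) : ℂ) ≠ 0 := by exact_mod_cast Nat.factorial_ne_zero _
  have h2 : ((i : ℂ) + 1) ≠ 0 := by exact_mod_cast Nat.succ_ne_zero i
  rw [intChoose, intChoose, Finset.prod_range_succ, Nat.factorial_succ]
  push_cast
  field_simp

theorem intChoose_pascal (m : ℤ) (i : ℕ) :
    intChoose (m + 1) (i + 1) = intChoose m (i + 1) + intChoose m i := by
  have h1 : ((i.factorial : ℕ) : ℂ) ≠ 0 := by exact_mod_cast Nat.factorial_ne_zero _
  have h2 : ((i : ℂ) + 1) ≠ 0 := by exact_mod_cast Nat.succ_ne_zero i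
  have h3 : ((i : ℂ) + 1) * intChoose (m + 1) (i + 1) = ((m : ℂ) + 1) * intChoose m i := by
    rw [intChoose, intChoose, Finset.prod_range_succ', Nat.factorial_succ]
    push_cast
    have : ∀ j : ℕ, (m : ℂ) + 1 - (j + 1) = m - j := fun j => by ring
    simp only [this]
    field_simp
    ring
  apply mul_left_cancel₀ h2
  rw [h3, mul_add, intChoose_succ_mul]
  ring

theorem intChoose_eq_zero {n i : ℕ} (h : n < i) : intChoose n i = 0 := by
  rw [intChoose, Finset.prod_eq_zero (Finset.mem_range.2 h), zero_div]
  simp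

/-- The expansion of `(X + sY)^m` in nonnegative powers of the outer variable `Y`. -/
def binS (m : ℤ) (s : ℂ) : KK :=
  HahnSeries.ofPowerSeries ℤ (LaurentSeries ℂ)
    (PowerSeries.mk fun i => HahnSeries.single (m - i) (intChoose m i * s ^ i))

/-- The inner variable. -/
def vX : KK := HahnSeries.C (HahnSeries.single 1 1)

/-- The outer variable. -/
def vY : KK := HahnSeries.single 1 1

/-- The scalar `c` of `KK`. -/
def cK (c : ℂ) : KK := HahnSeries.C (HahnSeries.C c)

theorem cK_one : cK 1 = 1 := by simp [cK]

theorem cK_neg (c : ℂ) : cK (-c) = -cK c := by simp [cK]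

theorem binS_succ (m : ℤ) (s : ℂ) : (vX + cK s * vY) * binS m s = binS (m + 1) s := by
  have hX : vX = HahnSeries.ofPowerSeries ℤ (LaurentSeries ℂ)
      (PowerSeries.C (HahnSeries.single 1 1)) := by
    rw [HahnSeries.ofPowerSeries_C]; rfl
  have hY : vY = HahnSeries.ofPowerSeries ℤ (LaurentSeries ℂ) PowerSeries.X := by
    rw [HahnSeries.ofPowerSeries_X]; rfl
  have hs : cK s = HahnSeries.ofPowerSeries ℤ (LaurentSeries ℂ)
      (PowerSeries.C (HahnSeries.C s)) := by
    rw [HahnSeries.ofPowerSeries_C]; rfl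
  rw [hX, hY, hs, binS, binS, ← map_mul, ← map_add, ← map_mul]
  congr 1
  ext1 n
  rw [add_mul, map_add, mul_assoc, PowerSeries.coeff_C_mul, PowerSeries.coeff_C_mul,
    PowerSeries.coeff_mk, PowerSeries.coeff_mk]
  rcases n with _ | n
  · rw [PowerSeries.coeff_zero_X_mul, HahnSeries.single_mul_single]
    simp [intChoose_zero, add_comm]
  · rw [PowerSeries.coeff_succ_X_mul, PowerSeries.coeff_mk, HahnSeries.single_mul_single,
      show (HahnSeries.C s : LaurentSeries ℂ) = HahnSeries.single 0 s from rfl,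
      HahnSeries.single_mul_single, intChoose_pascal]
    have e1 : (1 : ℤ) + (m - ((n + 1 : ℕ) : ℤ)) = m + 1 - ((n + 1 : ℕ) : ℤ) := by ring
    have e2 : (0 : ℤ) + (m - (n : ℤ)) = m + 1 - ((n + 1 : ℕ) : ℤ) := by push_cast; ring
    rw [e1, e2, ← HahnSeries.single_add]
    congr 1
    ring

/-- `X^a (X + sY)^m Y^b`. -/
def monc (a m : ℤ) (s : ℂ) (b : ℤ) : KK :=
  binS m s * (HahnSeries.C (HahnSeries.single a 1) * HahnSeries.single b 1)

theorem vX_mul_monc (a m : ℤ) (s : ℂ) (b : ℤ) : vX * monc a m s b = monc (a + 1) m s b := by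
  have : vX * (HahnSeries.C (HahnSeries.single a 1) : KK) =
      HahnSeries.C (HahnSeries.single (a + 1) 1) := by
    rw [vX, ← map_mul, HahnSeries.single_mul_single, one_mul, add_comm]
  rw [monc, monc, ← this]
  ring

theorem vY_mul_monc (a m : ℤ) (s : ℂ) (b : ℤ) : vY * monc a m s b = monc a m s (b + 1) := by
  have : vY * (HahnSeries.single b 1 : KK) = HahnSeries.single (b + 1) 1 := by
    rw [vY, HahnSeries.single_mul_single, one_mul, add_comm]
  rw [monc, monc, ← this]
  ring

theorem lin_mul_monc (a m : ℤ) (s : ℂ) (b : ℤ) :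
    (vX + cK s * vY) * monc a m s b = monc a (m + 1) s b := by
  rw [monc, monc, ← binS_succ]
  ring

theorem coeff_single_mul' (p μ : ℤ) (c : ℂ) (F : LaurentSeries ℂ) :
    (HahnSeries.single p c * F).coeff μ = c * F.coeff (μ - p) := by
  have := HahnSeries.coeff_single_mul_add (r := c) (x := F) (a := μ - p) (b := p)
  rwa [sub_add_cancel] at this

theorem coeff_single_mul_KK (p κ : ℤ) (E : KK) :
    ((HahnSeries.single p 1 : KK) * E).coeff κ = E.coeff (κ - p) := by
  have := HahnSeries.coeff_single_mul_add (r := (1 : LaurentSeries ℂ)) (x := E) (a := κ - p) (b := p)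
  rwa [sub_add_cancel, one_mul] at this

theorem coeff_monc_mul (a m : ℤ) (s : ℂ) (b : ℤ) {q : ℤ} {S : KK} (hS : Low q S) (κ μ : ℤ) {n : ℕ}
    (hn : κ - b - q + 1 ≤ n) :
    ((monc a m s b * S).coeff κ).coeff μ = ∑ i ∈ Finset.range n, intChoose m i * s ^ i *
      (S.coeff (κ - b - i)).coeff (μ - a - m + i) := by
  have h1 : monc a m s b * S = (HahnSeries.single b 1 : KK) *
      (HahnSeries.C (HahnSeries.single a 1) * (binS m s * S)) := by
    rw [monc]; ring
  rw [h1, coeff_single_mul_KK, coeff_C_mul, coeff_single_mul', one_mul, binS,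
    coeff_ofPowerSeries_mul _ hS _ hn, HahnSeries.coeff_sum]
  refine Finset.sum_congr rfl fun i _ => ?_
  rw [PowerSeries.coeff_mk, coeff_single_mul']
  congr 2
  ring

theorem coeff_monc_mul_finsum (a m : ℤ) (s : ℂ) (b : ℤ) (S : KK) (κ μ : ℤ) :
    ((monc a m s b * S).coeff κ).coeff μ = ∑ᶠ i : ℕ, intChoose m i * s ^ i *
      (S.coeff (κ - b - i)).coeff (μ - a - m + i) := by
  obtain ⟨q, hq⟩ := exists_low S
  rw [coeff_monc_mul a m s b hq κ μ (n := (κ - b - q + 1).toNat) (Int.self_le_toNat _)]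
  symm
  apply finsum_eq_sum_of_support_subset
  intro i hi
  rw [Function.mem_support] at hi
  by_contra h
  rw [Finset.mem_coe, Finset.mem_range] at h
  apply hi
  rw [hq (κ - b - i) (by omega), HahnSeries.coeff_zero, mul_zero]

/-- The double residue. -/
def rr : KK →+ ℂ where
  toFun S := (S.coeff (-1)).coeff (-1)
  map_zero' := rfl
  map_add' _ _ := rfl

/-- Triples of iterated series, one for each expansion region. -/
abbrev TT : Type := KK × KK × KK

/-- The alternating sum of the three double residues. -/
def X0 : TT →+ ℂ where
  toFun T := rr T.2.2 - rr T.1 + rr T.2.1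
  map_zero' := by simp
  map_add' S T := by
    simp only [Prod.fst_add, Prod.snd_add, map_add]
    ring

/-- The three expansions of the variables `x`, `y`. -/
def tX : TT := (vX, vY, vX + vY)

/-- See `tX`. -/
def tY : TT := (vY, vX, vX)

/-- The three expansions of `x^m (x-y)^n y^k`. -/
def mon (m n k : ℤ) : TT :=
  (monc m n (-1) k, cK ((-1) ^ n) * monc k n (-1) m, monc k m 1 n)

theorem tX_mul_mon (m n k : ℤ) : tX * mon m n k = mon (m + 1) n k := by
  have h := lin_mul_monc k m 1 n
  rw [cK_one, one_mul] at h
  refine Prod.ext ?_ (Prod.ext ?_ ?_)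
  · exact vX_mul_monc _ _ _ _
  · change vY * (cK ((-1) ^ n) * monc k n (-1) m) = cK ((-1) ^ n) * monc k n (-1) (m + 1)
    rw [← vY_mul_monc]; ring
  · exact h

theorem tY_mul_mon (m n k : ℤ) : tY * mon m n k = mon m n (k + 1) := by
  refine Prod.ext ?_ (Prod.ext ?_ ?_)
  · exact vY_mul_monc _ _ _ _
  · change vX * (cK ((-1) ^ n) * monc k n (-1) m) = cK ((-1) ^ n) * monc (k + 1) n (-1) m
    rw [← vX_mul_monc]; ring
  · exact vX_mul_monc _ _ _ _

theorem tXY_mul_mon (m n k : ℤ) : (tX - tY) * mon m n k = mon m (n + 1) k := by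
  refine Prod.ext ?_ (Prod.ext ?_ ?_)
  · change (vX - vY) * monc m n (-1) k = monc m (n + 1) (-1) k
    rw [← lin_mul_monc, cK_neg, cK_one]; ring
  · change (vY - vX) * (cK ((-1) ^ n) * monc k n (-1) m) =
      cK ((-1) ^ (n + 1)) * monc k (n + 1) (-1) m
    rw [← lin_mul_monc, zpow_add_one₀ (by norm_num), mul_neg, mul_one, cK_neg, cK_neg, cK_one]; ring
  · change (vX + vY - vX) * monc k m 1 n = monc k m 1 (n + 1)
    rw [← vY_mul_monc]; ring

theorem coeff_monc (a m : ℤ) (s : ℂ) (b : ℤ) (κ μ : ℤ) :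
    ((monc a m s b).coeff κ).coeff μ = if 0 ≤ κ - b ∧ μ - a - m + (κ - b) = 0 then
      intChoose m (κ - b).toNat * s ^ (κ - b).toNat else 0 := by
  have h1 : Low 0 (1 : KK) := by
    intro κ hκ
    rw [HahnSeries.coeff_one, if_neg hκ.ne]
  have h2 := coeff_monc_mul a m s b h1 κ μ (n := (κ - b + 1).toNat)
    (by rw [sub_zero]; exact Int.self_le_toNat _)
  rw [mul_one] at h2
  rw [h2]
  have h3 : ∀ i : ℕ, ((1 : KK).coeff (κ - b - i)).coeff (μ - a - m + i) =
      if κ - b - i = 0 ∧ μ - a - m + i = 0 then 1 else 0 := by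
    intro i
    rw [HahnSeries.coeff_one]
    by_cases hi : κ - b - i = 0
    · rw [if_pos hi, HahnSeries.coeff_one]; simp [hi]
    · rw [if_neg hi, HahnSeries.coeff_zero]; simp [hi]
  simp only [h3]
  split_ifs with h
  · rw [Finset.sum_eq_single (κ - b).toNat]
    · rw [if_pos (by omega), mul_one]
    · intro i _ hi
      rw [if_neg (by omega), mul_zero]
    · intro hh
      rw [Finset.mem_range] at hh
      omega
  · refine Finset.sum_eq_zero fun i _ => ?_
    rw [if_neg (by omega), mul_zero]

theorem X0_mon_n_zero (m k : ℤ) : X0 (mon m 0 k) = 0 := by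
  change ((monc k m 1 0).coeff (-1)).coeff (-1) - ((monc m 0 (-1) k).coeff (-1)).coeff (-1) +
    ((cK ((-1) ^ (0 : ℤ)) * monc k 0 (-1) m).coeff (-1)).coeff (-1) = 0
  rw [zpow_zero, cK_one, one_mul, coeff_monc, coeff_monc, coeff_monc, if_neg (by omega)]
  have h : ∀ i : ℕ, intChoose 0 i = if i = 0 then 1 else 0 := by
    intro i
    rcases i with _ | i
    · simp [intChoose_zero]
    · have := intChoose_eq_zero (Nat.succ_pos i)
      rw [Nat.cast_zero] at this
      rw [this, if_neg (Nat.succ_ne_zero i)]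
  rw [h, h]
  by_cases h1 : m = -1 <;> by_cases h2 : k = -1
  · simp [h1, h2]
  · rw [if_neg (by omega), if_neg (by omega)]; simp
  · rw [if_neg (by omega), if_neg (by omega)]; simp
  · have e1 : (if 0 ≤ -1 - k ∧ -1 - m - 0 + (-1 - k) = 0 then
        (if (-1 - k).toNat = 0 then (1 : ℂ) else 0) * (-1) ^ (-1 - k).toNat else 0) = 0 := by
      split_ifs with h3 h4
      · omega
      · simp
      · rfl
    have e2 : (if 0 ≤ -1 - m ∧ -1 - k - 0 + (-1 - m) = 0 then
        (if (-1 - m).toNat = 0 then (1 : ℂ) else 0) * (-1) ^ (-1 - m).toNat else 0) = 0 := by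
      split_ifs with h3 h4
      · omega
      · simp
      · rfl
    rw [e1, e2]; simp

theorem X0_mon_m_zero (n k : ℤ) : X0 (mon 0 n k) = 0 := by
  change ((monc k 0 1 n).coeff (-1)).coeff (-1) - ((monc 0 n (-1) k).coeff (-1)).coeff (-1) +
    ((cK ((-1) ^ n) * monc k n (-1) 0).coeff (-1)).coeff (-1) = 0
  have h0 : (cK ((-1) ^ n) * monc k n (-1) 0).coeff (-1) =
      HahnSeries.C ((-1) ^ n) * (monc k n (-1) 0).coeff (-1) := coeff_C_mul _ _ _
  rw [h0, HahnSeries.C_mul_eq_smul, HahnSeries.coeff_smul, coeff_monc, coeff_monc, coeff_monc,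
    if_neg (c := 0 ≤ (-1 : ℤ) - 0 ∧ _) (by omega), smul_zero, add_zero]
  have h : ∀ i : ℕ, intChoose 0 i = if i = 0 then 1 else 0 := by
    intro i
    rcases i with _ | i
    · simp [intChoose_zero]
    · have := intChoose_eq_zero (Nat.succ_pos i)
      rw [Nat.cast_zero] at this
      rw [this, if_neg (Nat.succ_ne_zero i)]
  rw [h, one_pow, mul_one]
  by_cases h1 : n = -1 ∧ k = -1
  · obtain ⟨rfl, rfl⟩ := h1
    simp [intChoose_zero]
  · have e1 : (if 0 ≤ -1 - n ∧ -1 - k - 0 + (-1 - n) = 0 then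
        (if (-1 - n).toNat = 0 then (1 : ℂ) else 0) else 0) = 0 := by
      split_ifs with h3 h4
      · omega
      · rfl
      · rfl
    rw [e1]
    split_ifs with h3
    · obtain ⟨i, hi⟩ : ∃ i : ℕ, n = i := ⟨n.toNat, by omega⟩
      have : (-1 - k).toNat = i + 1 := by omega
      rw [this, hi, intChoose_eq_zero (Nat.lt_succ_self i)]
      simp
    · simp

theorem X0_mon_recursion (m n k : ℤ) :
    X0 (mon (m + 1) n k) = X0 (mon m n (k + 1)) + X0 (mon m (n + 1) k) := by
  rw [← tX_mul_mon, ← tY_mul_mon, ← tXY_mul_mon, ← map_add]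
  congr 1
  ring

theorem X0_mon (m n k : ℤ) : X0 (mon m n k) = 0 := by
  have hn : ∀ b : ℕ, ∀ m k, X0 (mon m b k) = 0 := by
    intro b
    induction b with
    | zero => exact fun m k => X0_mon_n_zero m k
    | succ b ih =>
      intro m k
      have := X0_mon_recursion m b k
      rw [ih, ih, zero_add] at this
      exact_mod_cast this.symm
  have hm : ∀ a : ℕ, ∀ n k, X0 (mon a n k) = 0 := by
    intro a
    induction a with
    | zero => exact fun n k => X0_mon_m_zero n k
    | succ a ih =>
      intro n k
      have := X0_mon_recursion a n k
      rw [ih, ih, zero_add] at this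
      exact_mod_cast this
  have key : ∀ N a b : ℕ, a + b = N → ∀ k, X0 (mon (-a) (-b) k) = 0 := by
    intro N
    induction N with
    | zero =>
      intro a b hab k
      obtain rfl : a = 0 := by omega
      exact_mod_cast hm 0 _ k
    | succ N ih =>
      intro a b hab k
      rcases a with _ | a
      · exact_mod_cast hm 0 _ k
      rcases b with _ | b
      · exact_mod_cast hn 0 _ k
      have := X0_mon_recursion (-((a + 1 : ℕ) : ℤ)) (-((b + 1 : ℕ) : ℤ)) (k - 1)
      rw [show -((a + 1 : ℕ) : ℤ) + 1 = -(a : ℤ) by push_cast; ring,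
        show -((b + 1 : ℕ) : ℤ) + 1 = -(b : ℤ) by push_cast; ring, sub_add_cancel,
        ih a (b + 1) (by omega), ih (a + 1) b (by omega), add_zero] at this
      exact this.symm
  rcases le_or_gt 0 m with h | h
  · obtain ⟨a, rfl⟩ := Int.eq_ofNat_of_zero_le h
    exact hm a n k
  rcases le_or_gt 0 n with h' | h'
  · obtain ⟨b, rfl⟩ := Int.eq_ofNat_of_zero_le h'
    exact hn b m k
  · have := key _ (-m).toNat (-n).toNat rfl k
    rwa [Int.toNat_of_nonneg (by omega), Int.toNat_of_nonneg (by omega), neg_neg, neg_neg] at this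

end

noncomputable section

/-- All coefficients of total degree below `R` vanish. -/
def Fil (R : ℤ) (S : KK) : Prop := ∀ κ μ, κ + μ < R → (S.coeff κ).coeff μ = 0

theorem Fil.mul {R R' : ℤ} {S S' : KK} (h : Fil R S) (h' : Fil R' S') : Fil (R + R') (S * S') := by
  intro κ μ hκ
  rw [HahnSeries.coeff_mul, HahnSeries.coeff_sum]
  refine Finset.sum_eq_zero fun ij hij => ?_
  rw [Finset.mem_antidiagonal] at hij
  rw [HahnSeries.coeff_mul]
  refine Finset.sum_eq_zero fun ab hab => ?_
  rw [Finset.mem_antidiagonal] at hab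
  rcases lt_or_ge (ij.1 + ab.1) R with h1 | h1
  · rw [h _ _ h1, zero_mul]
  · rw [h' _ _ (by linarith [hij.2.2, hab.2.2]), mul_zero]

theorem exists_rr_mul_eq_zero (S : KK) : ∃ R : ℤ, ∀ M, Fil R M → Low 0 M → rr (M * S) = 0 := by
  obtain ⟨q, hq⟩ := exists_low S
  choose ν hν using fun j => exists_low (S.coeff j)
  obtain ⟨b, hb⟩ : ∃ b, ∀ j ∈ Finset.Icc q (-1), b ≤ ν j := by
    obtain ⟨b, hb⟩ := ((Finset.Icc q (-1)).image ν).bddBelow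
    exact ⟨b, fun j hj => hb (Finset.mem_coe.2 (Finset.mem_image_of_mem ν hj))⟩
  refine ⟨-1 - q - b, fun M hM hM0 => ?_⟩
  change ((M * S).coeff (-1)).coeff (-1) = 0
  rw [HahnSeries.coeff_mul, HahnSeries.coeff_sum]
  refine Finset.sum_eq_zero fun ij hij => ?_
  rw [Finset.mem_antidiagonal] at hij
  rcases lt_or_ge ij.1 0 with h1 | h1
  · rw [hM0 _ h1, zero_mul, HahnSeries.coeff_zero]
  rcases lt_or_ge ij.2 q with h2 | h2
  · rw [hq _ h2, mul_zero, HahnSeries.coeff_zero]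
  have h3 := hb ij.2 (Finset.mem_Icc.2 ⟨h2, by linarith [hij.2.2]⟩)
  rw [HahnSeries.coeff_mul]
  refine Finset.sum_eq_zero fun ac hac => ?_
  rw [Finset.mem_antidiagonal] at hac
  rcases lt_or_ge ac.2 (ν ij.2) with h4 | h4
  · rw [hν _ _ h4, mul_zero]
  · rw [hM _ _ (by linarith [hij.2.2, hac.2.2]), zero_mul]

/-- Triples of power series, of order at least `R`. -/
def PP (R : ℤ) (T : TT) : Prop :=
  (Fil R T.1 ∧ Low 0 T.1) ∧ (Fil R T.2.1 ∧ Low 0 T.2.1) ∧ (Fil R T.2.2 ∧ Low 0 T.2.2)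

theorem PP.mul {R R' : ℤ} {S T : TT} (h : PP R S) (h' : PP R' T) : PP (R + R') (S * T) :=
  ⟨⟨h.1.1.mul h'.1.1, by simpa using h.1.2.mul h'.1.2⟩,
    ⟨h.2.1.1.mul h'.2.1.1, by simpa using h.2.1.2.mul h'.2.1.2⟩,
    ⟨h.2.2.1.mul h'.2.2.1, by simpa using h.2.2.2.mul h'.2.2.2⟩⟩

theorem exists_X0_mul_eq_zero (T : TT) : ∃ R : ℕ, ∀ M, PP R M → X0 (M * T) = 0 := by
  obtain ⟨R1, h1⟩ := exists_rr_mul_eq_zero T.1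
  obtain ⟨R2, h2⟩ := exists_rr_mul_eq_zero T.2.1
  obtain ⟨R3, h3⟩ := exists_rr_mul_eq_zero T.2.2
  refine ⟨(max R1 (max R2 R3)).toNat, fun M hM => ?_⟩
  have hR := Int.self_le_toNat (max R1 (max R2 R3))
  have e1 : R1 ≤ ((max R1 (max R2 R3)).toNat : ℤ) := (le_max_left _ _).trans hR
  have e2 : R2 ≤ ((max R1 (max R2 R3)).toNat : ℤ) :=
    ((le_max_left _ _).trans (le_max_right _ _)).trans hR
  have e3 : R3 ≤ ((max R1 (max R2 R3)).toNat : ℤ) :=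
    ((le_max_right _ _).trans (le_max_right _ _)).trans hR
  change rr (M.2.2 * T.2.2) - rr (M.1 * T.1) + rr (M.2.1 * T.2.1) = 0
  rw [h1 _ (fun κ μ h => hM.1.1 κ μ (h.trans_le e1)) hM.1.2,
    h2 _ (fun κ μ h => hM.2.1.1 κ μ (h.trans_le e2)) hM.2.1.2,
    h3 _ (fun κ μ h => hM.2.2.1 κ μ (h.trans_le e3)) hM.2.2.2]
  simp

theorem X0_smul (c : ℂ) (T : TT) : X0 (c • T) = c * X0 T := by
  have h : ∀ S : KK, rr (c • S) = c * rr S := fun S => rfl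
  change rr (c • T.2.2) - rr (c • T.1) + rr (c • T.2.1) = c * (rr T.2.2 - rr T.1 + rr T.2.1)
  rw [h, h, h]
  ring

/-- Triples all of whose moments against the `mon m n k` vanish. -/
def NN : Submodule ℂ TT where
  carrier := {T | ∀ m n k, X0 (mon m n k * T) = 0}
  zero_mem' m n k := by rw [mul_zero, map_zero]
  add_mem' {S T} hS hT m n k := by rw [mul_add, map_add, hS, hT, add_zero]
  smul_mem' c T hT m n k := by rw [mul_smul_comm, X0_smul, hT, mul_zero]

theorem tX_mul_mem {T : TT} : tX * T ∈ NN ↔ T ∈ NN := by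
  have h : ∀ m n k, X0 (mon m n k * (tX * T)) = X0 (mon (m + 1) n k * T) := fun m n k => by
    rw [← mul_assoc, mul_comm _ tX, tX_mul_mon]
  refine ⟨fun hT m n k => ?_, fun hT m n k => (h m n k).trans (hT _ _ _)⟩
  have := hT (m - 1) n k
  rwa [h, sub_add_cancel] at this

theorem tY_mul_mem {T : TT} : tY * T ∈ NN ↔ T ∈ NN := by
  have h : ∀ m n k, X0 (mon m n k * (tY * T)) = X0 (mon m n (k + 1) * T) := fun m n k => by
    rw [← mul_assoc, mul_comm _ tY, tY_mul_mon]
  refine ⟨fun hT m n k => ?_, fun hT m n k => (h m n k).trans (hT _ _ _)⟩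
  have := hT m n (k - 1)
  rwa [h, sub_add_cancel] at this

theorem tXY_mul_mem {T : TT} : (tX - tY) * T ∈ NN ↔ T ∈ NN := by
  have h : ∀ m n k, X0 (mon m n k * ((tX - tY) * T)) = X0 (mon m (n + 1) k * T) := fun m n k => by
    rw [← mul_assoc, mul_comm _ (tX - tY), tXY_mul_mon]
  refine ⟨fun hT m n k => ?_, fun hT m n k => (h m n k).trans (hT _ _ _)⟩
  have := hT m (n - 1) k
  rwa [h, sub_add_cancel] at this

theorem one_mem_NN : (1 : TT) ∈ NN := fun m n k => by rw [mul_one, X0_mon]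

/-- The multipliers of `NN`. -/
def St : Subalgebra ℂ TT where
  carrier := {U | ∀ T ∈ NN, U * T ∈ NN}
  mul_mem' {U V} hU hV T hT := by rw [mul_assoc]; exact hU _ (hV _ hT)
  add_mem' {U V} hU hV T hT := by rw [add_mul]; exact NN.add_mem (hU _ hT) (hV _ hT)
  algebraMap_mem' c T hT := by rw [← Algebra.smul_def]; exact NN.smul_mem c hT

theorem mem_St_of_approx {U : TT} (h : ∀ R : ℕ, ∃ q ∈ St, ∃ δ, PP R δ ∧ U = q + δ) : U ∈ St := by
  intro T hT m n k
  obtain ⟨R, hR⟩ := exists_X0_mul_eq_zero (mon m n k * T)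
  obtain ⟨q, hq, δ, hδ, hU⟩ := h R
  have h1 := hR _ hδ
  have h2 := hq T hT m n k
  have : mon m n k * (U * T) = δ * (mon m n k * T) + mon m n k * (q * T) := by
    rw [hU]; ring
  rw [this, map_add, h1, h2, add_zero]

/-- Multiplication by `U` reflects membership in `NN`. -/
def Can (U : TT) : Prop := ∀ T, U * T ∈ NN → T ∈ NN

theorem Can.mul {U V : TT} (hU : Can U) (hV : Can V) : Can (U * V) := fun T hT =>
  hV T (hU _ (by rwa [← mul_assoc]))

theorem Can.of_mul_eq_one {U V : TT} (hU : V ∈ St) (h : V * U = 1) : Can U := fun T hT => by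
  have := hU _ hT
  rwa [← mul_assoc, h, one_mul] at this

theorem PP.smul {R : ℤ} {T : TT} (h : PP R T) (c : ℂ) : PP R (c • T) := by
  have hs : ∀ S : KK, Fil R S ∧ Low 0 S → Fil R (c • S) ∧ Low 0 (c • S) := by
    refine fun S hS => ⟨fun κ μ hκ => ?_, fun κ hκ => ?_⟩
    · change c * (S.coeff κ).coeff μ = 0
      rw [hS.1 _ _ hκ, mul_zero]
    · change c • S.coeff κ = 0
      rw [hS.2 _ hκ, smul_zero]
  exact ⟨hs _ h.1, hs _ h.2.1, hs _ h.2.2⟩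

theorem PP.pow {T : TT} (h : PP 1 T) (h0 : PP 0 1) (R : ℕ) : PP R (T ^ R) := by
  induction R with
  | zero => simpa using h0
  | succ R ih => rw [pow_succ]; push_cast; exact ih.mul h

theorem mul_eq_geom_sum_add {A : Type} [CommRing A] [Algebra ℂ A] {θ U T M : A} {e : ℂ}
    (h : θ + e • U = 1) (R : ℕ) : M * T =
      M * ((e • ∑ i ∈ Finset.range R, θ ^ i) * (U * T)) + θ ^ R * (M * T) := by
  have h1 := geom_sum_mul θ R
  have h2 : e • U = 1 - θ := by rw [← h]; ring
  have h3 : (e • ∑ i ∈ Finset.range R, θ ^ i) * (U * T) =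
      ((∑ i ∈ Finset.range R, θ ^ i) * (e • U)) * T := by
    rw [smul_mul_assoc, mul_smul_comm, smul_mul_assoc, mul_assoc]
  rw [h3, h2]
  linear_combination M * T * h1

theorem can_of_PP {U ε : TT} (hU : U ∈ St) {d : ℂ} (hd : d ≠ 0) (h : U = d • 1 + ε)
    (hε : PP 1 ε) (h0 : PP 0 1) : Can U := by
  intro T hT
  obtain ⟨θ, hθ⟩ : ∃ θ : TT, θ = (-d⁻¹) • ε := ⟨_, rfl⟩
  have h0' : θ + d⁻¹ • U = 1 := by
    rw [h, smul_add, smul_smul, inv_mul_cancel₀ hd, one_smul, hθ, add_left_comm, ← add_smul,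
      neg_add_cancel, zero_smul ℂ ε, add_zero]
  have hθS : θ ∈ St := by
    have : θ = 1 + (-d⁻¹) • U := by
      rw [← h0', add_assoc, ← add_smul, add_neg_cancel, zero_smul ℂ U, add_zero]
    rw [this]
    exact St.add_mem St.one_mem (St.smul_mem hU _)
  have hθP : PP 1 θ := hθ ▸ hε.smul _
  intro m n k
  obtain ⟨R, hR⟩ := exists_X0_mul_eq_zero (mon m n k * T)
  have h4 : (d⁻¹ • ∑ i ∈ Finset.range R, θ ^ i) ∈ St :=
    St.smul_mem (St.sum_mem fun i _ => St.pow_mem hθS i) _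
  refine (congrArg X0 (mul_eq_geom_sum_add (M := mon m n k) (T := T) h0' R)).trans ?_
  rw [map_add, hR _ (hθP.pow h0 R), add_zero]
  exact h4 _ hT m n k

end

noncomputable section

/-- The power series `∑ cₙ (σX + τY)ⁿ` in two variables, `X` being the outer one. -/
def lcP (c : ℕ → ℂ) (τ σ : ℂ) : PowerSeries (PowerSeries ℂ) :=
  PowerSeries.mk fun b => PowerSeries.mk fun a =>
    ((a + b).choose b : ℂ) * τ ^ a * σ ^ b * c (a + b)

theorem lcP_rec (c : ℕ → ℂ) (τ σ : ℂ) : lcP c τ σ = PowerSeries.C (PowerSeries.C (c 0)) +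
    (PowerSeries.C (PowerSeries.C τ * PowerSeries.X) +
      PowerSeries.C (PowerSeries.C σ) * PowerSeries.X) * lcP (fun n => c (n + 1)) τ σ := by
  ext b a
  rw [add_mul, mul_assoc (PowerSeries.C (PowerSeries.C σ))]
  simp only [map_add, PowerSeries.coeff_C_mul, mul_assoc]
  rcases b with _ | b
  · rw [PowerSeries.coeff_zero_X_mul]
    rcases a with _ | a
    · simp [lcP, PowerSeries.coeff_zero_X_mul]
    · rw [PowerSeries.coeff_succ_X_mul]
      simp [lcP, PowerSeries.coeff_C]
      ring
  · rw [PowerSeries.coeff_succ_X_mul]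
    rcases a with _ | a
    · simp [lcP, PowerSeries.coeff_zero_X_mul]
      ring
    · rw [PowerSeries.coeff_succ_X_mul]
      have e1 : a + (b + 1) + 1 = a + 1 + (b + 1) := by ring
      have e2 : a + 1 + b + 1 = a + 1 + (b + 1) := by ring
      have e3 : (((a + 1 + (b + 1)).choose (b + 1) : ℕ) : ℂ) =
          ((a + (b + 1)).choose (b + 1) : ℕ) + ((a + 1 + b).choose b : ℕ) := by
        rw [← e1, Nat.choose_succ_succ, show a + 1 + b = a + (b + 1) by ring]
        push_cast
        ring
      simp [lcP, e1, e2, e3]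
      ring

/-- The embedding of power series into iterated Laurent series. -/
def emb : PowerSeries (PowerSeries ℂ) →+* KK :=
  (HahnSeries.ofPowerSeries ℤ (LaurentSeries ℂ)).comp
    (PowerSeries.map (HahnSeries.ofPowerSeries ℤ ℂ))

/-- The iterated Laurent series `∑ cₙ (σX + τY)ⁿ`. -/
def lc (c : ℕ → ℂ) (τ σ : ℂ) : KK := emb (lcP c τ σ)

theorem emb_low (p : PowerSeries (PowerSeries ℂ)) : Low 0 (emb p) := low_ofPowerSeries _

theorem emb_coeff (p : PowerSeries (PowerSeries ℂ)) (n : ℕ) :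
    (emb p).coeff n = HahnSeries.ofPowerSeries ℤ ℂ (PowerSeries.coeff n p) := by
  have h : (emb p).coeff n = PowerSeries.coeff n (PowerSeries.map (HahnSeries.ofPowerSeries ℤ ℂ) p)
    := HahnSeries.ofPowerSeries_apply_coeff _ _
  rw [h, PowerSeries.coeff_map]

theorem emb_fil (p : PowerSeries (PowerSeries ℂ)) : Fil 0 (emb p) := by
  intro κ μ hκ
  rcases lt_or_ge κ 0 with h | h
  · rw [emb_low p κ h, HahnSeries.coeff_zero]
  · obtain ⟨n, rfl⟩ := Int.eq_ofNat_of_zero_le h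
    rw [emb_coeff]
    exact low_ofPowerSeries _ μ (by omega)

theorem emb_CC (c : ℂ) : emb (PowerSeries.C (PowerSeries.C c)) = cK c := by
  rw [emb, RingHom.comp_apply, PowerSeries.map_C, HahnSeries.ofPowerSeries_C,
    HahnSeries.ofPowerSeries_C]
  rfl

theorem emb_X : emb PowerSeries.X = vY := by
  rw [emb, RingHom.comp_apply, PowerSeries.map_X, HahnSeries.ofPowerSeries_X]
  rfl

theorem emb_CX : emb (PowerSeries.C PowerSeries.X) = vX := by
  rw [emb, RingHom.comp_apply, PowerSeries.map_C, HahnSeries.ofPowerSeries_X,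
    HahnSeries.ofPowerSeries_C]
  rfl

theorem lc_rec (c : ℕ → ℂ) (τ σ : ℂ) :
    lc c τ σ = cK (c 0) + (cK τ * vX + cK σ * vY) * lc (fun n => c (n + 1)) τ σ := by
  have h : ∀ a b c d e f : PowerSeries (PowerSeries ℂ), emb (a + (b * c + d * e) * f) =
      emb a + (emb b * emb c + emb d * emb e) * emb f := fun a b c d e f => by simp
  rw [lc, lcP_rec, lc, ← emb_CC, ← emb_CC, ← emb_CC, ← emb_X, ← emb_CX, ← h, map_mul]

theorem lc_exp (i τ σ : ℤ) : lc (fun n => (i : ℂ) ^ n / (n.factorial : ℂ)) τ σ =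
    HahnSeries.C (exL ((i * τ : ℤ) : ℂ)) * exL ((i * σ : ℤ) : LaurentSeries ℂ) := by
  have h : (HahnSeries.C (exL ((i * τ : ℤ) : ℂ)) * exL ((i * σ : ℤ) : LaurentSeries ℂ) : KK) =
      HahnSeries.ofPowerSeries ℤ (LaurentSeries ℂ) (PowerSeries.C (exL ((i * τ : ℤ) : ℂ)) *
        PowerSeries.rescale ((i * σ : ℤ) : LaurentSeries ℂ)
          (PowerSeries.exp (LaurentSeries ℂ))) := by
    rw [map_mul, HahnSeries.ofPowerSeries_C]
    rfl
  rw [h, lc, emb, RingHom.comp_apply]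
  congr 1
  ext1 b
  rw [PowerSeries.coeff_C_mul, coeff_rescale_exp, PowerSeries.coeff_map, mul_comm, exL,
    ← HahnSeries.ofPowerSeries_C, ← map_mul]
  congr 1
  ext a
  rw [PowerSeries.coeff_C_mul, PowerSeries.coeff_rescale, PowerSeries.coeff_exp, lcP,
    PowerSeries.coeff_mk, PowerSeries.coeff_mk]
  have h1 : ((a.factorial : ℕ) : ℂ) ≠ 0 := by exact_mod_cast Nat.factorial_ne_zero _
  have h2 : ((b.factorial : ℕ) : ℂ) ≠ 0 := by exact_mod_cast Nat.factorial_ne_zero _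
  have h3 : (((a + b).factorial : ℕ) : ℂ) ≠ 0 := by exact_mod_cast Nat.factorial_ne_zero _
  have h4 : (((a + b).choose b : ℕ) : ℂ) * (b.factorial : ℂ) * (a.factorial : ℂ) =
      ((a + b).factorial : ℂ) := by
    have := Nat.choose_mul_factorial_mul_factorial (Nat.le_add_left b a)
    rw [Nat.add_sub_cancel] at this
    exact_mod_cast this
  have h5 : (((a + b).choose b : ℕ) : ℂ) = ((a + b).factorial : ℂ) / ((b.factorial : ℂ) *
      (a.factorial : ℂ)) := by
    rw [← h4]
    field_simp
  rw [h5]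
  simp only [map_div₀, map_one, map_natCast]
  push_cast
  field_simp
  ring

theorem PP.add {R : ℤ} {S T : TT} (h : PP R S) (h' : PP R T) : PP R (S + T) := by
  have hs : ∀ S T : KK, Fil R S ∧ Low 0 S → Fil R T ∧ Low 0 T →
      Fil R (S + T) ∧ Low 0 (S + T) := by
    refine fun S T hS hT => ⟨fun κ μ hκ => ?_, fun κ hκ => ?_⟩
    · change (S.coeff κ).coeff μ + (T.coeff κ).coeff μ = 0
      rw [hS.1 _ _ hκ, hT.1 _ _ hκ, add_zero]
    · change S.coeff κ + T.coeff κ = 0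
      rw [hS.2 _ hκ, hT.2 _ hκ, add_zero]
  exact ⟨hs _ _ h.1 h'.1, hs _ _ h.2.1 h'.2.1, hs _ _ h.2.2 h'.2.2⟩

theorem low_vY : Low 0 vY := by
  rw [← emb_X]; exact emb_low _

theorem low_vX : Low 0 vX := by
  rw [← emb_CX]; exact emb_low _

theorem fil_vX : Fil 1 vX := by
  intro κ μ h
  rw [vX]
  change ((HahnSeries.single 0 (HahnSeries.single 1 (1 : ℂ)) : KK).coeff κ).coeff μ = 0
  by_cases h0 : κ = 0
  · subst h0
    rw [HahnSeries.coeff_single_same, HahnSeries.coeff_single_of_ne (by omega)]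
  · rw [HahnSeries.coeff_single_of_ne h0, HahnSeries.coeff_zero]

theorem fil_vY : Fil 1 vY := by
  intro κ μ h
  rw [vY]
  by_cases h0 : κ = 1
  · subst h0
    rw [HahnSeries.coeff_single_same, HahnSeries.coeff_one, if_neg (by omega)]
  · rw [HahnSeries.coeff_single_of_ne h0, HahnSeries.coeff_zero]

theorem pp_tY : PP 1 tY := ⟨⟨fil_vY, low_vY⟩, ⟨fil_vX, low_vX⟩, ⟨fil_vX, low_vX⟩⟩

theorem pp_tX : PP 1 tX := by
  have h : PP 1 ((vX, vX, vX) : TT) := ⟨⟨fil_vX, low_vX⟩, ⟨fil_vX, low_vX⟩, ⟨fil_vX, low_vX⟩⟩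
  have h' : PP 1 ((vX, vX, vY) : TT) := ⟨⟨fil_vX, low_vX⟩, ⟨fil_vX, low_vX⟩, ⟨fil_vY, low_vY⟩⟩
  exact ⟨⟨fil_vX, low_vX⟩, ⟨fil_vY, low_vY⟩, (h.add h').2.2⟩

/-- `x tX + y tY`. -/
def tL (x y : ℂ) : TT := x • tX + y • tY

theorem pp_tL (x y : ℂ) : PP 1 (tL x y) := (pp_tX.smul x).add (pp_tY.smul y)

theorem tL_mem_St (x y : ℂ) : tL x y ∈ St :=
  St.add_mem (St.smul_mem (fun _ h => tX_mul_mem.2 h) x) (St.smul_mem (fun _ h => tY_mul_mem.2 h) y)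

/-- The power series with coefficients `c` evaluated at `tL x y`. -/
def lT (c : ℕ → ℂ) (x y : ℂ) : TT := (lc c x y, lc c y x, lc c (x + y) x)

theorem cK_mul (c : ℂ) (S : KK) : cK c * S = c • S := by
  ext κ μ
  have h1 : (cK c * S).coeff κ = HahnSeries.C c * S.coeff κ := coeff_C_mul _ _ _
  rw [h1, HahnSeries.C_mul_eq_smul]
  rfl

theorem lT_rec (c : ℕ → ℂ) (x y : ℂ) :
    lT c x y = c 0 • 1 + tL x y * lT (fun n => c (n + 1)) x y := by
  have h1 : ∀ c : ℂ, c • (1 : KK) = cK c := fun c => by rw [← cK_mul, mul_one]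
  refine Prod.ext ?_ (Prod.ext ?_ ?_)
  · refine (lc_rec c x y).trans ?_
    change _ = c 0 • (1 : KK) + (x • vX + y • vY) * _
    rw [h1, ← cK_mul, ← cK_mul]
    rfl
  · refine (lc_rec c y x).trans ?_
    change _ = c 0 • (1 : KK) + (x • vY + y • vX) * _
    rw [h1, ← cK_mul, ← cK_mul, add_comm (cK x * vY)]
    rfl
  · refine (lc_rec c (x + y) x).trans ?_
    change _ = c 0 • (1 : KK) + (x • (vX + vY) + y • vX) * _
    have h2 : cK (x + y) = cK x + cK y := by simp [cK]
    have h3 : x • (vX + vY) + y • vX = cK (x + y) * vX + cK x * vY := by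
      rw [← cK_mul, ← cK_mul, h2]
      ring
    rw [h1, h3]
    rfl

theorem pp_lT (c : ℕ → ℂ) (x y : ℂ) : PP 0 (lT c x y) :=
  ⟨⟨emb_fil _, emb_low _⟩, ⟨emb_fil _, emb_low _⟩, ⟨emb_fil _, emb_low _⟩⟩

theorem pp_one : PP 0 1 := by
  have h := pp_lT (Pi.single 0 1) 0 0
  have h1 : Fil 0 (1 : KK) ∧ Low 0 (1 : KK) := by
    rw [← map_one emb]; exact ⟨emb_fil _, emb_low _⟩
  exact ⟨h1, h1, h1⟩

theorem lT_mem_St (c : ℕ → ℂ) (x y : ℂ) : lT c x y ∈ St := by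
  have key : ∀ R : ℕ, ∀ c : ℕ → ℂ, ∃ q ∈ St, ∃ δ, PP R δ ∧ lT c x y = q + δ := by
    intro R
    induction R with
    | zero => exact fun c => ⟨0, St.zero_mem, lT c x y, pp_lT c x y, (zero_add _).symm⟩
    | succ R ih =>
      intro c
      obtain ⟨q, hq, δ, hδ, h⟩ := ih fun n => c (n + 1)
      refine ⟨c 0 • 1 + tL x y * q, St.add_mem (St.smul_mem St.one_mem _)
        (St.mul_mem (tL_mem_St x y) hq), tL x y * δ, ?_, ?_⟩
      · have := (pp_tL x y).mul hδ
        rw [add_comm] at this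
        exact_mod_cast this
      · rw [lT_rec, h, mul_add, add_assoc]
  exact mem_St_of_approx fun R => key R c

end

noncomputable section

/-- The multiplicative monoid of Laurent polynomials generated by nonzero monomials and the
`T - s`, `s ∈ S`. -/
def MG (S : Set ℂ) : Submonoid (AddMonoidAlgebra ℂ ℤ) :=
  Submonoid.closure ({f | ∃ (i : ℤ) (c : ℂ), c ≠ 0 ∧ f = AddMonoidAlgebra.single i c} ∪
    {f | ∃ s ∈ S, f = AddMonoidAlgebra.single 1 1 - AddMonoidAlgebra.single 0 s})

/-- Insertion of a one-variable Laurent polynomial along the exponent `v`. -/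
def md (v : ℤ × ℤ) : AddMonoidAlgebra ℂ ℤ →ₐ[ℂ] AddMonoidAlgebra ℂ (ℤ × ℤ) :=
  AddMonoidAlgebra.mapDomainAlgHom ℂ ℂ (zmultiplesHom (ℤ × ℤ) v)

theorem md_single (v : ℤ × ℤ) (i : ℤ) (c : ℂ) :
    md v (AddMonoidAlgebra.single i c) = AddMonoidAlgebra.single (i • v) c := by
  rw [md, AddMonoidAlgebra.mapDomainAlgHom_apply, AddMonoidAlgebra.mapDomain_single]
  rfl

/-- The linear substitution of exponents sending the standard basis to `u`, `v`. -/
def sub2 (u v : ℤ × ℤ) : ℤ × ℤ →+ ℤ × ℤ :=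
  (zmultiplesHom (ℤ × ℤ) u).coprod (zmultiplesHom (ℤ × ℤ) v)

/-- The three exponential evaluations of a Laurent polynomial in two variables. -/
def E3 : AddMonoidAlgebra ℂ (ℤ × ℤ) →ₐ[ℂ] TT :=
  (ev2.comp (AddMonoidAlgebra.mapDomainAlgHom ℂ ℂ (sub2 (1, 0) (0, 1)))).prod
    ((ev2.comp (AddMonoidAlgebra.mapDomainAlgHom ℂ ℂ (sub2 (0, 1) (1, 0)))).prod
      (ev2.comp (AddMonoidAlgebra.mapDomainAlgHom ℂ ℂ (sub2 (1, 1) (1, 0)))))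

theorem E3_single (v : ℤ × ℤ) (i : ℤ) :
    E3 (AddMonoidAlgebra.single (i • v) 1) =
      lT (fun n => (i : ℂ) ^ n / (n.factorial : ℂ)) v.1 v.2 := by
  have h : ∀ (p q : ℤ × ℤ), (ev2.comp (AddMonoidAlgebra.mapDomainAlgHom ℂ ℂ (sub2 p q)))
      (AddMonoidAlgebra.single (i • v) 1) = lc (fun n => (i : ℂ) ^ n / (n.factorial : ℂ))
        ((v.1 * p.1 + v.2 * q.1 : ℤ) : ℂ) ((v.1 * p.2 + v.2 * q.2 : ℤ) : ℂ) := by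
    intro p q
    rw [lc_exp, AlgHom.comp_apply, AddMonoidAlgebra.mapDomainAlgHom_apply,
      AddMonoidAlgebra.mapDomain_single]
    have : sub2 p q (i • v) = (i * (v.1 * p.1 + v.2 * q.1), i * (v.1 * p.2 + v.2 * q.2)) := by
      simp only [sub2, AddMonoidHom.coprod_apply, zmultiplesHom_apply, Prod.smul_fst,
        Prod.smul_snd, smul_eq_mul]
      ext <;> simp <;> ring
    rw [this, ev2_single, one_smul]
  have h1 := h (1, 0) (0, 1)
  have h2 := h (0, 1) (1, 0)
  have h3 := h (1, 1) (1, 0)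
  simp only [mul_one, mul_zero, zero_add, add_zero] at h1 h2 h3
  push_cast at h3
  exact Prod.ext h1 (Prod.ext h2 h3)

theorem single_eq_smul (v : ℤ × ℤ) (c : ℂ) :
    (AddMonoidAlgebra.single v c : AddMonoidAlgebra ℂ (ℤ × ℤ)) =
      c • (AddMonoidAlgebra.single ((1 : ℤ) • (v.1, (0 : ℤ))) 1 *
        AddMonoidAlgebra.single ((1 : ℤ) • ((0 : ℤ), v.2)) 1) := by
  rw [AddMonoidAlgebra.single_mul_single, AddMonoidAlgebra.smul_single]
  simp

theorem E3_mem_St (P : AddMonoidAlgebra ℂ (ℤ × ℤ)) : E3 P ∈ St := by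
  induction P using AddMonoidAlgebra.induction_linear with
  | zero => rw [map_zero]; exact St.zero_mem
  | add f g hf hg => rw [map_add]; exact St.add_mem hf hg
  | single v c =>
    rw [single_eq_smul, map_smul, map_mul, E3_single, E3_single]
    exact St.smul_mem (St.mul_mem (lT_mem_St _ _ _) (lT_mem_St _ _ _)) _

theorem Can.smul {U : TT} (hU : Can U) {c : ℂ} (hc : c ≠ 0) : Can (c • U) := fun T hT => by
  refine hU T ?_
  rw [smul_mul_assoc] at hT
  have := NN.smul_mem c⁻¹ hT
  rwa [smul_smul, inv_mul_cancel₀ hc, one_smul] at this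

theorem can_E3_single (v : ℤ × ℤ) {c : ℂ} (hc : c ≠ 0) :
    Can (E3 (AddMonoidAlgebra.single v c)) := by
  have h1 : E3 (AddMonoidAlgebra.single v c) = c • E3 (AddMonoidAlgebra.single v 1) := by
    rw [← map_smul, AddMonoidAlgebra.smul_single, smul_eq_mul, mul_one]
  rw [h1]
  refine Can.smul (Can.of_mul_eq_one (E3_mem_St (AddMonoidAlgebra.single (-v) 1)) ?_) hc
  rw [← map_mul, AddMonoidAlgebra.single_mul_single, neg_add_cancel, mul_one]
  exact map_one E3

theorem can_E3_sub (v : ℤ × ℤ) (hv : Can (tL v.1 v.2)) (s : ℂ) :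
    Can (E3 (AddMonoidAlgebra.single v 1 - AddMonoidAlgebra.single 0 s)) := by
  have h0 : (AddMonoidAlgebra.single v 1 - AddMonoidAlgebra.single 0 s :
      AddMonoidAlgebra ℂ (ℤ × ℤ)) = AddMonoidAlgebra.single ((1 : ℤ) • v) 1 + (-s) • 1 := by
    rw [one_smul, AddMonoidAlgebra.one_def, AddMonoidAlgebra.smul_single, sub_eq_add_neg,
      ← AddMonoidAlgebra.single_neg]
    simp
  obtain ⟨e, he⟩ : ∃ e : ℕ → ℂ, e = fun n => ((1 : ℤ) : ℂ) ^ n / (n.factorial : ℂ) := ⟨_, rfl⟩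
  have he0 : e 0 = 1 := by simp [he]
  have he1 : e 1 = 1 := by simp [he]
  have h1 : E3 (AddMonoidAlgebra.single v 1 - AddMonoidAlgebra.single 0 s) =
      (1 - s) • 1 + tL v.1 v.2 * lT (fun n => e (n + 1)) v.1 v.2 := by
    rw [h0, map_add, E3_single, ← he, lT_rec, he0, map_smul, map_one, sub_eq_add_neg, add_smul,
      add_right_comm]
  rw [h1]
  by_cases hs : s = 1
  · have h2 : ((1 - s) • 1 + tL v.1 v.2 * lT (fun n => e (n + 1)) v.1 v.2 : TT) =
        tL v.1 v.2 * lT (fun n => e (n + 1)) v.1 v.2 := by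
      rw [hs, sub_self, zero_smul ℂ (1 : TT), zero_add]
    rw [h2]
    refine hv.mul (can_of_PP (lT_mem_St _ _ _) one_ne_zero ?_
      ((pp_tL v.1 v.2).mul (pp_lT (fun n => e (n + 1 + 1)) v.1 v.2)) pp_one)
    rw [lT_rec, he1]
  · refine can_of_PP ?_ (sub_ne_zero.2 (Ne.symm hs)) rfl ((pp_tL v.1 v.2).mul (pp_lT _ _ _)) pp_one
    exact St.add_mem (St.smul_mem St.one_mem _) (St.mul_mem (tL_mem_St _ _) (lT_mem_St _ _ _))

theorem can_E3_md {S : Set ℂ} {f : AddMonoidAlgebra ℂ ℤ} (hf : f ∈ MG S) (v : ℤ × ℤ)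
    (hv : Can (tL v.1 v.2)) : Can (E3 (md v f)) := by
  induction hf using Submonoid.closure_induction with
  | mem f hf =>
    rcases hf with ⟨i, c, hc, rfl⟩ | ⟨s, -, rfl⟩
    · rw [md_single]
      exact can_E3_single _ hc
    · rw [map_sub, md_single, md_single, one_smul, zero_smul]
      exact can_E3_sub v hv s
  | one => rw [map_one, map_one]; exact fun T hT => by rwa [one_mul] at hT
  | mul f g _ _ hf hg => rw [map_mul, map_mul]; exact hf.mul hg

/-- A triple of series with poles only along `x = 0`, `y = 0`, `x = y` in exponential coordinates
satisfies the residue identity. -/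
theorem mem_NN_of_relation {S : Set ℂ} {f g h : AddMonoidAlgebra ℂ ℤ} (hf : f ∈ MG S)
    (hg : g ∈ MG S) (hh : h ∈ MG S) {P : AddMonoidAlgebra ℂ (ℤ × ℤ)} {T : TT}
    (hT : E3 (md (1, 0) f * md (0, 1) g * md (1, -1) h) * T = E3 P) : T ∈ NN := by
  have h1 : Can (E3 (md (1, 0) f)) := can_E3_md hf _ fun T hT => by
    have : tL (((1 : ℤ), (0 : ℤ)).1 : ℂ) (((1 : ℤ), (0 : ℤ)).2 : ℂ) = tX := by
      simp [tL]
    rw [this] at hT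
    exact tX_mul_mem.1 hT
  have h2 : Can (E3 (md (0, 1) g)) := can_E3_md hg _ fun T hT => by
    have : tL (((0 : ℤ), (1 : ℤ)).1 : ℂ) (((0 : ℤ), (1 : ℤ)).2 : ℂ) = tY := by
      simp [tL]
    rw [this] at hT
    exact tY_mul_mem.1 hT
  have h3 : Can (E3 (md (1, -1) h)) := can_E3_md hh _ fun T hT => by
    have : tL (((1 : ℤ), (-1 : ℤ)).1 : ℂ) (((1 : ℤ), (-1 : ℤ)).2 : ℂ) = tX - tY := by
      have h : ∀ {A : Type} [CommRing A] [Algebra ℂ A] (x y : A),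
          (1 : ℂ) • x + (-1 : ℂ) • y = x - y := by
        intro A _ _ x y
        rw [one_smul, neg_one_smul, sub_eq_add_neg]
      rw [tL]
      push_cast
      exact h tX tY
    rw [this] at hT
    exact tXY_mul_mem.1 hT
  rw [map_mul, map_mul] at hT
  have h4 : E3 P ∈ NN := by
    have := E3_mem_St P 1 one_mem_NN
    rwa [mul_one] at this
  rw [← hT] at h4
  exact ((h1.mul h2).mul h3) T h4

end

noncomputable section

theorem residue_identity {T : TT} (hT : T ∈ NN) (m n k : ℤ) :
    ∑ᶠ i : ℕ, intChoose m i * (T.2.2.coeff (-(n + i) - 1)).coeff (-(m + k - i) - 1) =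
      ∑ᶠ i : ℕ, (-1) ^ i * intChoose n i * (T.1.coeff (-(k + i) - 1)).coeff (-(m + n - i) - 1) -
      (-1) ^ n * ∑ᶠ i : ℕ, (-1) ^ i * intChoose n i *
        (T.2.1.coeff (-(m + i) - 1)).coeff (-(n + k - i) - 1) := by
  have h := hT m n k
  have h1 : X0 (mon m n k * T) = ((monc k m 1 n * T.2.2).coeff (-1)).coeff (-1) -
      ((monc m n (-1) k * T.1).coeff (-1)).coeff (-1) +
      ((cK ((-1) ^ n) * monc k n (-1) m * T.2.1).coeff (-1)).coeff (-1) := rfl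
  have h2 : ((cK ((-1) ^ n) * monc k n (-1) m * T.2.1).coeff (-1)).coeff (-1) =
      (-1) ^ n * ((monc k n (-1) m * T.2.1).coeff (-1)).coeff (-1) := by
    rw [mul_assoc, cK_mul]
    rfl
  rw [h1, h2, coeff_monc_mul_finsum, coeff_monc_mul_finsum, coeff_monc_mul_finsum] at h
  have e1 : ∀ i : ℕ, intChoose m i * (T.2.2.coeff (-(n + i) - 1)).coeff (-(m + k - i) - 1) =
      intChoose m i * 1 ^ i * (T.2.2.coeff (-1 - n - i)).coeff (-1 - k - m + i) := fun i => by
    rw [one_pow, mul_one]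
    congr 2
    · congr 1; ring
    · ring
  have e2 : ∀ i : ℕ, (-1) ^ i * intChoose n i *
      (T.1.coeff (-(k + i) - 1)).coeff (-(m + n - i) - 1) =
      intChoose n i * (-1) ^ i * (T.1.coeff (-1 - k - i)).coeff (-1 - m - n + i) := fun i => by
    rw [mul_comm ((-1) ^ i)]
    congr 2
    · congr 1; ring
    · ring
  have e3 : ∀ i : ℕ, (-1) ^ i * intChoose n i *
      (T.2.1.coeff (-(m + i) - 1)).coeff (-(n + k - i) - 1) =
      intChoose n i * (-1) ^ i * (T.2.1.coeff (-1 - m - i)).coeff (-1 - k - n + i) := fun i => by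
    rw [mul_comm ((-1) ^ i)]
    congr 2
    · congr 1; ring
    · ring
  simp only [e1, e2, e3]
  linear_combination h

theorem cv_bound {Γ : Type} [AddCommGroup Γ] (L : Γ →+ ℤ) (f : AddMonoidAlgebra ℂ Γ) (c : ℤ) :
    ∃ c', ∀ A : Γ → ℂ, (∀ γ, L γ < c → A γ = 0) → ∀ γ, L γ < c' → cv Γ f A γ = 0 := by
  induction f using AddMonoidAlgebra.induction_linear with
  | zero => exact ⟨0, fun A _ γ _ => by rw [map_zero]; rfl⟩
  | add f g hf hg =>
    obtain ⟨c1, h1⟩ := hf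
    obtain ⟨c2, h2⟩ := hg
    refine ⟨min c1 c2, fun A hA γ hγ => ?_⟩
    rw [cv_add]
    change cv Γ f A γ + cv Γ g A γ = 0
    rw [h1 A hA γ (lt_of_lt_of_le hγ (min_le_left _ _)),
      h2 A hA γ (lt_of_lt_of_le hγ (min_le_right _ _)), add_zero]
  | single δ r =>
    refine ⟨c + L δ, fun A hA γ hγ => ?_⟩
    rw [cv_single, hA _ (by rw [map_sub]; omega), mul_zero]

/-- Sequences of operators. -/
abbrev Fld (W : Type) [AddCommGroup W] [Module ℂ W] : Type := ℤ → Module.End ℂ W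

variable {W : Type} [AddCommGroup W] [Module ℂ W]

/-- Lower truncation. -/
def IsFld (a : Fld W) : Prop := ∀ ω, ∃ N : ℤ, ∀ n < N, a n ω = 0

/-- The commutator of `a` and `b` is annihilated by `f(z₁/z₂)`. -/
def Loc (f : AddMonoidAlgebra ℂ ℤ) (a b : Fld W) : Prop :=
  ∀ (N : ℤ) (ω : W) (l : Module.Dual ℂ W),
    cv ℤ f (fun m => l (a m (b (N - m) ω))) = cv ℤ f (fun m => l (b (N - m) (a m ω)))

theorem Loc.mul_left {f : AddMonoidAlgebra ℂ ℤ} {a b : Fld W} (h : Loc f a b)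
    (g : AddMonoidAlgebra ℂ ℤ) : Loc (g * f) a b := fun N ω l => by
  rw [cv_mul, cv_mul, h]

/-- A product of two fields is supported in a finite window after multiplication by a locality
polynomial, uniformly in the functional. -/
theorem Loc.exists_window {f : AddMonoidAlgebra ℂ ℤ} {a b : Fld W} (h : Loc f a b)
    (ha : IsFld a) (hb : IsFld b) (N : ℤ) (ω : W) : ∃ s : Finset ℤ, ∀ l : Module.Dual ℂ W,
      ∀ m ∉ s, cv ℤ f (fun m => l (a m (b (N - m) ω))) m = 0 := by
  obtain ⟨p, hp⟩ := ha ω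
  obtain ⟨q, hq⟩ := hb ω
  obtain ⟨c1, h1⟩ := cv_bound (AddMonoidHom.id ℤ) f p
  obtain ⟨c2, h2⟩ := cv_bound (-AddMonoidHom.id ℤ) f (q - N)
  refine ⟨Finset.Icc c1 (-c2), fun l m hm => ?_⟩
  rw [Finset.mem_Icc, not_and_or, not_le, not_le] at hm
  rcases hm with hm | hm
  · rw [h N ω l]
    refine h1 _ (fun γ hγ => ?_) m hm
    rw [hp γ hγ, map_zero, map_zero]
  · refine h2 _ (fun γ hγ => ?_) m (by simp; omega)
    have : -γ < q - N := hγ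
    rw [hq (N - γ) (by omega), map_zero, map_zero]

theorem Loc.finite {f : AddMonoidAlgebra ℂ ℤ} {a b : Fld W} (h : Loc f a b)
    (ha : IsFld a) (hb : IsFld b) (N : ℤ) (ω : W) (l : Module.Dual ℂ W) :
    (cv ℤ f (fun m => l (a m (b (N - m) ω)))).support.Finite := by
  obtain ⟨s, hs⟩ := h.exists_window ha hb N ω
  refine s.finite_toSet.subset fun m hm => ?_
  by_contra hms
  exact hm (hs l m hms)

theorem cv_md_eq {v : ℤ × ℤ} {f : AddMonoidAlgebra ℂ ℤ} {A B : ℤ × ℤ → ℂ} {γ δ : ℤ × ℤ} {n : ℤ}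
    (hγ : γ = δ + n • v)
    (h : cv ℤ f (fun i => A (δ + i • v)) = cv ℤ f (fun i => B (δ + i • v))) :
    cv _ (md v f) A γ = cv _ (md v f) B γ := by
  have h1 := fun A => cv_mapDomain (zmultiplesHom (ℤ × ℤ) v) f A δ n
  have h2 : δ + (zmultiplesHom (ℤ × ℤ) v) n = γ := hγ.symm
  rw [h2] at h1
  exact (h1 A).trans ((congrFun h n).trans (h1 B).symm)

/-- The array of matrix coefficients of a triple product. -/
def tri (a b c : Fld W) (N : ℤ) (ω : W) (l : Module.Dual ℂ W) (p : ℤ × ℤ) : ℂ :=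
  l (a p.1 (b p.2 (c (N - p.1 - p.2) ω)))

/-- See `tri`; the order of the operators is `a`, `c`, `b`. -/
def tri132 (a b c : Fld W) (N : ℤ) (ω : W) (l : Module.Dual ℂ W) (p : ℤ × ℤ) : ℂ :=
  l (a p.1 (c (N - p.1 - p.2) (b p.2 ω)))

/-- See `tri`; the order of the operators is `b`, `a`, `c`. -/
def tri213 (a b c : Fld W) (N : ℤ) (ω : W) (l : Module.Dual ℂ W) (p : ℤ × ℤ) : ℂ :=
  l (b p.2 (a p.1 (c (N - p.1 - p.2) ω)))

/-- See `tri`; the order of the operators is `b`, `c`, `a`. -/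
def tri231 (a b c : Fld W) (N : ℤ) (ω : W) (l : Module.Dual ℂ W) (p : ℤ × ℤ) : ℂ :=
  l (b p.2 (c (N - p.1 - p.2) (a p.1 ω)))

theorem cv_tri_132 {f : AddMonoidAlgebra ℂ ℤ} {b c : Fld W} (h : Loc f b c) (a : Fld W)
    (N : ℤ) (ω : W) (l : Module.Dual ℂ W) :
    cv _ (md (0, 1) f) (tri a b c N ω l) = cv _ (md (0, 1) f) (tri132 a b c N ω l) := by
  funext γ
  refine cv_md_eq (δ := (γ.1, 0)) (n := γ.2) (by ext <;> simp) ?_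
  have := h (N - γ.1) ω (l.comp (a γ.1))
  simpa [tri, tri132] using this

theorem cv_tri_213 {f : AddMonoidAlgebra ℂ ℤ} {a b : Fld W} (h : Loc f a b) (c : Fld W)
    (N : ℤ) (ω : W) (l : Module.Dual ℂ W) :
    cv _ (md (1, -1) f) (tri a b c N ω l) = cv _ (md (1, -1) f) (tri213 a b c N ω l) := by
  funext γ
  refine cv_md_eq (δ := (0, γ.1 + γ.2)) (n := γ.1) (by ext <;> simp) ?_
  have := h (γ.1 + γ.2) (c (N - (γ.1 + γ.2)) ω) l
  simpa [tri, tri213, ← sub_eq_add_neg, sub_sub] using this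

theorem cv_tri_231 {f : AddMonoidAlgebra ℂ ℤ} {a c : Fld W} (h : Loc f a c) (b : Fld W)
    (N : ℤ) (ω : W) (l : Module.Dual ℂ W) :
    cv _ (md (1, 0) f) (tri213 a b c N ω l) = cv _ (md (1, 0) f) (tri231 a b c N ω l) := by
  funext γ
  refine cv_md_eq (δ := (0, γ.2)) (n := γ.1) (by ext <;> simp) ?_
  have := h (N - γ.2) ω (l.comp (b γ.2))
  simpa [tri231, tri213, sub_right_comm N γ.2] using this

theorem tri_finite {f g h : AddMonoidAlgebra ℂ ℤ} {a b c : Fld W} (ha : IsFld a)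
    (hb : IsFld b) (hc : IsFld c) (hac : Loc f a c) (hbc : Loc g b c) (hab : Loc h a b)
    (N : ℤ) (ω : W) (l : Module.Dual ℂ W) :
    (cv _ (md (1, 0) f * md (0, 1) g * md (1, -1) h) (tri a b c N ω l)).support.Finite := by
  set F := md (1, 0) f * md (0, 1) g * md (1, -1) h with hF
  have e1 : cv _ F (tri a b c N ω l) = cv _ F (tri132 a b c N ω l) := by
    rw [hF, mul_right_comm, cv_mul, cv_mul (md (1, 0) f * md (1, -1) h), cv_tri_132 hbc]
  have e2 : cv _ F (tri a b c N ω l) = cv _ F (tri231 a b c N ω l) := by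
    rw [hF, cv_mul, cv_tri_213 hab, ← cv_mul, mul_assoc, mul_comm (md (1, 0) f), cv_mul,
      cv_tri_231 hac, ← cv_mul]
  obtain ⟨p, hp⟩ := ha ω
  obtain ⟨q, hq⟩ := hb ω
  obtain ⟨r, hr⟩ := hc ω
  obtain ⟨c1, h1⟩ := cv_bound (AddMonoidHom.fst ℤ ℤ) F p
  obtain ⟨c2, h2⟩ := cv_bound (AddMonoidHom.snd ℤ ℤ) F q
  obtain ⟨c3, h3⟩ := cv_bound (-(AddMonoidHom.fst ℤ ℤ + AddMonoidHom.snd ℤ ℤ)) F (r - N)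
  refine ((Set.finite_Icc c1 (-c3 - c2)).prod (Set.finite_Icc c2 (-c3 - c1))).subset ?_
  intro γ hγ
  have k1 : c1 ≤ γ.1 := by
    by_contra hlt
    refine hγ ?_
    rw [e2]
    refine h1 _ (fun δ hδ => ?_) γ (not_le.1 hlt)
    rw [tri231, show (a δ.1) ω = 0 from hp _ hδ, map_zero, map_zero, map_zero]
  have k2 : c2 ≤ γ.2 := by
    by_contra hlt
    refine hγ ?_
    rw [e1]
    refine h2 _ (fun δ hδ => ?_) γ (not_le.1 hlt)
    rw [tri132, show (b δ.2) ω = 0 from hq _ hδ, map_zero, map_zero, map_zero]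
  have k3 : c3 ≤ -(γ.1 + γ.2) := by
    by_contra hlt
    refine hγ (h3 _ (fun δ hδ => ?_) γ (not_le.1 hlt))
    have : -(δ.1 + δ.2) < r - N := hδ
    rw [tri, hr _ (by omega), map_zero, map_zero, map_zero]
  exact ⟨⟨k1, by omega⟩, ⟨k2, by omega⟩⟩

end

noncomputable section

theorem relation_transport (h : ℤ × ℤ →+ ℤ × ℤ) (hh : Function.Bijective h) {A : ℤ × ℤ → ℂ}
    {F P : AddMonoidAlgebra ℂ (ℤ × ℤ)} {q : ℤ} {α : KK} (hA : BB q A) (hα : IsE2 A α)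
    (hF : cv _ F (fun v => A (h v)) = P.coeff) :
    (ev2.comp (AddMonoidAlgebra.mapDomainAlgHom ℂ ℂ h)) F * α =
      (ev2.comp (AddMonoidAlgebra.mapDomainAlgHom ℂ ℂ h)) P := by
  refine hα.relation hA ?_
  funext γ
  obtain ⟨n, rfl⟩ := hh.2 γ
  have h1 := cv_mapDomain h F A 0 n
  have h2 := cv_mapDomain h P (Pi.single 0 1) 0 n
  simp only [zero_add] at h1 h2
  have h3 : (fun n => (Pi.single 0 1 : ℤ × ℤ → ℂ) (h n)) = Pi.single 0 1 := by
    funext n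
    rw [Pi.single_apply, Pi.single_apply]
    simp only [map_eq_zero_iff h hh.1]
  rw [h3, cv_symbol, cv_symbol] at h2
  exact h1.trans ((congrFun hF n).trans h2.symm)

variable {W : Type} [AddCommGroup W] [Module ℂ W]

/-- `c` is the `j`-th product of `a` and `b`. -/
def IsProd (a b : Fld W) (j : ℤ) (c : Fld W) : Prop :=
  ∀ (N : ℤ) (ω : W) (l : Module.Dual ℂ W),
    l (c N ω) = (eps fun m => l (a m (b (N - m) ω))).coeff (-j - 1)

theorem eq_of_dual {x y : W} (h : ∀ l : Module.Dual ℂ W, l x = l y) : x = y :=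
  sub_eq_zero.1 ((Module.forall_dual_apply_eq_zero_iff ℂ _).1 fun l => by
    rw [map_sub, h, sub_self])

theorem fld_ext {a b : Fld W} (h : ∀ N ω (l : Module.Dual ℂ W), l (a N ω) = l (b N ω)) :
    a = b :=
  funext fun N => LinearMap.ext fun ω => eq_of_dual (h N ω)

theorem IsProd.unique {a b c c' : Fld W} {j : ℤ} (h : IsProd a b j c) (h' : IsProd a b j c') :
    c = c' :=
  fld_ext fun N ω l => by rw [h, h']

theorem exists_cv_vec (f : AddMonoidAlgebra ℂ ℤ) (x : ℤ → W) (γ : ℤ) :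
    ∃ y, ∀ l : Module.Dual ℂ W, cv ℤ f (fun m => l (x m)) γ = l y := by
  induction f using AddMonoidAlgebra.induction_linear with
  | zero => exact ⟨0, fun l => by simp⟩
  | add f g hf hg =>
    obtain ⟨y, hy⟩ := hf
    obtain ⟨z, hz⟩ := hg
    exact ⟨y + z, fun l => by rw [cv_add, Pi.add_apply, hy, hz, map_add]⟩
  | single i c => exact ⟨c • x (γ - i), fun l => by rw [cv_single, map_smul, smul_eq_mul]⟩

theorem eps_of_support {s : Finset ℤ} {A : ℤ → ℂ} (h : ∀ m ∉ s, A m = 0) :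
    eps A = ∑ m ∈ s, A m • exL (m : ℂ) := by
  have h1 : A = (∑ m ∈ s, AddMonoidAlgebra.single m (A m) : AddMonoidAlgebra ℂ ℤ).coeff := by
    funext n
    rw [AddMonoidAlgebra.coeff_sum, Finsupp.finsetSum_apply]
    simp only [AddMonoidAlgebra.coeff_single]
    by_cases hn : n ∈ s
    · rw [Finset.sum_eq_single_of_mem n hn fun m _ hm => Finsupp.single_eq_of_ne hm.symm,
        Finsupp.single_eq_same]
    · rw [h n hn, Finset.sum_eq_zero fun m hm =>
          Finsupp.single_eq_of_ne (by rintro rfl; exact hn hm)]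
  conv_lhs => rw [h1]
  rw [eps_symbol, map_sum]
  exact Finset.sum_congr rfl fun m _ => ev_single _ _

theorem mul_smul_comm_alg {K : Type} [CommRing K] [Algebra ℂ K] (x y : K) (c : ℂ) :
    x * c • y = c • (x * y) := mul_smul_comm c x y

theorem cv_translate (f : AddMonoidAlgebra ℂ ℤ) (A : ℤ → ℂ) (N m : ℤ) :
    cv ℤ f (fun n => A (N + n)) m = cv ℤ f A (N + m) := by
  have h := cv_mapDomain (AddMonoidHom.id ℤ) f A N m
  rw [AddMonoidAlgebra.mapDomainAlgHom_id] at h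
  exact h.symm

theorem Loc.exists_isProd {f : AddMonoidAlgebra ℂ ℤ} {a b : Fld W} (h : Loc f a b) (hf : f ≠ 0)
    (ha : IsFld a) (hb : IsFld b) (j : ℤ) : ∃ c, IsProd a b j c := by
  have h1 : ∀ (N : ℤ) (ω : W), ∃ x, ∀ l : Module.Dual ℂ W,
      l x = (eps fun m => l (a m (b (N - m) ω))).coeff (-j - 1) := by
    intro N ω
    obtain ⟨s, hs⟩ := h.exists_window ha hb N ω
    choose y hy using exists_cv_vec f fun m => a m (b (N - m) ω)
    refine ⟨∑ m ∈ s, ((ev f)⁻¹ * exL (m : ℂ)).coeff (-j - 1) • y m, fun l => ?_⟩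
    have h2 := eps_of_support (hs l)
    rw [eps_cv] at h2
    have h3 := congrArg ((ev f)⁻¹ * ·) h2
    simp only [inv_mul_cancel_left₀ (ev_ne_zero hf), Finset.mul_sum, hy] at h3
    rw [h3, map_sum, HahnSeries.coeff_sum]
    refine Finset.sum_congr rfl fun m _ => ?_
    rw [map_smul, smul_eq_mul, mul_comm]
    exact (congrArg (fun E : LaurentSeries ℂ => E.coeff (-j - 1))
      (mul_smul_comm_alg (ev f)⁻¹ (exL (m : ℂ)) (l (y m)))).symm
  choose x hx using h1
  refine ⟨fun N => { toFun := x N, map_add' := ?_, map_smul' := ?_ }, fun N ω l => hx N ω l⟩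
  · intro ω ω'
    refine eq_of_dual fun l => ?_
    rw [map_add, hx, hx, hx, ← HahnSeries.coeff_add, ← map_add]
    congr 2
    funext m
    simp
  · intro c ω
    refine eq_of_dual fun l => ?_
    rw [RingHom.id_apply, map_smul, hx, hx, ← HahnSeries.coeff_smul, ← map_smul]
    congr 2
    funext m
    simp

theorem IsProd.isFld {f : AddMonoidAlgebra ℂ ℤ} {a b c : Fld W} {j : ℤ} (hc : IsProd a b j c)
    (h : Loc f a b) (hf : f ≠ 0) (ha : IsFld a) (hb : IsFld b) : IsFld c := by
  intro ω
  obtain ⟨p, hp⟩ := ha ω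
  obtain ⟨q, hq⟩ := hb ω
  obtain ⟨c1, h1⟩ := cv_bound (AddMonoidHom.id ℤ) f p
  obtain ⟨c2, h2⟩ := cv_bound (-AddMonoidHom.id ℤ) f q
  refine ⟨c1 + c2, fun N hN => eq_of_dual fun l => ?_⟩
  have h3 : cv ℤ f (fun m => l (a m (b (N - m) ω))) = 0 := by
    funext m
    rcases lt_or_ge m c1 with hm | hm
    · rw [h N ω l]
      refine h1 _ (fun γ hγ => ?_) m hm
      rw [hp γ hγ, map_zero, map_zero]
    · have h4 := h2 (fun m => l (a (N + m) (b (N - (N + m)) ω))) (fun γ hγ => by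
        have h5 : -γ < q := hγ
        rw [hq (N - (N + γ)) (by omega), map_zero, map_zero]) (m - N)
        (show -(m - N) < c2 by omega)
      rw [cv_translate f fun m => l (a m (b (N - m) ω)), add_sub_cancel] at h4
      exact h4
  rw [hc, map_zero]
  have h4 := congrArg eps h3
  rw [eps_cv, map_zero, mul_eq_zero] at h4
  rw [h4.resolve_left (ev_ne_zero hf), HahnSeries.coeff_zero]

theorem Loc.bound {f : AddMonoidAlgebra ℂ ℤ} {a b : Fld W} (h : Loc f a b) (hf : f ≠ 0)
    (ha : IsFld a) (hb : IsFld b) : ∃ q, ∀ N ω (l : Module.Dual ℂ W),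
      Low q (eps fun m => l (a m (b (N - m) ω))) := by
  obtain ⟨q, hq⟩ := eps_bound hf
  exact ⟨q, fun N ω l => hq _ (h.finite ha hb N ω l)⟩

theorem Loc.trunc {f : AddMonoidAlgebra ℂ ℤ} {a b : Fld W} (h : Loc f a b) (hf : f ≠ 0)
    (ha : IsFld a) (hb : IsFld b) : ∃ N : ℤ, ∀ j, N ≤ j → ∀ c, IsProd a b j c → c = 0 := by
  obtain ⟨q, hq⟩ := h.bound hf ha hb
  refine ⟨-q, fun j hj c hc => fld_ext fun N ω l => ?_⟩
  rw [hc, hq N ω l _ (by omega)]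
  simp

theorem sub2_bijective {u v : ℤ × ℤ} (h : u.1 * v.2 - u.2 * v.1 = 1 ∨ u.1 * v.2 - u.2 * v.1 = -1) :
    Function.Bijective (sub2 u v) := by
  have e : ∀ x, sub2 u v x = (x.1 * u.1 + x.2 * v.1, x.1 * u.2 + x.2 * v.2) := fun x => by
    simp [sub2, AddMonoidHom.coprod_apply]
    ext <;> simp
  obtain ⟨d, hd, hd'⟩ : ∃ d : ℤ, d * d = 1 ∧ u.1 * v.2 - u.2 * v.1 = d := by
    rcases h with h | h
    · exact ⟨1, rfl, h⟩
    · exact ⟨-1, rfl, h⟩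
  refine Function.bijective_iff_has_inverse.2
    ⟨fun y => (d * (y.1 * v.2 - y.2 * v.1), d * (u.1 * y.2 - u.2 * y.1)), fun x => ?_, fun y => ?_⟩
  · rw [e]
    ext
    · simp only
      linear_combination x.1 * hd + d * x.1 * hd'
    · simp only
      linear_combination x.2 * hd + d * x.2 * hd'
  · rw [e]
    ext
    · simp only
      linear_combination y.1 * hd + d * y.1 * hd'
    · simp only
      linear_combination y.2 * hd + d * y.2 * hd'

theorem MG.ne_zero {S : Set ℂ} {f : AddMonoidAlgebra ℂ ℤ} (hf : f ∈ MG S) : f ≠ 0 := by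
  induction hf using Submonoid.closure_induction with
  | mem f hf =>
    rcases hf with ⟨i, c, hc, rfl⟩ | ⟨s, -, rfl⟩
    · exact fun h => hc (AddMonoidAlgebra.single_eq_zero.1 h)
    · intro h
      have := congrArg (fun f => f.coeff 1) h
      simp at this
  | one => exact one_ne_zero
  | mul f g _ _ hf hg => exact mul_ne_zero hf hg

/-- The Borcherds identity for products of mutually local fields. -/
theorem isProd_borcherds {S : Set ℂ} {f g h : AddMonoidAlgebra ℂ ℤ} (hf : f ∈ MG S)
    (hg : g ∈ MG S) (hh : h ∈ MG S) {a b c : Fld W} (ha : IsFld a)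
    (hb : IsFld b) (hc : IsFld c) (hac : Loc f a c) (hbc : Loc g b c) (hab : Loc h a b)
    {ab ac bc : ℤ → Fld W} {abc bac a_bc : ℤ → ℤ → Fld W} (pab : ∀ j, IsProd a b j (ab j))
    (pac : ∀ j, IsProd a c j (ac j)) (pbc : ∀ j, IsProd b c j (bc j))
    (pabc : ∀ i j, IsProd (ab i) c j (abc i j)) (pbac : ∀ i j, IsProd b (ac i) j (bac i j))
    (pa_bc : ∀ i j, IsProd a (bc i) j (a_bc i j)) (m n k N : ℤ) (ω : W) (l : Module.Dual ℂ W) :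
    ∑ᶠ i : ℕ, intChoose m i * l (abc (n + i) (m + k - i) N ω) =
      ∑ᶠ i : ℕ, (-1) ^ i * intChoose n i * l (a_bc (k + i) (m + n - i) N ω) -
      (-1) ^ n * ∑ᶠ i : ℕ, (-1) ^ i * intChoose n i * l (bac (m + i) (n + k - i) N ω) := by
  obtain ⟨P, hP⟩ := exists_symbol (tri_finite ha hb hc hac hbc hab N ω l)
  obtain ⟨q1, hq1⟩ := hbc.bound (MG.ne_zero hg) hb hc
  obtain ⟨q2, hq2⟩ := hac.bound (MG.ne_zero hf) ha hc
  obtain ⟨q3, hq3⟩ := hab.bound (MG.ne_zero hh) ha hb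
  have B1 : BB q1 (tri a b c N ω l) := fun p => by
    have := hq1 (N - p) ω (l.comp (a p))
    exact this
  have B2 : BB q2 (fun v => tri213 a b c N ω l (v.2, v.1)) := fun p => by
    have := hq2 (N - p) ω (l.comp (b p))
    simp only [sub_right_comm N p] at this
    exact this
  have B3 : BB q3 (fun v => tri a b c N ω l (v.2, v.1 - v.2)) := fun p => by
    have := hq3 p (c (N - p) ω) l
    have e : ∀ j, N - j - (p - j) = N - p := fun j => by ring
    simp only [tri, e]
    exact this
  obtain ⟨α1, h1⟩ := B1.exists_isE2
  obtain ⟨α2, h2⟩ := B2.exists_isE2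
  obtain ⟨α3, h3⟩ := B3.exists_isE2
  have r1 := relation_transport (sub2 (1, 0) (0, 1)) (sub2_bijective (by simp)) B1 h1 (P := P)
    (F := md (1, 0) f * md (0, 1) g * md (1, -1) h) (by
      rw [← hP]; congr 1; funext v; congr 1; simp [sub2])
  have r2 := relation_transport (sub2 (0, 1) (1, 0)) (sub2_bijective (by simp)) B2 h2 (P := P)
    (F := md (1, 0) f * md (0, 1) g * md (1, -1) h) (by
      rw [← hP, cv_mul, cv_mul _ _ (tri a b c N ω l), cv_tri_213 hab]
      congr 2; funext v; congr 1; simp [sub2])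
  have r3 := relation_transport (sub2 (1, 1) (1, 0)) (sub2_bijective (by simp)) B3 h3 (P := P)
    (F := md (1, 0) f * md (0, 1) g * md (1, -1) h) (by
      rw [← hP]; congr 1; funext v; congr 1; simp [sub2])
  have hT : ((α1, α2, α3) : TT) ∈ NN := mem_NN_of_relation hf hg hh (P := P)
    (Prod.ext r1 (Prod.ext r2 r3))
  have c1 : ∀ k m, (α1.coeff (-k - 1)).coeff (-m - 1) = l (a_bc k m N ω) := fun k m => by
    rw [h1, pa_bc]
    congr 2
    funext p
    have := pbc k (N - p) ω (l.comp (a p))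
    exact this.symm
  have c2 : ∀ m k, (α2.coeff (-m - 1)).coeff (-k - 1) = l (bac m k N ω) := fun m k => by
    rw [h2, pbac]
    congr 2
    funext p
    have := pac m (N - p) ω (l.comp (b p))
    simp only [sub_right_comm N p] at this
    exact this.symm
  have c3 : ∀ n k, (α3.coeff (-n - 1)).coeff (-k - 1) = l (abc n k N ω) := fun n k => by
    rw [h3, pabc]
    congr 2
    funext p
    have := pab n p (c (N - p) ω) l
    have e : ∀ j, N - j - (p - j) = N - p := fun j => by ring
    simp only [tri, e]
    exact this.symm
  have := residue_identity hT m n k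
  simp only [c1, c2, c3] at this
  exact this

end

noncomputable section

/-- Inversion of the variable. -/
def inv1 : AddMonoidAlgebra ℂ ℤ →ₐ[ℂ] AddMonoidAlgebra ℂ ℤ :=
  AddMonoidAlgebra.mapDomainAlgHom ℂ ℂ (-AddMonoidHom.id ℤ)

theorem inv1_single (i : ℤ) (c : ℂ) :
    inv1 (AddMonoidAlgebra.single i c) = AddMonoidAlgebra.single (-i) c := by
  rw [inv1, AddMonoidAlgebra.mapDomainAlgHom_apply, AddMonoidAlgebra.mapDomain_single]
  rfl

theorem cv_inv1 (f : AddMonoidAlgebra ℂ ℤ) (A : ℤ → ℂ) (N m : ℤ) :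
    cv ℤ (inv1 f) A (N - m) = cv ℤ f (fun n => A (N - n)) m := by
  have h := cv_mapDomain (-AddMonoidHom.id ℤ) f A N m
  simp only [AddMonoidHom.neg_apply, AddMonoidHom.id_apply, ← sub_eq_add_neg] at h
  exact h

theorem single_mem_MG (S : Set ℂ) (i : ℤ) {c : ℂ} (hc : c ≠ 0) :
    AddMonoidAlgebra.single i c ∈ MG S :=
  Submonoid.subset_closure (Or.inl ⟨i, c, hc, rfl⟩)

theorem sub_mem_MG {S : Set ℂ} {s : ℂ} (hs : s ∈ S) :
    AddMonoidAlgebra.single 1 1 - AddMonoidAlgebra.single 0 s ∈ MG S :=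
  Submonoid.subset_closure (Or.inr ⟨s, hs, rfl⟩)

theorem inv1_mem_MG {S : Set ℂ} (h0 : (0 : ℂ) ∉ S) (hinv : ∀ s ∈ S, s⁻¹ ∈ S)
    {f : AddMonoidAlgebra ℂ ℤ} (hf : f ∈ MG S) : inv1 f ∈ MG S := by
  induction hf using Submonoid.closure_induction with
  | mem f hf =>
    rcases hf with ⟨i, c, hc, rfl⟩ | ⟨s, hs, rfl⟩
    · rw [inv1_single]
      exact single_mem_MG S _ hc
    · have hs0 : s ≠ 0 := fun h => h0 (h ▸ hs)
      have : inv1 (AddMonoidAlgebra.single 1 1 - AddMonoidAlgebra.single 0 s) =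
          AddMonoidAlgebra.single (-1) (-s) *
            (AddMonoidAlgebra.single 1 1 - AddMonoidAlgebra.single 0 s⁻¹) := by
        rw [map_sub, inv1_single, inv1_single, mul_sub, AddMonoidAlgebra.single_mul_single,
          AddMonoidAlgebra.single_mul_single, show -s * s⁻¹ = -1 by rw [neg_mul, mul_inv_cancel₀ hs0],
          AddMonoidAlgebra.single_neg, mul_one, AddMonoidAlgebra.single_neg]
        simp only [neg_add_cancel, add_zero, neg_zero]
        abel
      rw [this]
      exact mul_mem (single_mem_MG S _ (neg_ne_zero.2 hs0)) (sub_mem_MG (hinv s hs))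
  | one => rw [map_one]; exact one_mem _
  | mul f g _ _ hf hg => rw [map_mul]; exact mul_mem hf hg

variable {W : Type} [AddCommGroup W] [Module ℂ W]

/-- Mutual locality with respect to a polynomial with zeros in `S`. -/
def LocS (S : Set ℂ) (a b : Fld W) : Prop := ∃ f ∈ MG S, Loc f a b

theorem LocS.symm {S : Set ℂ} (h0 : (0 : ℂ) ∉ S) (hinv : ∀ s ∈ S, s⁻¹ ∈ S) {a b : Fld W}
    (h : LocS S a b) : LocS S b a := by
  obtain ⟨f, hf, h⟩ := h
  refine ⟨inv1 f, inv1_mem_MG h0 hinv hf, fun N ω l => funext fun m => ?_⟩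
  obtain ⟨m, rfl⟩ : ∃ m', m = N - m' := ⟨N - m, by ring⟩
  rw [cv_inv1, cv_inv1]
  simp only [sub_sub_cancel]
  rw [h]

theorem LocS.add {S : Set ℂ} {a b c : Fld W} (hb : LocS S a b) (hc : LocS S a c) :
    LocS S a (b + c) := by
  obtain ⟨f, hf, hb⟩ := hb
  obtain ⟨g, hg, hc⟩ := hc
  refine ⟨f * g, mul_mem hf hg, fun N ω l => ?_⟩
  have h1 := (mul_comm g f ▸ hb.mul_left g) N ω l
  have h2 := (hc.mul_left f) N ω l
  have h3 := congrArg₂ (· + ·) h1 h2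
  simp only [← map_add] at h3
  convert h3 using 2 <;> funext m <;> simp

theorem LocS.smul {S : Set ℂ} {a b : Fld W} (hb : LocS S a b) (c : ℂ) :
    LocS S a (c • b) := by
  obtain ⟨f, hf, hb⟩ := hb
  refine ⟨f, hf, fun N ω l => ?_⟩
  have h3 := hb N ω (c • l)
  simpa using h3

/-- The identity field. -/
def idF : Fld W := Pi.single 0 1

theorem idF_apply (n : ℤ) (ω : W) : (idF n : Module.End ℂ W) ω = if n = 0 then ω else 0 := by
  rw [idF, Pi.single_apply]
  split_ifs <;> rfl

theorem locS_idF (S : Set ℂ) (a : Fld W) : LocS S a idF := by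
  refine ⟨1, one_mem _, fun N ω l => ?_⟩
  congr 1
  funext m
  rw [idF_apply, idF_apply]
  split_ifs <;> simp

theorem locS_zero (S : Set ℂ) (a : Fld W) : LocS S a 0 :=
  ⟨1, one_mem _, fun N ω l => by simp⟩

theorem isFld_zero : IsFld (0 : Fld W) := fun _ => ⟨0, fun _ _ => rfl⟩

theorem isFld_idF : IsFld (idF : Fld W) := fun ω => ⟨0, fun n hn => by
  rw [idF_apply, if_neg hn.ne]⟩

theorem IsFld.add {a b : Fld W} (ha : IsFld a) (hb : IsFld b) : IsFld (a + b) := fun ω => by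
  obtain ⟨p, hp⟩ := ha ω
  obtain ⟨q, hq⟩ := hb ω
  refine ⟨min p q, fun n hn => ?_⟩
  rw [Pi.add_apply, LinearMap.add_apply, hp n (by omega), hq n (by omega), add_zero]

theorem IsFld.smul {a : Fld W} (ha : IsFld a) (c : ℂ) : IsFld (c • a) := fun ω => by
  obtain ⟨p, hp⟩ := ha ω
  refine ⟨p, fun n hn => ?_⟩
  rw [Pi.smul_apply, LinearMap.smul_apply, hp n hn, smul_zero]

theorem eps_cv_md (f : AddMonoidAlgebra ℂ ℤ) (C : ℤ × ℤ → ℂ) (p : ℤ) (κ : ℤ) :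
    (eps fun j => cv _ (md (1, 0) f) C (p, j)).coeff κ =
      cv ℤ f (fun p => (eps fun j => C (p, j)).coeff κ) p := by
  induction f using AddMonoidAlgebra.induction_linear with
  | zero =>
    have : (fun j => cv (ℤ × ℤ) (md (1, 0) 0) C (p, j)) = 0 := by
      funext j
      simp
    rw [this, map_zero]
    simp
  | add f g hf hg =>
    have : (fun j => cv (ℤ × ℤ) (md (1, 0) (f + g)) C (p, j)) =
        (fun j => cv (ℤ × ℤ) (md (1, 0) f) C (p, j)) +
          fun j => cv (ℤ × ℤ) (md (1, 0) g) C (p, j) := by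
      funext j
      rw [map_add, cv_add]
      rfl
    rw [this, map_add, HahnSeries.coeff_add, hf, hg, cv_add]
    rfl
  | single i c =>
    have : (fun j => cv (ℤ × ℤ) (md (1, 0) (AddMonoidAlgebra.single i c)) C (p, j)) =
        c • fun j => C (p - i, j) := by
      funext j
      rw [md_single, cv_single]
      simp
    rw [this, map_smul, HahnSeries.coeff_smul, cv_single, smul_eq_mul]

theorem low_exL_sub_one (a : ℂ) : Low 1 (exL a - 1) := by
  intro κ hκ
  rw [HahnSeries.coeff_sub, exL_coeff, HahnSeries.coeff_one]
  rcases lt_or_eq_of_le (Int.lt_add_one_iff.1 hκ : κ ≤ 0) with h | rfl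
  · rw [if_pos h, if_neg h.ne, sub_zero]
  · simp

theorem sub_smul_mul_eq {K : Type} [CommRing K] [Algebra ℂ K] (x y : K) (c : ℂ) :
    c • (x * y) - c • y = c • ((x - 1) * y) := by
  rw [sub_one_mul, smul_sub]

theorem bb_cv_of_linear_factor {q : ℤ} {C : ℤ × ℤ → ℂ} (hC : BB q C) (f : AddMonoidAlgebra ℂ ℤ)
    (h : cv _ (md (1, -1) f) C = 0) : BB (q + 1) (cv _ (md (1, 0) f) C) := by
  have key : ∀ (f : AddMonoidAlgebra ℂ ℤ) (p : ℤ),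
      Low (q + 1) (eps fun j => (cv _ (md (1, -1) f) C (p, j) - cv _ (md (1, 0) f) C (p, j))) := by
    clear h f
    intro f p
    induction f using AddMonoidAlgebra.induction_linear with
    | zero =>
      have : (fun j => cv (ℤ × ℤ) (md (1, -1) 0) C (p, j) - cv (ℤ × ℤ) (md (1, 0) 0) C (p, j)) =
          0 := by
        funext j
        simp
      rw [this, map_zero]
      exact fun _ _ => rfl
    | add f g hf hg =>
      have : (fun j => cv (ℤ × ℤ) (md (1, -1) (f + g)) C (p, j) -
          cv (ℤ × ℤ) (md (1, 0) (f + g)) C (p, j)) =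
          (fun j => cv (ℤ × ℤ) (md (1, -1) f) C (p, j) - cv (ℤ × ℤ) (md (1, 0) f) C (p, j)) +
          fun j => cv (ℤ × ℤ) (md (1, -1) g) C (p, j) - cv (ℤ × ℤ) (md (1, 0) g) C (p, j) := by
        funext j
        rw [map_add (md (1, -1)), map_add (md (1, 0)), cv_add, cv_add]
        exact add_sub_add_comm _ _ _ _
      rw [this, map_add]
      exact hf.add hg
    | single i c =>
      have : (fun j => cv (ℤ × ℤ) (md (1, -1) (AddMonoidAlgebra.single i c)) C (p, j) -
          cv (ℤ × ℤ) (md (1, 0) (AddMonoidAlgebra.single i c)) C (p, j)) =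
          (fun j => c * (fun j => C (p - i, j)) (j - (-i))) - c • fun j => C (p - i, j) := by
        funext j
        rw [md_single, md_single, cv_single, cv_single]
        simp
      rw [this, map_sub, map_smul, eps_shift _ _ (fun j => C (p - i, j))]
      have h1 := ((low_exL_sub_one ((-i : ℤ) : ℂ)).mul (hC (p - i))).smul c
      rw [add_comm] at h1
      have h2 := sub_smul_mul_eq (exL ((-i : ℤ) : ℂ)) (eps fun j => C (p - i, j)) c
      intro κ hκ
      exact (congrArg (fun E : LaurentSeries ℂ => E.coeff κ) h2).trans (h1 κ hκ)
  intro p κ hκ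
  have h1 := key f p κ hκ
  rw [h] at h1
  have h2 : (fun j => (0 : ℤ × ℤ → ℂ) (p, j) - cv (ℤ × ℤ) (md (1, 0) f) C (p, j)) =
      -fun j => cv (ℤ × ℤ) (md (1, 0) f) C (p, j) := by
    funext j
    simp
  rw [h2, map_neg, HahnSeries.coeff_neg, neg_eq_zero] at h1
  exact h1

theorem bb_dong {q : ℤ} {C : ℤ × ℤ → ℂ} (hC : BB q C) (f : AddMonoidAlgebra ℂ ℤ)
    (h : cv _ (md (1, -1) f) C = 0) (n : ℕ) : BB (q + n) (cv _ (md (1, 0) (f ^ n)) C) := by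
  induction n with
  | zero => simpa using hC
  | succ n ih =>
    have h1 := bb_cv_of_linear_factor ih f (by rw [cv_comm, h, map_zero])
    rw [← cv_mul, ← map_mul, ← pow_succ'] at h1
    rw [Nat.cast_succ, ← add_assoc]
    exact h1

/-- Dong's lemma. -/
theorem LocS.dong {S : Set ℂ} {a b c d : Fld W} (hb : IsFld b) (hc : IsFld c)
    (hab : LocS S a b) (hac : LocS S a c) (hbc : LocS S b c) {k : ℤ} (hd : IsProd b c k d) :
    LocS S a d := by
  obtain ⟨f, hf, hab⟩ := hab
  obtain ⟨g, hg, hac⟩ := hac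
  obtain ⟨h, hh, hbc⟩ := hbc
  obtain ⟨q, hq⟩ := hbc.bound (MG.ne_zero hh) hb hc
  refine ⟨f ^ (-k - q).toNat * g, mul_mem (pow_mem hf _) hg, fun N ω l => ?_⟩
  set C := tri a b c N ω l - tri231 a b c N ω l with hCdef
  have e : ∀ p, (fun j => C (p, j)) = (fun j => l (a p (b j (c (N - p - j) ω)))) -
      fun j => l (b j (c (N - p - j) (a p ω))) := fun p => rfl
  have hC : BB q C := by
    intro p κ hκ
    rw [e, map_sub, HahnSeries.coeff_sub, sub_eq_zero]
    exact (hq (N - p) ω (l.comp (a p)) κ hκ).trans (hq (N - p) (a p ω) l κ hκ).symm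
  have h1 : cv _ (md (1, -1) f) (cv _ (md (1, 0) g) C) = 0 := by
    rw [← cv_mul, mul_comm, hCdef, map_sub, sub_eq_zero, cv_mul, cv_tri_213 hab, ← cv_mul,
      mul_comm, cv_mul, cv_tri_231 hac, ← cv_mul]
  have h2 := bb_dong (hC.cv (md (1, 0) g)) f h1 (-k - q).toNat
  rw [← cv_mul, ← map_mul] at h2
  rw [← sub_eq_zero, ← map_sub]
  funext p
  have h3 : ((fun m => l (a m (d (N - m) ω))) - fun m => l (d (N - m) (a m ω))) =
      fun p => (eps fun j => C (p, j)).coeff (-k - 1) := by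
    funext p
    rw [e, map_sub, HahnSeries.coeff_sub, Pi.sub_apply]
    exact congrArg₂ (· - ·) (hd (N - p) ω (l.comp (a p))) (hd (N - p) (a p ω) l)
  rw [h3, ← eps_cv_md]
  exact h2 p _ (by omega)

/-- The fields generated by `B`. -/
inductive Gen (S : Set ℂ) (B : Set (Fld W)) : Fld W → Prop
  | base {a : Fld W} : a ∈ B → Gen S B a
  | one : Gen S B idF
  | zero : Gen S B 0
  | add {a b : Fld W} : Gen S B a → Gen S B b → Gen S B (a + b)
  | smul (c : ℂ) {a : Fld W} : Gen S B a → Gen S B (c • a)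
  | prod {a b c : Fld W} {k : ℤ} : Gen S B a → Gen S B b → LocS S a b → IsProd a b k c → Gen S B c

theorem Gen.isFld {S : Set ℂ} {B : Set (Fld W)} (hB : ∀ a ∈ B, IsFld a) {a : Fld W}
    (h : Gen S B a) : IsFld a := by
  induction h with
  | base h => exact hB _ h
  | one => exact isFld_idF
  | zero => exact isFld_zero
  | add _ _ ha hb => exact ha.add hb
  | smul c _ ha => exact ha.smul c
  | prod _ _ hab hc ha hb =>
    obtain ⟨f, hf, h⟩ := hab
    exact hc.isFld h (MG.ne_zero hf) ha hb

theorem Gen.locS_of_base {S : Set ℂ} {B : Set (Fld W)} (hB : ∀ a ∈ B, IsFld a) {a b : Fld W}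
    (hab : ∀ b ∈ B, LocS S a b) (hb : Gen S B b) : LocS S a b := by
  induction hb with
  | base h => exact hab _ h
  | one => exact locS_idF S a
  | zero => exact locS_zero S a
  | add _ _ hb hc => exact hb.add hc
  | smul c _ hb => exact hb.smul c
  | prod hb hc hbc hd h1 h2 => exact h1.dong (hb.isFld hB) (hc.isFld hB) h2 hbc hd

theorem Gen.locS {S : Set ℂ} (h0 : (0 : ℂ) ∉ S) (hinv : ∀ s ∈ S, s⁻¹ ∈ S) {B : Set (Fld W)}
    (hB : ∀ a ∈ B, IsFld a) (hBB : ∀ a ∈ B, ∀ b ∈ B, LocS S a b) {a b : Fld W}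
    (ha : Gen S B a) (hb : Gen S B b) : LocS S a b :=
  hb.locS_of_base hB fun _ hb' =>
    (ha.locS_of_base hB (hBB _ hb')).symm h0 hinv

end

noncomputable section

theorem finite_of_trunc {X Y : Type} [Zero X] [Zero Y] {u : ℕ → X} {x : ℤ → Y} {N k : ℤ}
    (hN : ∀ n, N ≤ n → x n = 0) (hx : ∀ i : ℕ, x (k + i) = 0 → u i = 0) :
    u.support.Finite := by
  refine (Set.finite_Iio ((N - k).toNat)).subset fun i hi => ?_
  by_contra hlt
  rw [Set.mem_Iio, not_lt] at hlt
  exact hi (hx i (hN _ (by omega)))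

variable {W : Type} [AddCommGroup W] [Module ℂ W]

theorem IsProd.add_left {a a' b c c' : Fld W} {j : ℤ} (h : IsProd a b j c)
    (h' : IsProd a' b j c') : IsProd (a + a') b j (c + c') := fun N ω l => by
  rw [Pi.add_apply, LinearMap.add_apply, map_add, h, h', ← HahnSeries.coeff_add, ← map_add]
  congr 2
  funext m
  simp

theorem IsProd.smul_left {a b c : Fld W} {j : ℤ} (h : IsProd a b j c) (r : ℂ) :
    IsProd (r • a) b j (r • c) := fun N ω l => by
  rw [Pi.smul_apply, LinearMap.smul_apply, map_smul, h, ← HahnSeries.coeff_smul, ← map_smul]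
  congr 2
  funext m
  simp

theorem IsProd.add_right {a b b' c c' : Fld W} {j : ℤ} (h : IsProd a b j c)
    (h' : IsProd a b' j c') : IsProd a (b + b') j (c + c') := fun N ω l => by
  rw [Pi.add_apply, LinearMap.add_apply, map_add, h, h', ← HahnSeries.coeff_add, ← map_add]
  congr 2
  funext m
  simp

theorem IsProd.smul_right {a b c : Fld W} {j : ℤ} (h : IsProd a b j c) (r : ℂ) :
    IsProd a (r • b) j (r • c) := fun N ω l => by
  rw [Pi.smul_apply, LinearMap.smul_apply, map_smul, h, ← HahnSeries.coeff_smul, ← map_smul]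
  congr 2
  funext m
  simp

theorem isProd_idF_left (b : Fld W) (j : ℤ) : IsProd idF b j (if j = -1 then b else 0) := by
  intro N ω l
  have h : (fun m => l (idF m (b (N - m) ω))) =
      (AddMonoidAlgebra.single 0 (l (b N ω)) : AddMonoidAlgebra ℂ ℤ).coeff := by
    funext m
    rw [idF_apply, AddMonoidAlgebra.coeff_single, Finsupp.single_apply]
    by_cases hm : m = 0
    · subst hm
      simp
    · simp [hm, Ne.symm hm]
  rw [h, eps_symbol, ev_single, HahnSeries.coeff_smul, Int.cast_zero, exL_zero,
    HahnSeries.coeff_one]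
  by_cases hj : j = -1
  · subst hj
    simp
  · rw [if_neg hj, if_neg (by omega)]
    simp

theorem isProd_idF_right (b : Fld W) (j : ℤ) {c : Fld W}
    (hc : ∀ N, c N = (exL (N : ℂ)).coeff (-j - 1) • b N) : IsProd b idF j c := by
  intro N ω l
  have h : (fun m => l (b m ((idF (N - m) : Module.End ℂ W) ω))) =
      (AddMonoidAlgebra.single N (l (b N ω)) : AddMonoidAlgebra ℂ ℤ).coeff := by
    funext m
    rw [idF_apply, AddMonoidAlgebra.coeff_single, Finsupp.single_apply]
    by_cases hm : m = N
    · subst hm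
      simp
    · rw [if_neg (by omega), if_neg (Ne.symm hm), map_zero, map_zero]
  rw [h, eps_symbol, ev_single, HahnSeries.coeff_smul, hc, LinearMap.smul_apply, map_smul,
    smul_eq_mul, smul_eq_mul, mul_comm]

/-- A pairwise mutually local set of fields. -/
structure LocalSystem (S : Set ℂ) (B : Set (Fld W)) : Prop where
  zero_notMem : (0 : ℂ) ∉ S
  inv_mem : ∀ s ∈ S, s⁻¹ ∈ S
  isFld : ∀ a ∈ B, IsFld a
  locS : ∀ a ∈ B, ∀ b ∈ B, LocS S a b

/-- The space of fields generated by `B`. -/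
def genSpace (S : Set ℂ) (B : Set (Fld W)) : Submodule ℂ (Fld W) where
  carrier := {a | Gen S B a}
  add_mem' := Gen.add
  zero_mem' := Gen.zero
  smul_mem' c _ := Gen.smul c

namespace LocalSystem

variable {S : Set ℂ} {B : Set (Fld W)}

theorem isFld' (h : LocalSystem S B) (a : genSpace S B) : IsFld a.1 := Gen.isFld h.isFld a.2

theorem locS' (h : LocalSystem S B) (a b : genSpace S B) : LocS S a.1 b.1 :=
  Gen.locS h.zero_notMem h.inv_mem h.isFld h.locS a.2 b.2

theorem exists_prod (h : LocalSystem S B) (a b : genSpace S B) (j : ℤ) :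
    ∃ c : genSpace S B, IsProd a.1 b.1 j c.1 := by
  obtain ⟨f, hf, hl'⟩ := h.locS' a b
  obtain ⟨c, hc⟩ := hl'.exists_isProd (MG.ne_zero hf) (h.isFld' a) (h.isFld' b) j
  exact ⟨⟨c, Gen.prod a.2 b.2 (h.locS' a b) hc⟩, hc⟩

/-- The products of the generated fields. -/
def Y (h : LocalSystem S B) (a : genSpace S B) (j : ℤ) : Module.End ℂ (genSpace S B) where
  toFun b := Classical.choose (h.exists_prod a b j)
  map_add' b b' := Subtype.ext <| (Classical.choose_spec (h.exists_prod a (b + b') j)).unique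
    ((Classical.choose_spec (h.exists_prod a b j)).add_right
      (Classical.choose_spec (h.exists_prod a b' j)))
  map_smul' r b := Subtype.ext <| (Classical.choose_spec (h.exists_prod a (r • b) j)).unique
    ((Classical.choose_spec (h.exists_prod a b j)).smul_right r)

theorem isProd_Y (h : LocalSystem S B) (a b : genSpace S B) (j : ℤ) :
    IsProd a.1 b.1 j (h.Y a j b).1 :=
  Classical.choose_spec (h.exists_prod a b j)

theorem Y_eq (h : LocalSystem S B) {a b c : genSpace S B} {j : ℤ}
    (hc : IsProd a.1 b.1 j c.1) : h.Y a j b = c :=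
  Subtype.ext ((h.isProd_Y a b j).unique hc)

theorem Y_trunc (h : LocalSystem S B) (a b : genSpace S B) :
    ∃ N : ℤ, ∀ n, N ≤ n → h.Y a n b = 0 := by
  obtain ⟨f, hf, hl⟩ := h.locS' a b
  obtain ⟨N, hN⟩ := hl.trunc (MG.ne_zero hf) (h.isFld' a) (h.isFld' b)
  exact ⟨N, fun n hn => Subtype.ext (hN n hn _ (h.isProd_Y a b n))⟩

theorem Y_borcherds (h : LocalSystem S B) (u v w : genSpace S B) (m n k : ℤ) :
    (∑ᶠ i : ℕ, intChoose m i • h.Y (h.Y u (n + i) v) (m + k - i) w) =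
      ∑ᶠ i : ℕ, ((-1 : ℂ) ^ i * intChoose n i) •
        (h.Y u (m + n - i) (h.Y v (k + i) w)
          - ((-1 : ℂ) ^ n) • h.Y v (n + k - i) (h.Y u (m + i) w)) := by
  obtain ⟨f, hf, hac⟩ := h.locS' u w
  obtain ⟨g, hg, hbc⟩ := h.locS' v w
  obtain ⟨e, he, hab⟩ := h.locS' u v
  obtain ⟨N1, h1⟩ := h.Y_trunc u v
  obtain ⟨N2, h2⟩ := h.Y_trunc v w
  obtain ⟨N3, h3⟩ := h.Y_trunc u w
  have Y0 : ∀ j (b : genSpace S B), h.Y 0 j b = 0 := fun j b =>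
    h.Y_eq (fun N ω l => by
      have : (fun m => l ((0 : genSpace S B).1 m (b.1 (N - m) ω))) = 0 := by
        funext m
        simp
      rw [this, map_zero]
      simp)
  refine Subtype.ext (fld_ext fun N ω l => ?_)
  let φ : genSpace S B →ₗ[ℂ] ℂ := l.comp
    (((LinearMap.applyₗ ω).comp (LinearMap.proj N)).comp (genSpace S B).subtype)
  have hφ : ∀ a : genSpace S B, l (a.1 N ω) = φ a := fun a => rfl
  rw [hφ, hφ, ← LinearMap.toAddMonoidHom_coe, AddMonoidHom.map_finsum, AddMonoidHom.map_finsum]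
  rotate_left
  · refine (Set.finite_Iio (max (N2 - k).toNat (N3 - m).toNat)).subset fun i hi => ?_
    by_contra hlt
    rw [Set.mem_Iio, not_lt, max_le_iff] at hlt
    refine hi ?_
    beta_reduce
    rw [h2 (k + i) (by omega), h3 (m + i) (by omega), map_zero, map_zero, smul_zero, sub_zero, smul_zero]
  · refine finite_of_trunc (x := fun n => h.Y u n v) (k := n) h1 fun i hi => ?_
    beta_reduce at hi
    rw [hi, Y0, smul_zero]
  have key := isProd_borcherds hf hg he (h.isFld' u) (h.isFld' v) (h.isFld' w) hac hbc hab
    (h.isProd_Y u v) (h.isProd_Y u w) (h.isProd_Y v w) (fun i => h.isProd_Y (h.Y u i v) w)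
    (fun i => h.isProd_Y v (h.Y u i w)) (fun i => h.isProd_Y u (h.Y v i w)) m n k N ω l
  simp only [hφ] at key
  simp only [LinearMap.toAddMonoidHom_coe, map_smul, map_sub, smul_eq_mul, mul_sub]
  rw [finsum_sub_distrib, key, mul_finsum]
  · congr 1
    refine finsum_congr fun i => ?_
    ring
  · exact finite_of_trunc (x := fun n => h.Y v n w) (k := k) h2 fun i hi => by
      rw [hi, map_zero, map_zero, mul_zero]
  · exact finite_of_trunc (x := fun n => h.Y u n w) (k := m) h3 fun i hi => by
      rw [hi, map_zero, map_zero, mul_zero, mul_zero]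

/-- The vertex algebra generated by a local system. -/
def va (h : LocalSystem S B) : VertexAlg (genSpace S B) where
  Y := h.Y
  one := ⟨idF, Gen.one⟩
  Y_add u v n := LinearMap.ext fun b => h.Y_eq ((h.isProd_Y u b n).add_left (h.isProd_Y v b n))
  Y_smul c u n := LinearMap.ext fun b => h.Y_eq ((h.isProd_Y u b n).smul_left c)
  trunc := h.Y_trunc
  vacuum_Y n := LinearMap.ext fun b => h.Y_eq <| by
    have := isProd_idF_left b.1 n
    by_cases hn : n = -1
    · simpa [hn] using this
    · simpa [hn] using this
  create v n hn := h.Y_eq <| isProd_idF_right v.1 n fun N => by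
    rw [exL_coeff, if_pos (by omega), zero_smul]
    rfl
  create_neg_one v := h.Y_eq <| isProd_idF_right v.1 (-1) fun N => by
    simp [exL_coeff]
  borcherds := h.Y_borcherds

theorem va_D (h : LocalSystem S B) (a : genSpace S B) (N : ℤ) :
    (h.va.D a).1 N = (N : ℂ) • a.1 N := by
  have hc : IsProd a.1 idF (-2) (fun N => (N : ℂ) • a.1 N) :=
    isProd_idF_right a.1 (-2) fun N => by
      simp [exL_coeff]
  exact congrFun ((h.isProd_Y a h.va.one (-2)).unique hc) N

end LocalSystem

end

noncomputable section

theorem smul_mul_assoc_alg {K : Type} [CommRing K] [Algebra ℂ K] (c : ℂ) (x y : K) :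
    (c • x) * y = c • (x * y) := smul_mul_assoc c x y

/-- The derivative of a Laurent series. -/
def dL (E : LaurentSeries ℂ) : LaurentSeries ℂ := LaurentSeries.derivative ℂ E

theorem dL_coeff (E : LaurentSeries ℂ) (n : ℤ) : (dL E).coeff n = (n + 1) * E.coeff (n + 1) := by
  have h := LaurentSeries.hasseDeriv_coeff (R := ℂ) 1 E n
  rw [Ring.choose_one_right, zsmul_eq_mul] at h
  exact_mod_cast h

theorem dL_add (E F : LaurentSeries ℂ) : dL (E + F) = dL E + dL F := by
  ext n
  simp only [HahnSeries.coeff_add, dL_coeff]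
  ring

theorem dL_smul (c : ℂ) (E : LaurentSeries ℂ) : dL (c • E) = c • dL E := by
  ext n
  simp only [HahnSeries.coeff_smul, dL_coeff, smul_eq_mul]
  ring

theorem dL_exL_mul (a : ℂ) (E : LaurentSeries ℂ) :
    dL (exL a * E) = a • (exL a * E) + exL a * dL E := by
  obtain ⟨q, hq⟩ := exists_low E
  have hq1 : Low (q - 1) (dL E) := fun κ hκ => by rw [dL_coeff, hq _ (by omega), mul_zero]
  ext κ
  obtain ⟨n, hn⟩ : ∃ n : ℕ, κ - q + 1 ≤ n := ⟨(κ - q + 1).toNat, Int.self_le_toNat _⟩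
  rw [dL_coeff, HahnSeries.coeff_add, HahnSeries.coeff_smul, exL,
    coeff_ofPowerSeries_mul _ hq (κ + 1) (n := n + 1) (by push_cast; omega),
    coeff_ofPowerSeries_mul _ hq κ (n := n) hn,
    coeff_ofPowerSeries_mul _ hq1 κ (n := n + 1) (by push_cast; omega)]
  simp only [dL_coeff, PowerSeries.coeff_rescale, PowerSeries.coeff_exp]
  have key : ∑ r ∈ Finset.range (n + 1), (r : ℂ) *
      (a ^ r * algebraMap ℚ ℂ (1 / (r.factorial : ℚ)) * E.coeff (κ + 1 - r)) =
      a • ∑ r ∈ Finset.range n,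
        a ^ r * algebraMap ℚ ℂ (1 / (r.factorial : ℚ)) * E.coeff (κ - r) := by
    rw [Finset.sum_range_succ', smul_eq_mul, Finset.mul_sum]
    simp only [Nat.cast_zero, zero_mul, add_zero]
    refine Finset.sum_congr rfl fun r _ => ?_
    have hr : (κ + 1 - ((r + 1 : ℕ) : ℤ)) = κ - r := by push_cast; ring
    have h1 : ((r : ℂ) + 1) ≠ 0 := by exact_mod_cast r.succ_ne_zero
    have h2 : (r.factorial : ℂ) ≠ 0 := by exact_mod_cast r.factorial_ne_zero
    rw [hr, Nat.factorial_succ]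
    simp only [map_div₀, map_one, map_natCast, map_mul, Nat.cast_mul, Nat.cast_succ, map_add]
    field_simp
    ring
  rw [← key, Finset.mul_sum, ← Finset.sum_add_distrib]
  refine Finset.sum_congr rfl fun r _ => ?_
  have hr : κ - (r : ℤ) + 1 = κ + 1 - r := by ring
  rw [hr]
  push_cast
  ring

/-- Multiplication by the index. -/
def mulm (A : ℤ → ℂ) : ℤ → ℂ := fun m => m * A m

theorem exists_euler (f : AddMonoidAlgebra ℂ ℤ) : ∃ θ : AddMonoidAlgebra ℂ ℤ,
    (∀ A, mulm (cv ℤ f A) = cv ℤ θ A + cv ℤ f (mulm A)) ∧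
    ∀ E, dL (ev f * E) = ev θ * E + ev f * dL E := by
  induction f using AddMonoidAlgebra.induction_linear with
  | zero =>
    refine ⟨0, fun A => ?_, fun E => ?_⟩
    · funext m
      simp [mulm]
    · ext n
      simp [dL_coeff]
  | add f g hf hg =>
    obtain ⟨θ, h1, h2⟩ := hf
    obtain ⟨η, h3, h4⟩ := hg
    refine ⟨θ + η, fun A => ?_, fun E => ?_⟩
    · have e : mulm (cv ℤ (f + g) A) = mulm (cv ℤ f A) + mulm (cv ℤ g A) := by
        funext m
        simp [mulm, mul_add]
      rw [e, h1, h3, cv_add, cv_add]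
      abel
    · rw [map_add, map_add, add_mul, dL_add, h2, h4, add_mul, add_mul]
      abel
  | single δ c =>
    refine ⟨AddMonoidAlgebra.single δ (δ * c), fun A => ?_, fun E => ?_⟩
    · funext m
      simp only [mulm, Pi.add_apply, cv_single]
      push_cast
      ring
    · rw [ev_single, ev_single]
      refine (congrArg dL (smul_mul_assoc_alg c (exL (δ : ℂ)) E)).trans ?_
      rw [dL_smul, dL_exL_mul, smul_add, smul_smul, mul_comm c]
      refine congrArg₂ (· + ·) ?_ ?_
      · exact (smul_mul_assoc_alg _ _ _).symm
      · exact (smul_mul_assoc_alg _ _ _).symm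

/-- Sequences with finite support after convolution with a nonzero Laurent polynomial. -/
def Tors (A : ℤ → ℂ) : Prop := ∃ f ≠ 0, (cv ℤ f A).support.Finite

theorem mulm_finite {A : ℤ → ℂ} (hA : A.support.Finite) : (mulm A).support.Finite :=
  hA.subset fun m hm => fun h => hm (by simp [mulm, h])

theorem eps_mulm_of_finite {A : ℤ → ℂ} (hA : A.support.Finite) : eps (mulm A) = dL (eps A) := by
  obtain ⟨f, rfl⟩ := exists_symbol hA
  obtain ⟨θ, h1, h2⟩ := exists_euler f
  have h3 := h1 (Pi.single 0 1)
  have h4 : mulm (Pi.single 0 1) = 0 := by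
    funext m
    by_cases hm : m = 0
    · subst hm
      simp [mulm]
    · simp [mulm, hm]
  have h5 := h2 1
  have h6 : dL 1 = 0 := by
    ext n
    rw [dL_coeff, HahnSeries.coeff_one]
    split_ifs with h
    · have : ((n : ℂ) + 1) = 0 := by exact_mod_cast h
      rw [this, zero_mul]
      rfl
    · rw [mul_zero]
      rfl
  rw [cv_symbol, cv_symbol, h4, map_zero, add_zero] at h3
  rw [h6, mul_zero, add_zero, mul_one, mul_one] at h5
  rw [h3, eps_symbol, eps_symbol, h5]

theorem eps_mulm {A : ℤ → ℂ} (hA : Tors A) : eps (mulm A) = dL (eps A) := by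
  obtain ⟨f, hf, hA⟩ := hA
  obtain ⟨θ, h1, h2⟩ := exists_euler f
  have h3 := eps_mulm_of_finite hA
  rw [h1, map_add, eps_cv, eps_cv, eps_cv, h2] at h3
  exact mul_left_cancel₀ (ev_ne_zero hf) (add_left_cancel h3)

theorem Tors.mulm {A : ℤ → ℂ} (hA : Tors A) : Tors (mulm A) := by
  obtain ⟨f, hf, hA⟩ := hA
  obtain ⟨θ, h1, h2⟩ := exists_euler f
  refine ⟨f * f, mul_ne_zero hf hf, ?_⟩
  have h3 : cv ℤ (f * f) (_root_.mulm A) =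
      cv ℤ f (_root_.mulm (cv ℤ f A)) - cv ℤ θ (cv ℤ f A) := by
    rw [cv_mul, h1, map_add, cv_comm θ f]
    abel
  rw [h3]
  exact ((cv_finite f _ (mulm_finite hA)).union (cv_finite θ _ hA)).subset
    (Function.support_sub _ _)

theorem Tors.smul {A : ℤ → ℂ} (hA : Tors A) (c : ℂ) : Tors (c • A) := by
  obtain ⟨f, hf, hA⟩ := hA
  refine ⟨f, hf, ?_⟩
  rw [map_smul]
  exact hA.subset (Function.support_const_smul_subset c _)

end

noncomputable section

/-- The quasi-exponential `α^{-m} (-m)^i / i!`. -/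
def qexp (α : ℂ) (i : ℕ) (m : ℤ) : ℂ := α ^ (-m) * ((-(m : ℂ)) ^ i / (i.factorial : ℂ))

/-- The part of `qexp` supported on negative integers. -/
def psi (α : ℂ) (i : ℕ) (m : ℤ) : ℂ := if m < 0 then qexp α i m else 0

theorem psi_succ (α : ℂ) (i : ℕ) : psi α (i + 1) = (-1 / ((i : ℂ) + 1)) • mulm (psi α i) := by
  funext m
  have h1 : ((i : ℂ) + 1) ≠ 0 := by exact_mod_cast i.succ_ne_zero
  have h2 : (i.factorial : ℂ) ≠ 0 := by exact_mod_cast i.factorial_ne_zero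
  simp only [psi, qexp, mulm, Pi.smul_apply, smul_eq_mul]
  split_ifs
  · rw [Nat.factorial_succ]
    push_cast
    field_simp
    ring
  · simp

theorem cv_psi_zero {α : ℂ} (hα : α ≠ 0) :
    cv ℤ (1 - AddMonoidAlgebra.single 1 α⁻¹) (psi α 0) =
      (AddMonoidAlgebra.single 0 (-1) : AddMonoidAlgebra ℂ ℤ).coeff := by
  funext m
  rw [map_sub, map_one]
  change psi α 0 m - cv ℤ (AddMonoidAlgebra.single 1 α⁻¹) (psi α 0) m = _
  rw [cv_single, AddMonoidAlgebra.coeff_single, Finsupp.single_apply]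
  simp only [psi, qexp, pow_zero, Nat.factorial_zero, Nat.cast_one, div_one, mul_one]
  rcases lt_trichotomy m 0 with h | h | h
  · rw [if_pos h, if_pos (by omega), if_neg (by omega), show -(m - 1) = -m + 1 by ring,
      zpow_add₀ hα, zpow_one]
    field_simp
    ring
  · subst h
    simp [hα]
  · rw [if_neg (by omega), if_neg (by omega), if_neg (by omega)]
    ring

theorem one_sub_single_ne_zero (c : ℂ) :
    (1 - AddMonoidAlgebra.single 1 c : AddMonoidAlgebra ℂ ℤ) ≠ 0 := by
  intro h
  have h1 := congrArg (fun f : AddMonoidAlgebra ℂ ℤ => cv ℤ f (Pi.single 0 1) 0) h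
  simp only [map_sub, map_one, LinearMap.sub_apply, Pi.sub_apply, cv_single, map_zero] at h1
  simp at h1

theorem tors_psi {α : ℂ} (hα : α ≠ 0) (i : ℕ) : Tors (psi α i) := by
  induction i with
  | zero =>
    refine ⟨_, one_sub_single_ne_zero α⁻¹, ?_⟩
    rw [cv_psi_zero hα]
    exact Finsupp.hasFiniteSupport _
  | succ i ih =>
    rw [psi_succ]
    exact ih.mulm.smul _

theorem eps_psi_zero_mul {α : ℂ} (hα : α ≠ 0) :
    HahnSeries.ofPowerSeries ℤ ℂ (1 - PowerSeries.C α⁻¹ * PowerSeries.exp ℂ) * eps (psi α 0) =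
      -1 := by
  have h := congrArg eps (cv_psi_zero hα)
  rw [eps_cv, eps_symbol, map_sub, map_one, ev_single, ev_single] at h
  have h1 : (α⁻¹ • exL ((1 : ℤ) : ℂ) : LaurentSeries ℂ) =
      HahnSeries.ofPowerSeries ℤ ℂ (PowerSeries.C α⁻¹ * PowerSeries.exp ℂ) := by
    rw [map_mul, HahnSeries.ofPowerSeries_C, exL, Int.cast_one, PowerSeries.rescale_one]
    rw [HahnSeries.C_mul_eq_smul]
    rfl
  have h2 : ((-1 : ℂ) • exL ((0 : ℤ) : ℂ) : LaurentSeries ℂ) = -1 := by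
    rw [Int.cast_zero, exL_zero]
    ext n
    simp
  rw [h1, h2] at h
  rw [map_sub, map_one]
  exact h

theorem low_eps_psi_zero {α : ℂ} (hα : α ≠ 0) (h1 : α ≠ 1) : Low 0 (eps (psi α 0)) := by
  have h := eps_psi_zero_mul hα
  set p : PowerSeries ℂ := 1 - PowerSeries.C α⁻¹ * PowerSeries.exp ℂ with hp
  have hc : PowerSeries.constantCoeff p ≠ 0 := by
    rw [hp, map_sub, map_mul, PowerSeries.constantCoeff_C, PowerSeries.constantCoeff_exp, map_one,
      mul_one]
    intro h0
    exact h1 (by rw [← inv_inv α, ← sub_eq_zero.1 h0, inv_one])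
  have h3 : eps (psi α 0) = HahnSeries.ofPowerSeries ℤ ℂ (-p⁻¹) := by
    have h4 := congrArg (fun E => HahnSeries.ofPowerSeries ℤ ℂ p⁻¹ * E) h
    beta_reduce at h4
    rw [← mul_assoc, ← map_mul, PowerSeries.inv_mul_cancel p hc, map_one, one_mul] at h4
    rw [h4, map_neg, mul_neg, mul_one]
  rw [h3]
  exact low_ofPowerSeries _

theorem eps_psi_one_zero : ∀ κ < (0 : ℤ), (eps (psi 1 0)).coeff κ = if κ = -1 then 1 else 0 := by
  have h := eps_psi_zero_mul one_ne_zero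
  set p : PowerSeries ℂ := 1 - PowerSeries.C 1⁻¹ * PowerSeries.exp ℂ with hp
  have hX : PowerSeries.X ∣ p := by
    rw [PowerSeries.X_dvd_iff, hp]
    simp
  obtain ⟨u, hu⟩ := hX
  have hc : PowerSeries.constantCoeff u = -1 := by
    have h2 := congrArg (PowerSeries.coeff 1) hu
    rw [mul_comm, show (1 : ℕ) = 0 + 1 from rfl, PowerSeries.coeff_succ_mul_X] at h2
    rw [← PowerSeries.coeff_zero_eq_constantCoeff_apply, ← h2, hp]
    simp [PowerSeries.coeff_exp, PowerSeries.coeff_one]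
  have hc0 : PowerSeries.constantCoeff u ≠ 0 := by rw [hc]; norm_num
  have h3 : HahnSeries.single (1 : ℤ) (1 : ℂ) * eps (psi 1 0) =
      HahnSeries.ofPowerSeries ℤ ℂ (-u⁻¹) := by
    have h4 := congrArg (fun E => HahnSeries.ofPowerSeries ℤ ℂ u⁻¹ * E) h
    beta_reduce at h4
    rw [hu, mul_comm PowerSeries.X u, ← mul_assoc, ← map_mul, ← mul_assoc,
      PowerSeries.inv_mul_cancel u hc0, one_mul, HahnSeries.ofPowerSeries_X] at h4
    rw [h4, map_neg, mul_neg, mul_one]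
  intro κ hκ
  have h5 : (eps (psi 1 0)).coeff κ = (HahnSeries.ofPowerSeries ℤ ℂ (-u⁻¹)).coeff (κ + 1) := by
    rw [← h3, HahnSeries.coeff_single_mul_add, one_mul]
  rw [h5]
  by_cases h6 : κ = -1
  · subst h6
    rw [if_pos rfl, PowerSeries.coeff_coe, if_neg (by norm_num)]
    simp [hc]
  · rw [if_neg h6]
    exact low_ofPowerSeries _ _ (by omega)

theorem eps_psi_coeff {α : ℂ} (hα : α ≠ 0) (i j : ℕ) :
    (eps (psi α i)).coeff (-(j : ℤ) - 1) = if α = 1 ∧ i = j then 1 else 0 := by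
  induction i generalizing j with
  | zero =>
    by_cases h1 : α = 1
    · subst h1
      rw [eps_psi_one_zero _ (by omega)]
      refine if_congr ?_ rfl rfl
      constructor
      · intro h
        exact ⟨rfl, by omega⟩
      · intro h
        omega
    · rw [low_eps_psi_zero hα h1 _ (by omega), if_neg fun h => h1 h.1]
  | succ i ih =>
    have h1 : ((i : ℂ) + 1) ≠ 0 := by exact_mod_cast i.succ_ne_zero
    rw [psi_succ, map_smul, HahnSeries.coeff_smul, eps_mulm (tors_psi hα i), dL_coeff]
    cases j with
    | zero => simp
    | succ j =>
      rw [show (-((j + 1 : ℕ) : ℤ) - 1 + 1) = -(j : ℤ) - 1 by push_cast; ring, ih]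
      by_cases h : α = 1 ∧ i = j
      · rw [if_pos h, if_pos ⟨h.1, by rw [h.2]⟩]
        obtain ⟨-, rfl⟩ := h
        push_cast
        simp only [smul_eq_mul]
        field_simp
        ring
      · rw [if_neg h, if_neg (fun h' => h ⟨h'.1, by omega⟩)]
        simp

theorem finite_of_bounds {A : ℤ → ℂ} {p q : ℤ} (h1 : ∀ m, p ≤ m → A m = 0)
    (h2 : ∀ m, m < q → A m = 0) : A.support.Finite := by
  refine (Set.finite_Ico q p).subset fun m hm => ⟨?_, ?_⟩
  · by_contra h
    exact hm (h2 m (not_le.1 h))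
  · by_contra h
    exact hm (h1 m (not_lt.1 h))

/-- The polar part of the summation of a one-sided sequence is read off its commutator. -/
theorem eps_coeff_of_sub {s : Finset ℂ} (hs : ∀ α ∈ s, α ≠ 0) {I : ℕ} {q : ℂ → ℕ → ℂ}
    {A B : ℤ → ℂ} {M M' : ℤ} (hA : ∀ m, M ≤ m → A m = 0) (hB : ∀ m, m < M' → B m = 0)
    (h : ∀ m, A m - B m = ∑ α ∈ s, ∑ i ∈ Finset.range I, q α i * qexp α i m) (j : ℕ) :
    (eps A).coeff (-(j : ℤ) - 1) = if (1 : ℂ) ∈ s ∧ j < I then q 1 j else 0 := by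
  have h1 : (A - ∑ α ∈ s, ∑ i ∈ Finset.range I, q α i • psi α i).support.Finite := by
    refine finite_of_bounds (p := max M 0) (q := min M' 0) (fun m hm => ?_) fun m hm => ?_
    · have : ∀ α i, psi α i m = 0 := fun α i => if_neg (by omega)
      simp [hA m (by omega), this]
    · have : ∀ α i, psi α i m = qexp α i m := fun α i => if_pos (by omega)
      have h2 := h m
      rw [hB m (by omega), sub_zero] at h2
      simp [this, h2]
  have h2 := low_eps_of_finite h1 (-(j : ℤ) - 1) (by omega)
  rw [map_sub, map_sum, HahnSeries.coeff_sub, HahnSeries.coeff_sum, sub_eq_zero] at h2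
  rw [h2]
  have h3 : ∀ α ∈ s, (eps (∑ i ∈ Finset.range I, q α i • psi α i)).coeff (-(j : ℤ) - 1) =
      if α = 1 then (if j < I then q 1 j else 0) else 0 := by
    intro α hα
    rw [map_sum, HahnSeries.coeff_sum]
    simp only [map_smul, HahnSeries.coeff_smul, eps_psi_coeff (hs α hα), smul_eq_mul]
    by_cases h1 : α = 1
    · subst h1
      simp
    · simp [h1]
  rw [Finset.sum_congr rfl h3, Finset.sum_ite_eq']
  by_cases h4 : (1 : ℂ) ∈ s <;> simp [h4]

end

noncomputable section

theorem cv_sub_apply (f g : AddMonoidAlgebra ℂ ℤ) (A : ℤ → ℂ) (m : ℤ) :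
    cv ℤ (f - g) A m = cv ℤ f A m - cv ℤ g A m := by
  rw [map_sub]
  rfl

theorem cv_lin_apply (α : ℂ) (A : ℤ → ℂ) (m : ℤ) :
    cv ℤ (AddMonoidAlgebra.single 1 1 - AddMonoidAlgebra.single 0 α) A m =
      A (m - 1) - α * A m := by
  rw [cv_sub_apply, cv_single, cv_single, one_mul, sub_zero]

theorem cv_lin_qexp {α : ℂ} (hα : α ≠ 0) (i : ℕ) :
    cv ℤ (AddMonoidAlgebra.single 1 1 - AddMonoidAlgebra.single 0 α) (qexp α i) =
      ∑ l ∈ Finset.range i, (α / ((i - l).factorial : ℂ)) • qexp α l := by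
  funext m
  rw [cv_lin_apply, Finset.sum_apply]
  have h1 : ((-((m - 1 : ℤ) : ℂ)) : ℂ) = -(m : ℂ) + 1 := by push_cast; ring
  simp only [qexp, Pi.smul_apply, smul_eq_mul]
  rw [h1, show -(m - 1) = -m + 1 by ring, zpow_add₀ hα, zpow_one, add_pow, Finset.sum_range_succ]
  simp only [one_pow, mul_one, Nat.choose_self, Nat.cast_one, add_div, Finset.sum_div, mul_add]
  rw [show α * (α ^ (-m) * ((-(m : ℂ)) ^ i / (i.factorial : ℂ))) =
    α ^ (-m) * α * ((-(m : ℂ)) ^ i / (i.factorial : ℂ)) by ring, add_sub_cancel_right,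
    Finset.mul_sum]
  refine Finset.sum_congr rfl fun l hl => ?_
  rw [Finset.mem_range] at hl
  have h2 := Nat.choose_mul_factorial_mul_factorial hl.le
  have h3 : (i.choose l : ℂ) * l.factorial * (i - l).factorial = i.factorial := by
    exact_mod_cast h2
  have e1 : (i.factorial : ℂ) ≠ 0 := by exact_mod_cast i.factorial_ne_zero
  have e2 : (l.factorial : ℂ) ≠ 0 := by exact_mod_cast l.factorial_ne_zero
  have e3 : ((i - l).factorial : ℂ) ≠ 0 := by exact_mod_cast (i - l).factorial_ne_zero
  field_simp
  linear_combination (-(m : ℂ)) ^ l * h3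

theorem cv_lin_pow_qexp {α : ℂ} (hα : α ≠ 0) (I : ℕ) : ∀ i < I,
    cv ℤ ((AddMonoidAlgebra.single 1 1 - AddMonoidAlgebra.single 0 α) ^ I) (qexp α i) = 0 := by
  induction I with
  | zero => exact fun i hi => absurd hi (Nat.not_lt_zero i)
  | succ I ih =>
    intro i hi
    rw [pow_succ, cv_mul, cv_lin_qexp hα, map_sum]
    refine Finset.sum_eq_zero fun l hl => ?_
    rw [map_smul, ih l (by rw [Finset.mem_range] at hl; omega), smul_zero]

/-- The annihilator of the quasi-exponentials with bases in `s` and degrees below `I`. -/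
def killer (s : Finset ℂ) (I : ℕ) : AddMonoidAlgebra ℂ ℤ :=
  ∏ α ∈ s, (AddMonoidAlgebra.single 1 1 - AddMonoidAlgebra.single 0 α) ^ I

theorem killer_mem {S : Set ℂ} {s : Finset ℂ} (hs : ∀ α ∈ s, α ∈ S) (I : ℕ) :
    killer s I ∈ MG S :=
  prod_mem fun α hα => pow_mem (sub_mem_MG (hs α hα)) I

theorem cv_killer {s : Finset ℂ} (hs : ∀ α ∈ s, α ≠ 0) (I : ℕ) (q : ℂ → ℕ → ℂ) :
    cv ℤ (killer s I) (∑ α ∈ s, ∑ i ∈ Finset.range I, q α i • qexp α i) = 0 := by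
  rw [map_sum]
  refine Finset.sum_eq_zero fun α hα => ?_
  rw [map_sum]
  refine Finset.sum_eq_zero fun i hi => ?_
  rw [killer, ← Finset.mul_prod_erase s _ hα, mul_comm, cv_mul, map_smul,
    cv_lin_pow_qexp (hs α hα) I i (Finset.mem_range.1 hi), smul_zero, map_zero]

/-- Rescaling of the variable. -/
def tw (α : ℂ) : (ℤ → ℂ) →ₗ[ℂ] (ℤ → ℂ) where
  toFun A m := α ^ m * A m
  map_add' A B := by
    funext m
    simp [mul_add]
  map_smul' c A := by
    funext m
    simp [mul_left_comm]

theorem tw_apply (α : ℂ) (A : ℤ → ℂ) (m : ℤ) : tw α A m = α ^ m * A m := rfl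

theorem exists_cv_tw {β : ℂ} (hβ : β ≠ 0) (f : AddMonoidAlgebra ℂ ℤ) :
    ∃ g, ∀ A, tw β (cv ℤ f A) = cv ℤ g (tw β A) := by
  induction f using AddMonoidAlgebra.induction_linear with
  | zero => exact ⟨0, fun A => by simp⟩
  | add f g hf hg =>
    obtain ⟨f', hf⟩ := hf
    obtain ⟨g', hg⟩ := hg
    exact ⟨f' + g', fun A => by rw [cv_add, cv_add, map_add, hf, hg]⟩
  | single δ c =>
    refine ⟨AddMonoidAlgebra.single δ (c * β ^ δ), fun A => funext fun m => ?_⟩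
    rw [tw_apply, cv_single, cv_single, tw_apply, zpow_sub₀ hβ]
    field_simp

theorem tw_psi {α β : ℂ} (i : ℕ) : tw α (psi β i) = psi (β / α) i := by
  funext m
  rw [tw_apply]
  simp only [psi, qexp]
  split_ifs
  · rw [div_zpow, zpow_neg α m, div_inv_eq_mul]
    ring
  · rw [mul_zero]

/-- All rescalings by elements of `S` have regular summation. -/
def Reg (S : Set ℂ) (A : ℤ → ℂ) : Prop := ∀ α ∈ S, Low 0 (eps (tw α A))

theorem Reg.cv {S : Set ℂ} (h0 : (0 : ℂ) ∉ S) {A : ℤ → ℂ} (hA : Reg S A)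
    (f : AddMonoidAlgebra ℂ ℤ) : Reg S (_root_.cv ℤ f A) := by
  intro β hβ
  obtain ⟨g, hg⟩ := exists_cv_tw (fun h => h0 (h ▸ hβ)) f
  rw [hg, eps_cv]
  exact zero_add (0 : ℤ) ▸ (low_ev g).mul (hA β hβ)

theorem cv_bound_above (f : AddMonoidAlgebra ℂ ℤ) (c : ℤ) :
    ∃ c', ∀ A : ℤ → ℂ, (∀ m, c ≤ m → A m = 0) → ∀ m, c' ≤ m → cv ℤ f A m = 0 := by
  obtain ⟨c', h⟩ := cv_bound (-AddMonoidHom.id ℤ) f (-c + 1)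
  simp only [AddMonoidHom.neg_apply, AddMonoidHom.id_apply] at h
  exact ⟨-c' + 1, fun A hA m hm => h A (fun γ hγ => hA γ (by omega)) m (by omega)⟩

theorem eq_of_reg {S : Set ℂ} (h0 : (0 : ℂ) ∉ S) {f : AddMonoidAlgebra ℂ ℤ} (hf : f ∈ MG S) :
    ∀ {A B : ℤ → ℂ} {M M' : ℤ}, (∀ m, M ≤ m → A m = 0) → (∀ m, m < M' → B m = 0) →
      Reg S A → cv ℤ f A = cv ℤ f B → A = B := by
  induction hf using Submonoid.closure_induction with
  | mem f hf =>
    intro A B M M' hA hB hr h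
    rcases hf with ⟨i, c, hc, rfl⟩ | ⟨s, hs, rfl⟩
    · funext m
      have h1 := congrFun h (m + i)
      rw [cv_single, cv_single, add_sub_cancel_right] at h1
      exact mul_left_cancel₀ hc h1
    · have hs0 : s ≠ 0 := fun h => h0 (h ▸ hs)
      have h1 : ∀ m, tw s A m - tw s B m = tw s A (m - 1) - tw s B (m - 1) := fun m => by
        have h2 := congrFun h m
        rw [cv_lin_apply, cv_lin_apply] at h2
        simp only [tw_apply]
        rw [zpow_sub₀ hs0, zpow_one]
        field_simp
        linear_combination -h2
      have h3 : ∀ m, tw s A m - tw s B m = tw s A 0 - tw s B 0 := fun m => by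
        induction m using Int.induction_on with
        | zero => rfl
        | succ i ih => rw [h1, add_sub_cancel_right, ih]
        | pred i ih => rw [← h1, ih]
      have h4 := eps_coeff_of_sub (s := {1}) (by simp) (I := 1)
        (q := fun _ _ => tw s A 0 - tw s B 0) (A := tw s A) (B := tw s B) (M := M) (M' := M')
        (fun m hm => by rw [tw_apply, hA m hm, mul_zero])
        (fun m hm => by rw [tw_apply, hB m hm, mul_zero])
        (fun m => by simp [h3 m, qexp]) 0
      rw [hr s hs _ (by simp)] at h4
      have h5 : tw s A 0 - tw s B 0 = 0 := by simpa using h4.symm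
      funext m
      have h6 := h3 m
      rw [h5, tw_apply, tw_apply, sub_eq_zero] at h6
      exact mul_left_cancel₀ (zpow_ne_zero m hs0) h6
  | one =>
    intro A B M M' _ _ _ h
    simpa using h
  | mul f g hf hg ihf ihg =>
    intro A B M M' hA hB hr h
    rw [cv_mul, cv_mul] at h
    obtain ⟨c1, h1⟩ := cv_bound_above g M
    obtain ⟨c2, h2⟩ := cv_bound (AddMonoidHom.id ℤ) g M'
    exact ihg hA hB hr (ihf (h1 A hA) (h2 B hB) (hr.cv h0 g) h)

/-- The commutator of two mutually local sequences is determined by polar parts. -/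
theorem sub_eq_of_eps_coeff {S : Set ℂ} (h0 : (0 : ℂ) ∉ S) {f : AddMonoidAlgebra ℂ ℤ}
    (hf : f ∈ MG S) {s : Finset ℂ} (hs : ∀ α ∈ s, α ∈ S) {I : ℕ} {q : ℂ → ℕ → ℂ}
    {A B : ℤ → ℂ} {M M' : ℤ} (hA : ∀ m, M ≤ m → A m = 0) (hB : ∀ m, m < M' → B m = 0)
    (hq : ∀ α ∈ S, ∀ j : ℕ, (eps (tw α A)).coeff (-(j : ℤ) - 1) =
      if α ∈ s ∧ j < I then q α j else 0)
    (h : cv ℤ f A = cv ℤ f B) (m : ℤ) :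
    A m - B m = ∑ α ∈ s, ∑ i ∈ Finset.range I, q α i * qexp α i m := by
  have hs0 : ∀ α ∈ s, α ≠ 0 := fun α hα h => h0 (h ▸ hs α hα)
  set P : ℤ → ℂ := ∑ α ∈ s, ∑ i ∈ Finset.range I, q α i • psi α i with hP
  set Q : ℤ → ℂ := ∑ α ∈ s, ∑ i ∈ Finset.range I, q α i • qexp α i with hQ
  have hPQ : ∀ m < 0, P m = Q m := fun m hm => by
    have : ∀ α i, psi α i m = qexp α i m := fun α i => if_pos hm
    simp [hP, hQ, this]
  have hP0 : ∀ m, 0 ≤ m → P m = 0 := fun m hm => by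
    have : ∀ α i, psi α i m = 0 := fun α i => if_neg (by omega)
    simp [hP, this]
  have hreg : Reg S (A - P) := by
    intro α hα κ hκ
    have hα0 : α ≠ 0 := fun h => h0 (h ▸ hα)
    obtain ⟨j, rfl⟩ : ∃ j : ℕ, κ = -(j : ℤ) - 1 := ⟨(-κ - 1).toNat, by omega⟩
    rw [map_sub, map_sub, HahnSeries.coeff_sub, hq α hα, hP, map_sum, map_sum,
      HahnSeries.coeff_sum, sub_eq_zero]
    have h3 : ∀ β ∈ s, (eps (tw α (∑ i ∈ Finset.range I, q β i • psi β i))).coeff (-(j : ℤ) - 1) =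
        if β = α then (if j < I then q α j else 0) else 0 := by
      intro β hβ
      rw [map_sum, map_sum, HahnSeries.coeff_sum]
      simp only [map_smul, HahnSeries.coeff_smul, tw_psi, smul_eq_mul,
        eps_psi_coeff (div_ne_zero (hs0 β hβ) hα0), div_eq_one_iff_eq hα0]
      by_cases h1 : β = α
      · subst h1
        simp
      · simp [h1]
    rw [Finset.sum_congr rfl h3, Finset.sum_ite_eq']
    by_cases h4 : α ∈ s <;> simp [h4]
  have hk : cv ℤ (killer s I * f) (A - P) = cv ℤ (killer s I * f) (B + (Q - P)) := by
    rw [mul_comm, cv_mul, cv_mul, map_sub, map_add, map_sub (cv ℤ (killer s I)) Q, hQ,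
      cv_killer hs0, zero_sub, ← sub_eq_add_neg, map_sub, map_sub, cv_comm f _ A, h, cv_comm f _ B]
  have := eq_of_reg h0 (mul_mem (killer_mem hs I) hf) (M := max M 0) (M' := min M' 0)
    (fun m hm => by rw [Pi.sub_apply, hA m (by omega), hP0 m (by omega), sub_zero])
    (fun m hm => by
      rw [Pi.add_apply, hB m (by omega), Pi.sub_apply, hPQ m (by omega), sub_self, add_zero])
    hreg hk
  have h5 := congrFun this m
  have h6 : Q m = ∑ α ∈ s, ∑ i ∈ Finset.range I, q α i * qexp α i m := by
    simp [hQ]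
  rw [← h6]
  simp only [Pi.sub_apply, Pi.add_apply] at h5
  linear_combination h5

/-- The substitution `t ↦ -t`. -/
def nu (E : LaurentSeries ℂ) : LaurentSeries ℂ where
  coeff n := (-1) ^ n * E.coeff n
  isPWO_support' := E.isPWO_support.mono fun n hn h => hn (by
    simp only at h ⊢
    rw [h, mul_zero])

theorem nu_coeff (E : LaurentSeries ℂ) (n : ℤ) : (nu E).coeff n = (-1) ^ n * E.coeff n := rfl

theorem nu_exL_mul (a : ℂ) (E : LaurentSeries ℂ) : nu (exL a * E) = exL (-a) * nu E := by
  obtain ⟨q, hq⟩ := exists_low E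
  have hq1 : Low q (nu E) := fun κ hκ => by rw [nu_coeff, hq _ hκ, mul_zero]
  ext κ
  obtain ⟨n, hn⟩ : ∃ n : ℕ, κ - q + 1 ≤ n := ⟨(κ - q + 1).toNat, Int.self_le_toNat _⟩
  rw [nu_coeff, exL, exL, coeff_ofPowerSeries_mul _ hq κ hn, coeff_ofPowerSeries_mul _ hq1 κ hn,
    Finset.mul_sum]
  refine Finset.sum_congr rfl fun r _ => ?_
  have h1 : ((-1 : ℂ)) ^ κ = (-1) ^ r * (-1) ^ (κ - r) := by
    rw [← zpow_natCast, ← zpow_add₀ (by norm_num)]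
    congr 1
    ring
  rw [nu_coeff, PowerSeries.coeff_rescale, PowerSeries.coeff_rescale, h1, neg_pow a]
  ring

theorem nu_ev_mul (f : AddMonoidAlgebra ℂ ℤ) (E : LaurentSeries ℂ) :
    nu (ev f * E) = ev (inv1 f) * nu E := by
  induction f using AddMonoidAlgebra.induction_linear with
  | zero =>
    ext n
    simp [nu_coeff]
  | add f g hf hg =>
    rw [map_add, map_add, map_add, add_mul, add_mul, ← hf, ← hg]
    ext n
    simp [nu_coeff, mul_add]
  | single δ c =>
    rw [inv1_single, ev_single, ev_single]
    refine (congrArg nu (smul_mul_assoc_alg c (exL (δ : ℂ)) E)).trans ?_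
    refine Eq.trans ?_ (smul_mul_assoc_alg c (exL ((-δ : ℤ) : ℂ)) (nu E)).symm
    rw [Int.cast_neg, ← nu_exL_mul]
    ext n
    simp [nu_coeff, mul_left_comm]

theorem inv1_inv1 (f : AddMonoidAlgebra ℂ ℤ) : inv1 (inv1 f) = f := by
  induction f using AddMonoidAlgebra.induction_linear with
  | zero => simp
  | add f g hf hg => rw [map_add, map_add, hf, hg]
  | single δ c => rw [inv1_single, inv1_single, neg_neg]

theorem inv1_ne_zero {f : AddMonoidAlgebra ℂ ℤ} (hf : f ≠ 0) : inv1 f ≠ 0 := fun h =>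
  hf (by rw [← inv1_inv1 f, h, map_zero])

theorem eps_shift_single (N : ℤ) (A : ℤ → ℂ) :
    eps (fun m => A (m - N)) = exL (N : ℂ) * eps A := by
  have h := eps_cv (AddMonoidAlgebra.single N 1) A
  rw [ev_single, one_smul] at h
  rw [← h]
  congr 1
  funext m
  rw [cv_single, one_mul]

theorem eps_reverse_finite (N : ℤ) {A : ℤ → ℂ} (hA : A.support.Finite) :
    eps (fun m => A (N - m)) = exL (N : ℂ) * nu (eps A) := by
  obtain ⟨f, rfl⟩ := exists_symbol hA
  have h1 : (fun m => f.coeff (N - m)) = fun m => (inv1 f).coeff (m - N) := by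
    funext m
    rw [← cv_symbol, ← cv_symbol]
    have h2 := cv_inv1 f (Pi.single 0 1) 0 (N - m)
    rw [show 0 - (N - m) = m - N by ring] at h2
    rw [h2]
    refine congrArg (fun A => cv ℤ f A (N - m)) (funext fun n => ?_)
    simp [Pi.single_apply]
  rw [h1, eps_shift_single, eps_symbol, eps_symbol]
  have h3 := nu_ev_mul f 1
  have h4 : nu 1 = 1 := by
    ext n
    rw [nu_coeff, HahnSeries.coeff_one]
    split_ifs with h
    · rw [h]
      simp
    · rw [mul_zero]
  rw [h4, mul_one, mul_one] at h3
  rw [h3]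

theorem eps_reverse (N : ℤ) {A : ℤ → ℂ} (hA : Tors A) :
    eps (fun m => A (N - m)) = exL (N : ℂ) * nu (eps A) := by
  obtain ⟨f, hf, hA⟩ := hA
  have h1 := eps_reverse_finite N hA
  have h2 : (fun m => cv ℤ f A (N - m)) = cv ℤ (inv1 f) (fun m => A (N - m)) := by
    funext m
    rw [← cv_inv1, inv1_inv1]
  rw [h2, eps_cv, eps_cv, nu_ev_mul, mul_left_comm] at h1
  exact mul_left_cancel₀ (ev_ne_zero (inv1_ne_zero hf)) h1

end

noncomputable section

/-- Polynomials as Laurent polynomials. -/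
def pl : Polynomial ℂ →ₐ[ℂ] AddMonoidAlgebra ℂ ℤ :=
  Polynomial.aeval (AddMonoidAlgebra.single 1 1)

theorem pl_eq_sum (f : Polynomial ℂ) :
    pl f = ∑ i ∈ f.support, AddMonoidAlgebra.single (i : ℤ) (f.coeff i) := by
  rw [pl, Polynomial.aeval_def, Polynomial.eval₂_eq_sum, Polynomial.sum_def]
  refine Finset.sum_congr rfl fun i _ => ?_
  rw [AddMonoidAlgebra.single_pow, one_pow, ← Algebra.smul_def, AddMonoidAlgebra.smul_single]
  simp

theorem pl_coeff (f : Polynomial ℂ) (i : ℕ) : (pl f).coeff (i : ℤ) = f.coeff i := by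
  rw [pl_eq_sum, AddMonoidAlgebra.coeff_sum, Finsupp.finsetSum_apply]
  simp only [AddMonoidAlgebra.coeff_single, Finsupp.single_apply, Nat.cast_inj]
  rw [Finset.sum_ite_eq']
  split_ifs with h
  · rfl
  · exact (Polynomial.notMem_support_iff.1 h).symm

theorem pl_ne_zero {f : Polynomial ℂ} (hf : f ≠ 0) : pl f ≠ 0 := fun h => hf <| by
  ext i
  rw [← pl_coeff, h]
  rfl

theorem cv_pl (f : Polynomial ℂ) (A : ℤ → ℂ) (m : ℤ) :
    cv ℤ (pl f) A m = ∑ i ∈ f.support, f.coeff i * A (m - i) := by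
  rw [pl_eq_sum, map_sum, LinearMap.sum_apply, Finset.sum_apply]
  exact Finset.sum_congr rfl fun i _ => cv_single _ _ _ _

theorem ev_pl_coeff (f : Polynomial ℂ) (s : ℤ) :
    (ev (pl f)).coeff s = ∑ i ∈ f.support, f.coeff i * expC i s := by
  rw [pl_eq_sum, map_sum, HahnSeries.coeff_sum]
  refine Finset.sum_congr rfl fun i _ => ?_
  rw [ev_single, HahnSeries.coeff_smul, exL_coeff, expC, smul_eq_mul]
  congr 1
  by_cases hs : s < 0
  · rw [if_pos hs, if_neg (by omega)]
  · rw [if_neg hs, if_pos (by omega), show s.natAbs = s.toNat by omega]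
    push_cast
    rfl

theorem subC_eq (m r : ℤ) : subC m r = (exL (m : ℂ)).coeff r := by
  rw [exL_coeff, subC]
  by_cases hs : r < 0
  · rw [if_pos hs, if_neg (by omega)]
  · rw [if_neg hs, if_pos (by omega), show r.natAbs = r.toNat by omega]

theorem eps_coeff_of_finite {A : ℤ → ℂ} (hA : A.support.Finite) (r : ℤ) :
    (eps A).coeff r = ∑ᶠ m : ℤ, subC m r * A m := by
  obtain ⟨f, rfl⟩ := exists_symbol hA
  rw [eps_symbol, ev_eq_sum, HahnSeries.coeff_sum, finsum_eq_sum_of_support_subset (s := f.coeff.support)]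
  · refine Finset.sum_congr rfl fun m _ => ?_
    rw [HahnSeries.coeff_smul, subC_eq, smul_eq_mul, mul_comm]
  · intro m hm
    have := right_ne_zero_of_mul (Function.mem_support.1 hm)
    simpa using this

theorem coeff_mul_finsum (E F : LaurentSeries ℂ) (r : ℤ) :
    (E * F).coeff r = ∑ᶠ j : ℤ, E.coeff (r + j + 1) * F.coeff (-j - 1) := by
  rw [HahnSeries.coeff_mul]
  symm
  have hinj : Set.InjOn (fun ij : ℤ × ℤ => -ij.2 - 1)
      (Finset.antidiagonal E.isPWO_support F.isPWO_support r : Set (ℤ × ℤ)) := by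
    intro x hx y hy hxy
    rw [Finset.mem_coe, Finset.mem_antidiagonal] at hx hy
    simp only at hxy
    exact Prod.ext (by omega) (by omega)
  rw [finsum_eq_sum_of_support_subset
    (s := (Finset.antidiagonal E.isPWO_support F.isPWO_support r).image fun ij => -ij.2 - 1),
    Finset.sum_image hinj]
  · refine Finset.sum_congr rfl fun ij hij => ?_
    rw [Finset.mem_antidiagonal] at hij
    congr 2 <;> omega
  · intro j hj
    rw [Finset.mem_coe, Finset.mem_image]
    refine ⟨(r + j + 1, -j - 1), ?_, by ring⟩
    rw [Finset.mem_antidiagonal]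
    exact ⟨left_ne_zero_of_mul hj, right_ne_zero_of_mul hj, by ring⟩

theorem exists_polynomial {S : Set ℂ} {f : AddMonoidAlgebra ℂ ℤ} (hf : f ∈ MG S) :
    ∃ p : Polynomial ℂ, p ≠ 0 ∧ (∀ c, p.IsRoot c → c ∈ S) ∧ ∃ g, pl p = g * f := by
  induction hf using Submonoid.closure_induction with
  | mem f hf =>
    rcases hf with ⟨i, c, hc, rfl⟩ | ⟨s, hs, rfl⟩
    · refine ⟨1, one_ne_zero, fun c hc => by simp at hc,
        AddMonoidAlgebra.single (-i) c⁻¹, ?_⟩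
      rw [AddMonoidAlgebra.single_mul_single, neg_add_cancel, inv_mul_cancel₀ hc, map_one]
      rfl
    · refine ⟨Polynomial.X - Polynomial.C s, Polynomial.X_sub_C_ne_zero s, fun c hc => ?_, 1, ?_⟩
      · rw [Polynomial.root_X_sub_C] at hc
        exact hc ▸ hs
      · rw [one_mul, map_sub, pl, Polynomial.aeval_X, Polynomial.aeval_C]
        rfl
  | one => exact ⟨1, one_ne_zero, fun c hc => by simp at hc, 1, by simp⟩
  | mul f g _ _ hf hg =>
    obtain ⟨p, hp, hp', a, ha⟩ := hf
    obtain ⟨q, hq, hq', b, hb⟩ := hg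
    refine ⟨p * q, mul_ne_zero hp hq, fun c hc => ?_, a * b, ?_⟩
    · rcases Polynomial.root_mul.1 hc with h | h
      · exact hp' c h
      · exact hq' c h
    · rw [map_mul, ha, hb]
      ring

theorem pl_mem_MG {S : Set ℂ} {p : Polynomial ℂ} (hp : p ≠ 0) (h : ∀ c, p.IsRoot c → c ∈ S) :
    pl p ∈ MG S := by
  rw [(IsAlgClosed.splits p).eq_prod_roots, map_mul, map_multiset_prod, Multiset.map_map]
  refine mul_mem ?_ (multiset_prod_mem _ fun x hx => ?_)
  · rw [pl, Polynomial.aeval_C]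
    exact single_mem_MG S 0 (Polynomial.leadingCoeff_ne_zero.2 hp)
  · obtain ⟨c, hc, rfl⟩ := Multiset.mem_map.1 hx
    have h1 := sub_mem_MG (h c (Polynomial.isRoot_of_mem_roots hc))
    convert h1 using 1
    rw [Function.comp_apply, map_sub, pl, Polynomial.aeval_X, Polynomial.aeval_C]
    rfl

variable {W : Type} [AddCommGroup W] [Module ℂ W]

theorem dual_pCoeff2 (a b : Fld W) (f : Polynomial ℂ) (m k : ℤ) (ω : W) (l : Module.Dual ℂ W) :
    l (pCoeff2 a b f m k ω) = cv ℤ (pl f) (fun n => l (a n (b (m + k - n) ω))) m := by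
  rw [cv_pl, pCoeff2, LinearMap.sum_apply, map_sum]
  refine Finset.sum_congr rfl fun i _ => ?_
  rw [LinearMap.smul_apply, map_smul, smul_eq_mul, show m + k - (m - (i : ℤ)) = k + i by ring]
  rfl

theorem Loc.pCoeff2_bound {f : Polynomial ℂ} {a b : Fld W} (h : Loc (pl f) a b) (ha : IsFld a)
    (hb : IsFld b) (ω : W) : ∃ N : ℤ, ∀ m k : ℤ, (m < N ∨ k < N) → pCoeff2 a b f m k ω = 0 := by
  obtain ⟨p, hp⟩ := ha ω
  obtain ⟨q, hq⟩ := hb ω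
  refine ⟨min p (q - f.natDegree), fun m k hmk => eq_of_dual fun l => ?_⟩
  rw [map_zero, dual_pCoeff2]
  rcases hmk with hm | hk
  · rw [h, cv_pl]
    refine Finset.sum_eq_zero fun i _ => ?_
    rw [hp _ (by omega), map_zero, map_zero, mul_zero]
  · rw [cv_pl]
    refine Finset.sum_eq_zero fun i hi => ?_
    have := Polynomial.le_natDegree_of_mem_supp i hi
    rw [hq _ (by omega), map_zero, map_zero, mul_zero]

theorem finite_of_pCoeff2_bound {a b : Fld W} {f : Polynomial ℂ} {ω : W} {N : ℤ}
    (hN : ∀ m k : ℤ, (m < N ∨ k < N) → pCoeff2 a b f m k ω = 0) (n : ℤ) (l : Module.Dual ℂ W) :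
    (cv ℤ (pl f) (fun m => l (a m (b (n - m) ω)))).support.Finite := by
  refine finite_of_bounds (p := n - N + 1) (q := N) (fun m hm => ?_) fun m hm => ?_
  · have := dual_pCoeff2 a b f m (n - m) ω l
    rw [hN _ _ (Or.inr (by omega)), map_zero, add_sub_cancel] at this
    exact this.symm
  · have := dual_pCoeff2 a b f m (n - m) ω l
    rw [hN _ _ (Or.inl (by omega)), map_zero, add_sub_cancel] at this
    exact this.symm

/-- The associativity identity in coefficients is the identity of summations. -/
theorem assoc_iff_isProd {a b : Fld W} {c : ℤ → Fld W} {f : Polynomial ℂ} (hf : f ≠ 0)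
    (hfin : ∀ ω, ∃ N : ℤ, ∀ m k : ℤ, (m < N ∨ k < N) → pCoeff2 a b f m k ω = 0)
    (hc : ∃ N : ℤ, ∀ j, N ≤ j → c j = 0) :
    (∀ (r n : ℤ) (ω : W),
      (∑ᶠ j : ℤ, (∑ i ∈ f.support, f.coeff i * expC i (r + j + 1)) • c j n ω)
        = ∑ᶠ m : ℤ, subC m r • pCoeff2 a b f m (n - m) ω) ↔ ∀ j, IsProd a b j (c j) := by
  obtain ⟨Nc, hc⟩ := hc
  have hR : ∀ (r n : ℤ) (ω : W) (l : Module.Dual ℂ W),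
      l (∑ᶠ m : ℤ, subC m r • pCoeff2 a b f m (n - m) ω) =
        (ev (pl f) * eps fun m => l (a m (b (n - m) ω))).coeff r := by
    intro r n ω l
    obtain ⟨N, hN⟩ := hfin ω
    have hs : (Function.support fun m : ℤ => subC m r • pCoeff2 a b f m (n - m) ω).Finite := by
      refine (Set.finite_Icc N (n - N)).subset fun m hm => ?_
      by_contra h
      rw [Set.mem_Icc, not_and_or] at h
      exact hm (by beta_reduce; rw [hN _ _ (by omega), smul_zero])
    rw [← eps_cv, eps_coeff_of_finite (finite_of_pCoeff2_bound hN n l),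
      ← LinearMap.toAddMonoidHom_coe, AddMonoidHom.map_finsum _ hs]
    refine finsum_congr fun m => ?_
    rw [LinearMap.toAddMonoidHom_coe, map_smul, smul_eq_mul, dual_pCoeff2, add_sub_cancel]
  have hS : ∀ (n : ℤ) (ω : W) (l : Module.Dual ℂ W), ∃ E : LaurentSeries ℂ,
      ∀ j : ℤ, E.coeff (-j - 1) = l (c j n ω) := by
    intro n ω l
    refine ⟨HahnSeries.ofSuppBddBelow (fun κ => l (c (-κ - 1) n ω)) ⟨-Nc, fun κ hκ => ?_⟩,
      fun j => ?_⟩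
    · by_contra h
      refine hκ ?_
      beta_reduce
      rw [hc _ (by omega), Pi.zero_apply, LinearMap.zero_apply, map_zero]
    · change l (c (-(-j - 1) - 1) n ω) = _
      rw [show -(-j - 1) - 1 = j by ring]
  have hL : ∀ (r n : ℤ) (ω : W) (l : Module.Dual ℂ W) (E : LaurentSeries ℂ),
      (∀ j : ℤ, E.coeff (-j - 1) = l (c j n ω)) →
      l (∑ᶠ j : ℤ, (∑ i ∈ f.support, f.coeff i * expC i (r + j + 1)) • c j n ω) =
        (ev (pl f) * E).coeff r := by
    intro r n ω l E hE
    have hs : (Function.support fun j : ℤ =>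
        (∑ i ∈ f.support, f.coeff i * expC i (r + j + 1)) • c j n ω).Finite := by
      refine (Set.finite_Ico (-r - 1) Nc).subset fun j hj => ?_
      by_contra h
      rw [Set.mem_Ico, not_and_or] at h
      refine hj ?_
      beta_reduce
      rcases h with h | h
      · rw [← ev_pl_coeff, low_ev _ _ (by omega), zero_smul]
      · rw [hc _ (by omega), Pi.zero_apply, LinearMap.zero_apply, smul_zero]
    rw [coeff_mul_finsum, ← LinearMap.toAddMonoidHom_coe, AddMonoidHom.map_finsum _ hs]
    refine finsum_congr fun j => ?_
    rw [LinearMap.toAddMonoidHom_coe, map_smul, smul_eq_mul, hE, ev_pl_coeff]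
  constructor
  · intro h j n ω l
    obtain ⟨E, hE⟩ := hS n ω l
    have h1 : ev (pl f) * E = ev (pl f) * eps fun m => l (a m (b (n - m) ω)) := by
      ext r
      rw [← hL r n ω l E hE, ← hR, h]
    rw [← hE, mul_left_cancel₀ (ev_ne_zero (pl_ne_zero hf)) h1]
  · intro h r n ω
    refine eq_of_dual fun l => ?_
    obtain ⟨E, hE⟩ := hS n ω l
    have h1 : E = eps fun m => l (a m (b (n - m) ω)) := by
      ext κ
      have h2 := hE (-κ - 1)
      rw [h] at h2
      simpa using h2
    rw [hL r n ω l E hE, hR, h1]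

end

noncomputable section

namespace VertexAlg

variable {V : Type} [AddCommGroup V] [Module ℂ V]

/-- A vertex subalgebra, as a vertex algebra. -/
def restrict (VA : VertexAlg V) (P : Submodule ℂ V) (h1 : VA.one ∈ P)
    (hY : ∀ u ∈ P, ∀ v ∈ P, ∀ n, VA.Y u n v ∈ P) : VertexAlg P where
  Y u n := (VA.Y u.1 n).restrict fun v hv => hY u.1 u.2 v hv n
  one := ⟨VA.one, h1⟩
  Y_add u v n := LinearMap.ext fun w => Subtype.ext <| by
    simp [VA.Y_add, LinearMap.restrict_apply]
  Y_smul c u n := LinearMap.ext fun w => Subtype.ext <| by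
    simp [VA.Y_smul, LinearMap.restrict_apply]
  trunc u v := by
    obtain ⟨N, hN⟩ := VA.trunc u.1 v.1
    exact ⟨N, fun n hn => Subtype.ext (hN n hn)⟩
  vacuum_Y n := LinearMap.ext fun w => Subtype.ext <| by
    have := LinearMap.congr_fun (VA.vacuum_Y n) w.1
    rw [LinearMap.restrict_apply]
    refine this.trans ?_
    split_ifs <;> rfl
  create v n hn := Subtype.ext (VA.create v.1 n hn)
  create_neg_one v := Subtype.ext (VA.create_neg_one v.1)
  borcherds u v w m n k := P.injective_subtype <| by
    have e := fun f : ℕ → P =>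
      AddMonoidHom.map_finsum_of_injective P.subtype.toAddMonoidHom P.injective_subtype f
    simp only [LinearMap.toAddMonoidHom_coe] at e
    rw [e, e]
    exact VA.borcherds u.1 v.1 w.1 m n k

end VertexAlg

variable {C V : Type} [AddCommGroup C] [Module ℂ C] [AddCommGroup V] [Module ℂ V]

/-- The universal enveloping vertex algebra is generated by the conformal algebra. -/
theorem UnivVA.eq_top {CA : ConformalAlg C} (uva : UnivVA CA V) (P : Submodule ℂ V)
    (h1 : uva.va.one ∈ P) (hι : ∀ u, uva.ι u ∈ P)
    (hY : ∀ u ∈ P, ∀ v ∈ P, ∀ n, uva.va.Y u n v ∈ P) (v : V) : v ∈ P := by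
  obtain ⟨F, ⟨hF1, hFY, hFι⟩, -⟩ := uva.univ P (uva.va.restrict P h1 hY)
    (uva.ι.codRestrict P hι) (fun u => Subtype.ext (uva.ι_der u))
    (fun i u v => Subtype.ext (uva.ι_prod i u v))
  have hu := (uva.univ V uva.va uva.ι uva.ι_der uva.ι_prod).unique
    (y₁ := P.subtype ∘ₗ F) (y₂ := LinearMap.id)
    ⟨congrArg Subtype.val hF1, fun u n v => congrArg Subtype.val (hFY u n v),
      fun u => congrArg Subtype.val (hFι u)⟩ ⟨rfl, fun _ _ _ => rfl, fun _ => rfl⟩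
  have := LinearMap.congr_fun hu v
  exact (show ((F v : P) : V) = v from this) ▸ (F v).2

variable {W : Type} [AddCommGroup W] [Module ℂ W]

/-- Twisting by a character preserves products of fields. -/
theorem IsProd.twist {a b c : Fld W} {j : ℤ} (h : IsProd a b j c) {α : ℂ} (hα : α ≠ 0) :
    IsProd (fun n => α ^ n • a n) (fun n => α ^ n • b n) j (fun n => α ^ n • c n) := fun N ω l => by
  have e : (fun m => l ((α ^ m • a m) ((α ^ (N - m) • b (N - m)) ω))) =
      α ^ N • fun m => l (a m (b (N - m) ω)) := funext fun m => by
    simp only [LinearMap.smul_apply, map_smul, Pi.smul_apply, smul_smul]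
    rw [← zpow_add₀ hα, sub_add_cancel]
  rw [e, map_smul, HahnSeries.coeff_smul, ← h N ω l]
  simp

/-- If `d` acts as a derivation of weight equal to the mode on two fields, so it does on their
products. -/
theorem IsProd.derivation {a b c : Fld W} {j : ℤ} (h : IsProd a b j c) {d : Module.End ℂ W}
    (ha : ∀ n, d * a n - a n * d = (n : ℂ) • a n) (hb : ∀ n, d * b n - b n * d = (n : ℂ) • b n)
    (N : ℤ) : d * c N - c N * d = (N : ℂ) • c N := LinearMap.ext fun ω => by
  refine eq_of_dual fun l => ?_
  have ha' : ∀ n x, d (a n x) = a n (d x) + (n : ℂ) • a n x := fun n x => by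
    have := LinearMap.congr_fun (ha n) x
    simp only [LinearMap.sub_apply, Module.End.mul_apply, LinearMap.smul_apply] at this
    rw [← this]; abel
  have hb' : ∀ n x, d (b n x) = b n (d x) + (n : ℂ) • b n x := fun n x => by
    have := LinearMap.congr_fun (hb n) x
    simp only [LinearMap.sub_apply, Module.End.mul_apply, LinearMap.smul_apply] at this
    rw [← this]; abel
  have e : (fun m => (l ∘ₗ d) (a m (b (N - m) ω))) =
      (fun m => l (a m (b (N - m) (d ω)))) + (N : ℂ) • fun m => l (a m (b (N - m) ω)) :=
    funext fun m => by
      simp only [LinearMap.comp_apply, ha', hb', map_add, map_smul, Pi.add_apply, Pi.smul_apply,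
        smul_eq_mul]
      push_cast
      ring
  have h1 := h N ω (l ∘ₗ d)
  rw [e, map_add, map_smul, HahnSeries.coeff_add, HahnSeries.coeff_smul, ← h N ω l,
    ← h N (d ω) l] at h1
  simp only [LinearMap.comp_apply] at h1
  simp [h1]

end

noncomputable section

theorem finsum_finsum_smul {G M : Type*} [AddCommGroup M] [Module ℂ M] (c : G → ℕ → ℂ)
    {X : G → ℕ → M} {s : Finset G} {I : ℕ} (hs : ∀ g ∉ s, ∀ i, X g i = 0)
    (hI : ∀ g i, I ≤ i → X g i = 0) :
    ∑ᶠ g, ∑ᶠ i, c g i • X g i = ∑ g ∈ s, ∑ i ∈ Finset.range I, c g i • X g i := by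
  have h : ∀ g, ∑ᶠ i, c g i • X g i = ∑ i ∈ Finset.range I, c g i • X g i := fun g =>
    finsum_eq_sum_of_support_subset _ fun i hi => by
      by_contra hn
      simp only [Finset.coe_range, Set.mem_Iio, not_lt] at hn
      exact hi (by simp [hI g i hn])
  simp only [h]
  refine finsum_eq_sum_of_support_subset _ fun g hg => ?_
  by_contra hn
  exact hg (Finset.sum_eq_zero fun i _ => by rw [hs g hn i, smul_zero])

variable {C V W G : Type} [AddCommGroup C] [Module ℂ C] [AddCommGroup V] [Module ℂ V]
  [AddCommGroup W] [Module ℂ W] [Group G] {CA : ConformalAlg C} {ρC : G →* (C ≃ₗ[ℂ] C)}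
  {χ : G →* ℂˣ}

theorem ConformalAlg.exists_bounds
    (hG : ∀ u : C, {g : G | ∃ (i : ℕ) (v : C), CA.prod i (ρC g u) v ≠ 0}.Finite) (u v : C) :
    ∃ (s : Finset G) (I : ℕ), 1 ∈ s ∧ (∀ g ∉ s, ∀ i, CA.prod i (ρC g u) v = 0) ∧
      ∀ g i, I ≤ i → CA.prod i (ρC g u) v = 0 := by
  classical
  choose N hN using fun g => CA.loc (ρC g u) v
  have hs : ∀ g ∉ insert 1 (hG u).toFinset, ∀ i, CA.prod i (ρC g u) v = 0 := fun g hg i => by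
    by_contra h
    exact hg (Finset.mem_insert_of_mem ((hG u).mem_toFinset.2 ⟨i, v, h⟩))
  refine ⟨insert 1 (hG u).toFinset, (insert 1 (hG u).toFinset).sup N,
    Finset.mem_insert_self _ _, hs, fun g i hi => ?_⟩
  by_cases hg : g ∈ insert 1 (hG u).toFinset
  · exact hN g i ((Finset.le_sup hg).trans hi)
  · exact hs g hg i

/-- The values of a character. -/
def charSet (χ : G →* ℂˣ) : Set ℂ := Set.range fun g => (χ g : ℂ)

theorem zero_notMem_charSet : (0 : ℂ) ∉ charSet χ := fun ⟨g, hg⟩ => (χ g).ne_zero hg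

theorem inv_mem_charSet : ∀ s ∈ charSet χ, s⁻¹ ∈ charSet χ := by
  rintro _ ⟨g, rfl⟩
  exact ⟨g⁻¹, by simp⟩

theorem val_injective (hχ : Function.Injective χ) : Function.Injective fun g => (χ g : ℂ) :=
  Units.val_injective.comp hχ

theorem invFun_char (hχ : Function.Injective χ) (g : G) :
    Function.invFun (fun g => (χ g : ℂ)) (χ g : ℂ) = g :=
  Function.leftInverse_invFun (val_injective hχ) g

namespace CTildeGMod

variable (R : CTildeGMod CA ρC χ W)

/-- The generating fields of a module for the covariance algebra. -/
def field : C →ₗ[ℂ] Fld W where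
  toFun u n := R.T u (-n)
  map_add' u v := funext fun _ => R.T_add u v _
  map_smul' c u := funext fun _ => R.T_smul c u _

theorem field_apply (u : C) (n : ℤ) : R.field u n = R.T u (-n) := rfl

theorem isFld_field (u : C) : IsFld (R.field u) := fun ω => by
  obtain ⟨N, hN⟩ := R.res u ω
  exact ⟨-N, fun n hn => hN _ (by omega)⟩

open Classical in
theorem commutator (hχ : Function.Injective χ) {u v : C} {s : Finset G} {I : ℕ}
    (hs : ∀ g ∉ s, ∀ i, CA.prod i (ρC g u) v = 0)
    (hI : ∀ g i, I ≤ i → CA.prod i (ρC g u) v = 0) (N : ℤ) (ω : W) (l : Module.Dual ℂ W) (m : ℤ) :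
    l (R.field u m (R.field v (N - m) ω)) - l (R.field v (N - m) (R.field u m ω)) =
      ∑ α ∈ s.image fun g => (χ g : ℂ), ∑ i ∈ Finset.range I,
        l (R.field (CA.prod i (ρC (Function.invFun (fun g => (χ g : ℂ)) α) u) v) N ω) *
          qexp α i m := by
  have h0 : ∀ n, R.T 0 n = 0 := fun n => by simpa using R.T_smul 0 0 n
  have h := R.rel u v (-m) (-(N - m))
  rw [finsum_finsum_smul (s := s) (I := I) _ (fun g hg i => by rw [hs g hg i, h0])
    (fun g i hi => by rw [hI g i hi, h0])] at h
  have h' := congrArg l (LinearMap.congr_fun h ω)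
  rw [LinearMap.sub_apply, map_sub] at h'
  refine h'.trans ?_
  rw [Finset.sum_image (val_injective hχ).injOn]
  simp only [LinearMap.sum_apply, map_sum, invFun_char hχ]
  refine Finset.sum_congr rfl fun g _ => Finset.sum_congr rfl fun i _ => ?_
  rw [LinearMap.smul_apply, map_smul, field_apply, qexp, show -m + -(N - m) = -N by ring,
    smul_eq_mul, mul_comm]
  push_cast
  rfl

theorem localSystem (hχ : Function.Injective χ)
    (hG : ∀ u : C, {g : G | ∃ (i : ℕ) (v : C), CA.prod i (ρC g u) v ≠ 0}.Finite) :
    LocalSystem (charSet χ) (Set.range R.field) where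
  zero_notMem := zero_notMem_charSet
  inv_mem := inv_mem_charSet
  isFld := by rintro _ ⟨u, rfl⟩; exact R.isFld_field u
  locS := by
    classical
    rintro _ ⟨u, rfl⟩ _ ⟨v, rfl⟩
    obtain ⟨s, I, -, hs, hI⟩ := ConformalAlg.exists_bounds hG u v
    have hS : ∀ α ∈ s.image fun g => (χ g : ℂ), α ∈ charSet χ := by
      intro α hα
      obtain ⟨g, -, rfl⟩ := Finset.mem_image.1 hα
      exact ⟨g, rfl⟩
    refine ⟨killer (s.image fun g => (χ g : ℂ)) I, killer_mem hS I, fun N ω l => ?_⟩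
    rw [← sub_eq_zero, ← map_sub]
    convert cv_killer (s := s.image fun g => (χ g : ℂ))
      (fun α hα h => zero_notMem_charSet (h ▸ hS α hα)) I _ using 2
    rotate_left
    · exact fun α i =>
        l (R.field (CA.prod i (ρC (Function.invFun (fun g => (χ g : ℂ)) α) u) v) N ω)
    · funext m
      simpa [Finset.sum_apply] using R.commutator hχ hs hI N ω l m

theorem isProd_field (hχ : Function.Injective χ)
    (hG : ∀ u : C, {g : G | ∃ (i : ℕ) (v : C), CA.prod i (ρC g u) v ≠ 0}.Finite) (u v : C)
    (j : ℕ) : IsProd (R.field u) (R.field v) j (R.field (CA.prod j u v)) := fun N ω l => by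
  classical
  obtain ⟨s, I, h1, hs, hI⟩ := ConformalAlg.exists_bounds hG u v
  obtain ⟨M, hM⟩ := R.isFld_field v ω
  obtain ⟨M', hM'⟩ := R.isFld_field u ω
  rw [eps_coeff_of_sub (s := s.image fun g => (χ g : ℂ)) (M := N - M + 1) (M' := M')
    (fun α hα => by obtain ⟨g, -, rfl⟩ := Finset.mem_image.1 hα; exact (χ g).ne_zero)
    (fun m hm => by rw [hM _ (by omega), map_zero, map_zero])
    (fun m hm => by rw [hM' _ hm, map_zero, map_zero]) (R.commutator hχ hs hI N ω l)]
  have hinv : Function.invFun (fun g => (χ g : ℂ)) 1 = 1 := by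
    simpa using invFun_char hχ 1
  have hone : (1 : ℂ) ∈ s.image fun g => (χ g : ℂ) :=
    Finset.mem_image.2 ⟨1, h1, by simp⟩
  rw [hinv, map_one]
  split_ifs with h
  · rfl
  · have : CA.prod j u v = 0 := by simpa using hI 1 j (by by_contra hc; exact h ⟨hone, by omega⟩)
    rw [this, map_zero]
    simp

end CTildeGMod

end

noncomputable section

variable {C V W G : Type} [AddCommGroup C] [Module ℂ C] [AddCommGroup V] [Module ℂ V]
  [AddCommGroup W] [Module ℂ W] [Group G] {CA : ConformalAlg C} {ρC : G →* (C ≃ₗ[ℂ] C)}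
  {χ : G →* ℂˣ}

/-- A vertex algebra map into the algebra generated by a local system satisfies associativity. -/
theorem LocalSystem.assoc {VA : VertexAlg V} {B : Set (Fld W)} (h : LocalSystem (charSet χ) B)
    {F : V →ₗ[ℂ] genSpace (charSet χ) B}
    (hF : ∀ u n v, F (VA.Y u n v) = h.va.Y (F u) n (F v)) (u v : V) :
    ∃ f : Polynomial ℂ, f ≠ 0 ∧
    (∀ c : ℂ, f.IsRoot c → ∃ g : G, ((χ g : ℂ)) = c) ∧
    (∀ w : W, ∃ N : ℤ, ∀ m k : ℤ, (m < N ∨ k < N) →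
      pCoeff2 (F u).1 (F v).1 f m k w = 0) ∧
    (∀ (r n : ℤ) (w : W),
      (∑ᶠ j : ℤ, (∑ i ∈ f.support, f.coeff i * expC i (r + j + 1)) • (F (VA.Y u j v)).1 n w)
        = ∑ᶠ m : ℤ, subC m r • pCoeff2 (F u).1 (F v).1 f m (n - m) w) := by
  obtain ⟨f, hf, hl⟩ := h.locS' (F u) (F v)
  obtain ⟨p, hp, hroot, g, hg⟩ := exists_polynomial hf
  have hl' := hl.mul_left g
  rw [← hg] at hl'
  have hb := hl'.pCoeff2_bound (h.isFld' (F u)) (h.isFld' (F v))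
  refine ⟨p, hp, hroot, hb, (assoc_iff_isProd (c := fun j => (F (VA.Y u j v)).1) hp hb ?_).2
    fun j => ?_⟩
  · obtain ⟨N, hN⟩ := VA.trunc u v
    exact ⟨N, fun j hj => by rw [hN j hj, map_zero]; rfl⟩
  · rw [hF]
    exact h.isProd_Y _ _ _

theorem PhiMod.isProd {VA : VertexAlg V} {ρ : G →* (V ≃ₗ[ℂ] V)} (M : PhiMod VA ρ χ W) (u v : V)
    (j : ℤ) : IsProd (M.E u) (M.E v) j (M.E (VA.Y u j v)) := by
  obtain ⟨f, hf, -, hb, h⟩ := M.assoc u v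
  refine (assoc_iff_isProd (c := fun j => M.E (VA.Y u j v)) hf hb ?_).1 h j
  obtain ⟨N, hN⟩ := VA.trunc u v
  refine ⟨N, fun j hj => funext fun n => ?_⟩
  rw [hN j hj]
  simpa using M.E_smul 0 0 n

/-- The map to fields, linearly. -/
def PhiMod.fieldMap {VA : VertexAlg V} {ρ : G →* (V ≃ₗ[ℂ] V)} (M : PhiMod VA ρ χ W) :
    V →ₗ[ℂ] Fld W where
  toFun := M.E
  map_add' u v := funext fun n => M.E_add u v n
  map_smul' c u := funext fun n => M.E_smul c u n

theorem PhiMod.ext_of_ι {uva : UnivVA CA V} {ρ : G →* (V ≃ₗ[ℂ] V)} {M M' : PhiMod uva.va ρ χ W}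
    (h : ∀ u, M.E (uva.ι u) = M'.E (uva.ι u)) : M.E = M'.E := by
  funext v
  refine uva.eq_top (LinearMap.eqLocus M.fieldMap M'.fieldMap)
    (funext fun n => (M.vacuum n).trans (M'.vacuum n).symm) h (fun u hu v hv n => ?_) v
  have h1 := M.isProd u v n
  rw [show M.E u = M'.E u from hu, show M.E v = M'.E v from hv] at h1
  exact h1.unique (M'.isProd u v n)

theorem PhiModD.ext_of_ι {uva : UnivVA CA V} {ρ : G →* (V ≃ₗ[ℂ] V)} {M M' : PhiModD uva.va ρ χ W}
    (hd : M.d = M'.d) (h : ∀ u, M.E (uva.ι u) = M'.E (uva.ι u)) : M = M' := by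
  have hE := PhiMod.ext_of_ι h
  obtain ⟨M, d, _⟩ := M
  obtain ⟨M', d', _⟩ := M'
  cases M
  cases M'
  cases hE
  cases hd
  rfl

theorem CTildeGMod.exists_phiModD (hχ : Function.Injective χ)
    (hG : ∀ u : C, {g : G | ∃ (i : ℕ) (v : C), CA.prod i (ρC g u) v ≠ 0}.Finite)
    (uva : UnivVA CA V) (ρV : G →* (V ≃ₗ[ℂ] V)) (hρV : ∀ g, uva.va.IsAuto (ρV g))
    (hcomp : ∀ (g : G) (u : C), ρV g (uva.ι u) = uva.ι (ρC g u)) (R : CTildeGMod CA ρC χ W) :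
    ∃ M : PhiModD uva.va ρV χ W, M.d = R.d ∧ ∀ u, M.E (uva.ι u) = R.field u := by
  have h := R.localSystem hχ hG
  let ι' : C →ₗ[ℂ] genSpace (charSet χ) (Set.range R.field) :=
    R.field.codRestrict _ fun u => Gen.base ⟨u, rfl⟩
  obtain ⟨F, ⟨hF1, hFY, hFι⟩, -⟩ := uva.univ _ h.va ι'
    (fun u => Subtype.ext (funext fun n => by
      rw [h.va_D]
      refine (R.der_rel u (-n)).trans ?_
      push_cast
      rw [neg_neg]
      rfl))
    (fun i u v => h.Y_eq (R.isProd_field hχ hG u v i))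
  let E : V →ₗ[ℂ] Fld W := (genSpace (charSet χ) (Set.range R.field)).subtype ∘ₗ F
  have hE : ∀ v, E v = (F v).1 := fun _ => rfl
  have hEι : ∀ u, E (uva.ι u) = R.field u := fun u => congrArg Subtype.val (hFι u)
  have hE1 : E uva.va.one = idF := congrArg Subtype.val hF1
  have hEp : ∀ u v j, IsProd (E u) (E v) j (E (uva.va.Y u j v)) := fun u v j => by
    rw [hE (uva.va.Y u j v), hFY]
    exact h.isProd_Y _ _ _
  have hED : ∀ v n, E (uva.va.D v) n = (n : ℂ) • E v n := fun v n => by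
    refine Eq.trans ?_ (h.va_D (F v) n)
    refine congrFun (congrArg Subtype.val ((hFY v (-2) uva.va.one).trans ?_)) n
    rw [hF1]
    rfl
  have hequiv : ∀ (g : G) (v : V) (n : ℤ), E (ρV g v) n = (χ g : ℂ) ^ n • E v n := by
    intro g v
    let Tw : Fld W →ₗ[ℂ] Fld W :=
      { toFun := fun a n => (χ g : ℂ) ^ n • a n
        map_add' := fun a b => funext fun n => smul_add _ _ _
        map_smul' := fun c a => funext fun n => smul_comm ((χ g : ℂ) ^ n) c (a n) }
    refine congrFun (uva.eq_top
      (LinearMap.eqLocus (E ∘ₗ (ρV g).toLinearMap) (Tw ∘ₗ E)) ?_ ?_ ?_ v)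
    · change E (ρV g uva.va.one) = Tw (E uva.va.one)
      rw [(hρV g).1, hE1]
      funext n
      change _ = (χ g : ℂ) ^ n • idF n
      by_cases hn : n = 0 <;> simp [idF, hn]
    · intro u
      change E (ρV g (uva.ι u)) = Tw (E (uva.ι u))
      rw [hcomp, hEι, hEι]
      funext n
      refine (R.collapse g u (-n)).trans ?_
      rw [neg_neg]
      rfl
    · intro u hu w hw n
      change E (ρV g (uva.va.Y u n w)) = Tw (E (uva.va.Y u n w))
      rw [(hρV g).2]
      have h1 := hEp (ρV g u) (ρV g w) n
      rw [show E (ρV g u) = Tw (E u) from hu, show E (ρV g w) = Tw (E w) from hw] at h1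
      exact h1.unique ((hEp u w n).twist (χ g).ne_zero)
  have hd : ∀ (v : V) (n : ℤ), R.d * E v n - E v n * R.d = (n : ℂ) • E v n := by
    intro v
    let P : Submodule ℂ V :=
      { carrier := {v | ∀ n, R.d * E v n - E v n * R.d = (n : ℂ) • E v n}
        add_mem' := fun {a b} ha hb n => by
          rw [map_add, Pi.add_apply, mul_add, add_mul, smul_add, ← ha n, ← hb n]
          abel
        zero_mem' := fun n => by simp
        smul_mem' := fun c a ha n => by
          rw [map_smul, Pi.smul_apply, mul_smul_comm, smul_mul_assoc, ← smul_sub, ha n,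
            smul_comm] }
    refine uva.eq_top P ?_ ?_ ?_ v
    · intro n
      rw [hE1]
      by_cases hn : n = 0 <;> simp [idF, hn]
    · intro u n
      rw [hEι]
      refine (R.d_rel u (-n)).trans ?_
      push_cast
      rw [neg_neg]
      rfl
    · exact fun u hu w hw j => (hEp u w j).derivation hu hw
  refine ⟨{
    E := E
    E_add := fun u v n => by rw [map_add]; rfl
    E_smul := fun c v n => by rw [map_smul]; rfl
    lower_trunc := fun v => h.isFld' (F v)
    vacuum := fun n => by rw [hE1]; by_cases hn : n = 0 <;> simp [idF, hn]
    equivar := hequiv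
    assoc := h.assoc hFY
    d := R.d
    d_comm := fun v n => by rw [hED, hd] }, rfl, hEι⟩

end

noncomputable section

theorem intChoose_neg_one (i : ℕ) : intChoose (-1) i = (-1) ^ i := by
  have h : ∏ j ∈ Finset.range i, (((-1 : ℤ) : ℂ) - (j : ℂ)) = (-1) ^ i * (i.factorial : ℂ) := by
    induction i with
    | zero => simp
    | succ i ih =>
      rw [Finset.prod_range_succ, ih, Nat.factorial_succ]
      push_cast
      ring
  rw [intChoose, h, mul_div_assoc, div_self (Nat.cast_ne_zero.2 i.factorial_ne_zero), mul_one]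

variable {C V W G : Type} [AddCommGroup C] [Module ℂ C] [AddCommGroup V] [Module ℂ V]
  [AddCommGroup W] [Module ℂ W] [Group G] {CA : ConformalAlg C} {ρC : G →* (C ≃ₗ[ℂ] C)}
  {χ : G →* ℂˣ}

theorem VertexAlg.skew (VA : VertexAlg V) (u v : V) (n : ℤ) :
    VA.Y v n u = ∑ᶠ i : ℕ, (-1 : ℂ) ^ (n + i + 1) • VA.Y (VA.Y u (n + i) v) (-1 - i) VA.one := by
  have h := VA.borcherds u v VA.one (-1) n 0
  have hR : ∀ i : ℕ, ((-1 : ℂ) ^ i * intChoose n i) •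
      (VA.Y u (-1 + n - i) (VA.Y v (0 + i) VA.one) -
        (-1 : ℂ) ^ n • VA.Y v (n + 0 - i) (VA.Y u (-1 + i) VA.one)) =
      if i = 0 then -((-1 : ℂ) ^ n • VA.Y v n u) else 0 := fun i => by
    rw [VA.create v (0 + i) (by omega), map_zero, zero_sub]
    split_ifs with hi
    · subst hi
      simp [intChoose, VA.create_neg_one]
    · rw [VA.create u (-1 + i) (by omega)]
      simp
  rw [finsum_congr hR, finsum_eq_single _ 0 fun i hi => if_neg hi, if_pos rfl] at h
  rw [show VA.Y v n u = (-(-1 : ℂ) ^ n) • -((-1 : ℂ) ^ n • VA.Y v n u) by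
    rw [smul_neg, neg_smul, neg_neg, smul_smul, ← zpow_add₀ (by norm_num),
      Even.neg_one_zpow ⟨n, rfl⟩, one_smul], ← h, smul_finsum]
  refine finsum_congr fun i => ?_
  rw [smul_smul, intChoose_neg_one, add_zero, zpow_add₀ (by norm_num), zpow_add₀ (by norm_num),
    zpow_natCast, zpow_one]
  congr 1
  ring

namespace PhiMod

variable {VA : VertexAlg V} {ρ : G →* (V ≃ₗ[ℂ] V)} (M : PhiMod VA ρ χ W)

theorem E_zero (n : ℤ) : M.E 0 n = 0 := by simpa using M.E_smul 0 0 n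

theorem E_one : M.E VA.one = idF := funext fun n => by
  rw [M.vacuum]
  by_cases hn : n = 0 <;> simp [idF, hn]

theorem E_creation (v : V) (j N : ℤ) :
    M.E (VA.Y v j VA.one) N = (exL (N : ℂ)).coeff (-j - 1) • M.E v N := by
  have h := M.isProd v VA.one j
  rw [M.E_one] at h
  exact congrFun (h.unique (isProd_idF_right (M.E v) j fun _ => rfl)) N

theorem E_D (v : V) (N : ℤ) : M.E (VA.D v) N = (N : ℂ) • M.E v N := by
  rw [VertexAlg.D, E_creation, exL_coeff]
  simp

theorem tors (u v : V) (N : ℤ) (ω : W) (l : Module.Dual ℂ W) :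
    Tors fun m => l (M.E u m (M.E v (N - m) ω)) := by
  obtain ⟨f, hf, -, hb, -⟩ := M.assoc u v
  obtain ⟨K, hK⟩ := hb ω
  exact ⟨pl f, pl_ne_zero hf, finite_of_pCoeff2_bound hK N l⟩

/-- Both orders of composition have the same expansion. -/
theorem eps_swap (u v : V) (N : ℤ) (ω : W) (l : Module.Dual ℂ W) :
    eps (fun m => l (M.E u m (M.E v (N - m) ω))) =
      eps (fun m => l (M.E v (N - m) (M.E u m ω))) := by
  have hr := eps_reverse N (M.tors v u N ω l)
  simp only [sub_sub_cancel] at hr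
  rw [hr]
  ext r
  obtain ⟨n, rfl⟩ : ∃ n : ℤ, r = -n - 1 := ⟨-r - 1, by ring⟩
  rw [coeff_mul_finsum, ← M.isProd u v n N ω l, VA.skew v u n]
  let L : V →ₗ[ℂ] ℂ := l ∘ₗ LinearMap.applyₗ ω ∘ₗ LinearMap.proj N ∘ₗ M.fieldMap
  have hL : ∀ x, l (M.E x N ω) = L x := fun _ => rfl
  have hfin : (Function.support fun i : ℕ =>
      (-1 : ℂ) ^ (n + i + 1) • VA.Y (VA.Y v (n + i) u) (-1 - i) VA.one).Finite := by
    obtain ⟨K, hK⟩ := VA.trunc v u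
    refine (Set.finite_lt_nat (K - n).toNat).subset fun i hi => ?_
    by_contra hn
    simp only [Set.mem_ofPred_eq, not_lt] at hn
    refine hi ?_
    have h0 : VA.Y 0 (-1 - i) = 0 := by simpa using VA.Y_smul 0 0 (-1 - i)
    simp only [hK (n + i) (by omega), h0, LinearMap.zero_apply, smul_zero]
  rw [hL, map_finsum L hfin, ← finsum_mem_univ (f := fun j : ℤ => _)]
  rw [finsum_mem_inter_support_eq' _ _ (Set.range fun i : ℕ => n + (i : ℤ)),
    finsum_mem_range fun i j hij => by simpa using hij]
  · refine finsum_congr fun i => ?_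
    rw [map_smul, ← hL, M.E_creation, nu_coeff, ← M.isProd v u, LinearMap.smul_apply, map_smul,
      show -(-1 - (i : ℤ)) - 1 = i by ring, show -n - 1 + (n + (i : ℤ)) + 1 = i by ring,
      show -(n + (i : ℤ)) - 1 = -(n + i + 1) by ring, zpow_neg, ← inv_zpow, inv_neg_one]
    simp only [smul_eq_mul]
    ring
  · refine fun j hj => iff_of_true (Set.mem_univ _) ?_
    by_contra hn
    refine hj ?_
    have : j < n := by
      by_contra h'
      exact hn ⟨(j - n).toNat, by simp; omega⟩
    simp only [exL_coeff]
    rw [if_pos (by omega), zero_mul]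

theorem locS (u v : V) : LocS (charSet χ) (M.E u) (M.E v) := by
  obtain ⟨f, hf, hfr, hb, -⟩ := M.assoc u v
  obtain ⟨f', hf', hfr', hb', -⟩ := M.assoc v u
  refine ⟨pl f * inv1 (pl f'), mul_mem (pl_mem_MG hf hfr)
    (inv1_mem_MG zero_notMem_charSet inv_mem_charSet (pl_mem_MG hf' hfr')), fun N ω l => ?_⟩
  obtain ⟨K, hK⟩ := hb ω
  obtain ⟨K', hK'⟩ := hb' ω
  have h1 := finite_of_pCoeff2_bound hK N l
  have h2 : (cv ℤ (inv1 (pl f')) fun m => l (M.E v (N - m) (M.E u m ω))).support.Finite := by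
    have h2 := finite_of_pCoeff2_bound hK' N l
    refine (h2.image fun m => N - m).subset fun m hm => ⟨N - m, ?_, by ring⟩
    have e := cv_inv1 (pl f') (fun m => l (M.E v (N - m) (M.E u m ω))) N (N - m)
    simp only [sub_sub_cancel] at e
    rw [Function.mem_support] at hm ⊢
    rwa [← e]
  have h3 := cv_finite (inv1 (pl f')) _ h1
  have h4 := cv_finite (pl f) _ h2
  rw [← cv_mul, mul_comm] at h3
  rw [← cv_mul] at h4
  obtain ⟨x, hx⟩ := exists_symbol h3
  obtain ⟨y, hy⟩ := exists_symbol h4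
  rw [hx, hy]
  refine congrArg (fun z : AddMonoidAlgebra ℂ ℤ => (z.coeff : ℤ → ℂ)) (ev_injective ?_)
  rw [← eps_symbol, ← eps_symbol, ← hx, ← hy, eps_cv, eps_cv, M.eps_swap]

end PhiMod

end

noncomputable section

variable {C V W G : Type} [AddCommGroup C] [Module ℂ C] [AddCommGroup V] [Module ℂ V]
  [AddCommGroup W] [Module ℂ W] [Group G] {CA : ConformalAlg C} {ρC : G →* (C ≃ₗ[ℂ] C)}
  {χ : G →* ℂˣ}

open Classical in
theorem PhiMod.commutator (hχ : Function.Injective χ) {uva : UnivVA CA V}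
    {ρV : G →* (V ≃ₗ[ℂ] V)}
    (hcomp : ∀ (g : G) (u : C), ρV g (uva.ι u) = uva.ι (ρC g u)) (M : PhiMod uva.va ρV χ W)
    {u v : C} {s : Finset G} {I : ℕ} (hs : ∀ g ∉ s, ∀ i, CA.prod i (ρC g u) v = 0)
    (hI : ∀ g i, I ≤ i → CA.prod i (ρC g u) v = 0) (N : ℤ) (ω : W) (l : Module.Dual ℂ W) (m : ℤ) :
    l (M.E (uva.ι u) m (M.E (uva.ι v) (N - m) ω)) - l (M.E (uva.ι v) (N - m) (M.E (uva.ι u) m ω)) =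
      ∑ α ∈ s.image fun g => (χ g : ℂ), ∑ i ∈ Finset.range I,
        l (M.E (uva.ι (CA.prod i (ρC (Function.invFun (fun g => (χ g : ℂ)) α) u) v)) N ω) *
          qexp α i m := by
  obtain ⟨f, hf, hloc⟩ := M.locS (uva.ι u) (uva.ι v)
  obtain ⟨K, hK⟩ := M.lower_trunc (uva.ι v) ω
  obtain ⟨K', hK'⟩ := M.lower_trunc (uva.ι u) ω
  refine sub_eq_of_eps_coeff zero_notMem_charSet hf (M := N - K + 1) (M' := K')
    (A := fun m => l (M.E (uva.ι u) m (M.E (uva.ι v) (N - m) ω)))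
    (B := fun m => l (M.E (uva.ι v) (N - m) (M.E (uva.ι u) m ω)))
    (q := fun α i =>
      l (M.E (uva.ι (CA.prod i (ρC (Function.invFun (fun g => (χ g : ℂ)) α) u) v)) N ω))
    (fun α hα => by obtain ⟨g, -, rfl⟩ := Finset.mem_image.1 hα; exact ⟨g, rfl⟩)
    (fun m hm => by rw [hK _ (by omega), map_zero, map_zero])
    (fun m hm => by rw [hK' _ hm, map_zero, map_zero]) ?_ (hloc N ω l) m
  rintro _ ⟨g, rfl⟩ j
  have e : tw (χ g : ℂ) (fun m => l (M.E (uva.ι u) m (M.E (uva.ι v) (N - m) ω))) =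
      fun m => l (M.E (uva.ι (ρC g u)) m (M.E (uva.ι v) (N - m) ω)) := funext fun m => by
    rw [tw_apply, ← hcomp, M.equivar, LinearMap.smul_apply, map_smul, smul_eq_mul]
  simp only [invFun_char hχ]
  rw [e, ← M.isProd _ _ _ N ω l, uva.ι_prod]
  split_ifs with h
  · rfl
  · have h0 : CA.prod j (ρC g u) v = 0 := by
      by_cases hg : g ∈ s
      · refine hI g j ?_
        by_contra hj
        exact h ⟨Finset.mem_image_of_mem _ hg, by omega⟩
      · exact hs g hg j
    rw [h0, map_zero, M.E_zero, LinearMap.zero_apply, map_zero]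

/-- The module for the covariance algebra underlying a `φ`-coordinated module. -/
def PhiModD.toCTildeGMod (hχ : Function.Injective χ)
    (hG : ∀ u : C, {g : G | ∃ (i : ℕ) (v : C), CA.prod i (ρC g u) v ≠ 0}.Finite)
    {uva : UnivVA CA V} {ρV : G →* (V ≃ₗ[ℂ] V)}
    (hcomp : ∀ (g : G) (u : C), ρV g (uva.ι u) = uva.ι (ρC g u)) (M : PhiModD uva.va ρV χ W) :
    CTildeGMod CA ρC χ W where
  T u n := M.E (uva.ι u) (-n)
  T_add u v n := by rw [map_add, M.E_add]
  T_smul c u n := by rw [map_smul, M.E_smul]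
  d := M.d
  rel u v m n := by
    classical
    obtain ⟨s, I, -, hs, hI⟩ := ConformalAlg.exists_bounds hG u v
    rw [finsum_finsum_smul (s := s) (I := I) _
      (fun g hg i => by rw [hs g hg i, map_zero, M.E_zero])
      (fun g i hi => by rw [hI g i hi, map_zero, M.E_zero])]
    refine LinearMap.ext fun ω => eq_of_dual fun l => ?_
    have h := M.commutator hχ hcomp hs hI (-(m + n)) ω l (-m)
    rw [show -(m + n) - -m = -n by ring] at h
    rw [LinearMap.sub_apply, map_sub]
    refine h.trans ?_
    rw [Finset.sum_image (val_injective hχ).injOn]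
    simp only [LinearMap.sum_apply, map_sum, invFun_char hχ]
    refine Finset.sum_congr rfl fun g _ => Finset.sum_congr rfl fun i _ => ?_
    rw [LinearMap.smul_apply, map_smul, qexp, smul_eq_mul, mul_comm]
    simp
  der_rel u m := by
    rw [uva.ι_der, M.E_D]
    push_cast
    rfl
  collapse g u m := by rw [← hcomp, M.equivar]
  d_rel u m := by
    rw [M.d_comm, M.E_D]
    push_cast
    rfl
  res u ω := by
    obtain ⟨N, hN⟩ := M.lower_trunc (uva.ι u) ω
    exact ⟨-N + 1, fun n hn => hN _ (by omega)⟩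

theorem CTildeGMod.ext_of_T {R R' : CTildeGMod CA ρC χ W} (hd : R.d = R'.d) (h : R.T = R'.T) :
    R = R' := by
  cases R
  cases R'
  cases hd
  cases h
  rfl

end

/-- Let `𝒞` be a `G`-conformal algebra and `χ : G → ℂ×` an injective
linear character.  Then the `(G,χ)`-equivariant `φ`-coordinated quasi `V_𝒞`-modules
`(W, Y_W^φ, d)` are exactly the restricted `𝒞̃[G]`-modules `W`, under the correspondence
`d = 𝐝` and `Y_W^φ(u, z) = u[z] = ∑ₙ u[n]‾ z^{-n}` for `u ∈ 𝒞`. -/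
theorem statement_4 {C V W : Type} [AddCommGroup C] [Module ℂ C]
    [AddCommGroup V] [Module ℂ V] [AddCommGroup W] [Module ℂ W]
    {G : Type} [Group G] (CA : ConformalAlg C)
    (ρC : G →* (C ≃ₗ[ℂ] C))
    (hρC : ∀ g : G, (∀ u, ρC g (CA.der u) = CA.der (ρC g u)) ∧
      ∀ (i : ℕ) (u v : C), ρC g (CA.prod i u v) = CA.prod i (ρC g u) (ρC g v))
    (hGconf : ∀ u : C, {g : G | ∃ (i : ℕ) (v : C), CA.prod i (ρC g u) v ≠ 0}.Finite)
    (χ : G →* ℂˣ) (hχ : Function.Injective χ)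
    (uva : UnivVA CA V)
    (ρV : G →* (V ≃ₗ[ℂ] V)) (hρV : ∀ g, uva.va.IsAuto (ρV g))
    (hcomp : ∀ (g : G) (u : C), ρV g (uva.ι u) = uva.ι (ρC g u)) :
    (∀ R : CTildeGMod CA ρC χ W, ∃! M : PhiModD uva.va ρV χ W,
        M.d = R.d ∧ ∀ (u : C) (n : ℤ), M.E (uva.ι u) n = R.T u (-n)) ∧
    (∀ M : PhiModD uva.va ρV χ W, ∃! R : CTildeGMod CA ρC χ W,
        M.d = R.d ∧ ∀ (u : C) (n : ℤ), M.E (uva.ι u) n = R.T u (-n)) := by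
  constructor
  · intro R
    obtain ⟨M, hd, hE⟩ := R.exists_phiModD hχ hGconf uva ρV hρV hcomp
    refine ⟨M, ⟨hd, fun u n => congrFun (hE u) n⟩, fun M' hM' => ?_⟩
    exact PhiModD.ext_of_ι (hM'.1.trans hd.symm) fun u =>
      funext fun n => (hM'.2 u n).trans (congrFun (hE u) n).symm
  · intro M
    refine ⟨M.toCTildeGMod hχ hGconf hcomp,
      ⟨rfl, fun u n => congrArg (M.E (uva.ι u)) (neg_neg n).symm⟩, fun R hR => ?_⟩
    refine CTildeGMod.ext_of_T hR.1.symm (funext fun u => funext fun n => ?_)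
    have h := hR.2 u (-n)
    rw [neg_neg] at h
    exact h.symm

end
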